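/- Let n ≥ 2 be an integer. There exist d' > 0, δ > 0 and a positive integer k' (depending only on n) such that for every finite field K of characteristic ≠ 2, for all real numbers d, ε > 0, and for every set A ⊆ SL_n(K) generating SL_n(K) and satisfying |A·A·A| ≤ d·|A|^{1+ε}, we have |cl(A')| ≤ (d'·d^δ)·|A_{k'}|^{1/(n+1) + δε}, where A' is the set of semisimple elements of A. -/

import Mathlib

open Pointwise

/-- `A_r = (A ∪ A⁻¹ ∪ {1})^r`. -/
def prodSet {G : Type*} [Group G] (A : Set G) (r : ℕ) : Set G :=
  (A ∪ A⁻¹ ∪ {1}) ^ r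

/-- An element of `SL_n(K)` is semisimple if it is diagonalizable over the algebraic
closure `K̄`. -/
def IsSemisimpleElt (n : ℕ) (K : Type*) [Field K]
    (g : Matrix.SpecialLinearGroup (Fin n) K) : Prop :=
  ∃ (P : (Matrix (Fin n) (Fin n) (AlgebraicClosure K))ˣ)
    (d : Matrix (Fin n) (Fin n) (AlgebraicClosure K)), d.IsDiag ∧
      (g : Matrix (Fin n) (Fin n) K).map (algebraMap K (AlgebraicClosure K)) =
        (P : Matrix (Fin n) (Fin n) (AlgebraicClosure K)) * d *
          ((P⁻¹ : (Matrix (Fin n) (Fin n) (AlgebraicClosure K))ˣ) :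
            Matrix (Fin n) (Fin n) (AlgebraicClosure K))

open MvPolynomial in
/-- The substitution `X_i ↦ x_i + t v_i` where the `v_i` are polynomials. -/
noncomputable def lineSubst {σ K : Type} [Field K] (x : σ → K) (v : σ → MvPolynomial σ K) :
    MvPolynomial σ K →ₐ[K] Polynomial (MvPolynomial σ K) :=
  aeval (fun i => Polynomial.C (C (x i)) + Polynomial.X * Polynomial.C (v i))

open MvPolynomial in
theorem lineSubst_coeff_zero {σ K : Type} [Field K] (x : σ → K) (v : σ → MvPolynomial σ K)
    (p : MvPolynomial σ K) : (lineSubst x v p).coeff 0 = C (eval x p) := by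
  induction p using MvPolynomial.induction_on with
  | C a => simp [lineSubst, MvPolynomial.algebraMap_eq]
  | add p q hp hq => simp [hp, hq]
  | mul_X p i hp => simp [Polynomial.mul_coeff_zero, hp]; simp [lineSubst]

open MvPolynomial in
theorem lineSubst_coeff_one {σ K : Type} [Field K] [Fintype σ] (x : σ → K)
    (v : σ → MvPolynomial σ K) (p : MvPolynomial σ K) :
    (lineSubst x v p).coeff 1 = ∑ i, C (eval x (pderiv i p)) * v i := by
  classical
  induction p using MvPolynomial.induction_on with
  | C a =>
    simp [lineSubst, Polynomial.algebraMap_apply]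
  | add p q hp hq => simp [hp, hq, add_mul, Finset.sum_add_distrib]
  | mul_X p i hp =>
    have h : lineSubst x v (X i) = Polynomial.C (C (x i)) + Polynomial.X * Polynomial.C (v i) := by
      simp [lineSubst]
    rw [map_mul, h, mul_add, Polynomial.coeff_add, Polynomial.coeff_mul_C, hp, ← mul_assoc,
      Polynomial.coeff_mul_C, Polynomial.coeff_mul_X, lineSubst_coeff_zero]
    simp only [Derivation.leibniz, pderiv_X, smul_eq_mul, map_add, map_mul, eval_X, add_mul,
      Finset.sum_add_distrib]
    rw [add_comm]
    congr 1
    · rw [Finset.sum_eq_single i]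
      · simp
      · intro b _ hb
        simp [hb.symm]
      · simp
    · rw [Finset.sum_mul]
      exact Finset.sum_congr rfl fun _ _ => by ring

open MvPolynomial in
theorem aeval_dualNumber {σ K : Type} [Field K] [Fintype σ] (x v : σ → K)
    (p : MvPolynomial σ K) :
    aeval (fun i => (algebraMap K (DualNumber K) (x i) +
        algebraMap K (DualNumber K) (v i) * DualNumber.eps)) p
      = algebraMap K (DualNumber K) (eval x p)
        + algebraMap K (DualNumber K) (∑ i, eval x (pderiv i p) * v i) * DualNumber.eps := by
  classical
  induction p using MvPolynomial.induction_on with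
  | C a => simp
  | add p q hp hq =>
    simp only [map_add, hp, hq, add_mul, Finset.sum_add_distrib]; ring
  | mul_X p i hp =>
    have e : ∑ j, eval x (pderiv j (p * X i)) * v j =
        (∑ j, eval x (pderiv j p) * v j) * x i + eval x p * v i := by
      simp only [Derivation.leibniz, pderiv_X, smul_eq_mul, map_add, map_mul, eval_X, add_mul,
        Finset.sum_add_distrib]
      rw [add_comm]
      congr 1
      · rw [Finset.sum_mul]
        exact Finset.sum_congr rfl fun _ _ => by ring
      · rw [Finset.sum_eq_single i]
        · simp
        · intro b _ hb
          simp [hb.symm]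
        · simp
    rw [e]
    simp only [map_mul, hp, aeval_X, map_add, eval_X]
    have h2 : (DualNumber.eps : DualNumber K) * DualNumber.eps = 0 := DualNumber.eps_mul_eps
    linear_combination (algebraMap K (DualNumber K) (∑ i, eval x (pderiv i p) * v i)) *
      algebraMap K (DualNumber K) (v i) * h2

open MvPolynomial in
theorem bezout_local {σ K : Type} [Field K] [Fintype σ] [DecidableEq σ]
    (f : σ → MvPolynomial σ K) (g : MvPolynomial σ K)
    (x : σ → K) (hx : ∀ i, eval x (f i) = 0)
    (hJ : (Matrix.of fun i j => eval x (pderiv j (f i))).det ≠ 0)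
    (A r : ℕ) (c : Fin A × (σ → Fin A) → K)
    (hc : ∑ p, c p • (g ^ (p.1 : ℕ) * ∏ i, f i ^ (p.2 i : ℕ)) = 0)
    (hr : ∀ p, c p ≠ 0 → r ≤ ∑ i, (p.2 i : ℕ))
    (β₀ : σ → Fin A) (h₀ : ∑ i, (β₀ i : ℕ) = r) :
    ∑ a : Fin A, c (a, β₀) * eval x g ^ (a : ℕ) = 0 := by
  set J : Matrix σ σ K := Matrix.of fun i j => eval x (pderiv j (f i)) with hJdef
  set v : σ → MvPolynomial σ K := fun i => ∑ j, C (J⁻¹ i j) * X j with hv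
  have hF : ∀ i, ∃ F : Polynomial (MvPolynomial σ K), lineSubst x v (f i) = Polynomial.X * F ∧
      F.coeff 0 = X i := by
    intro i
    have h0 : (lineSubst x v (f i)).coeff 0 = 0 := by
      rw [lineSubst_coeff_zero, hx i, map_zero]
    obtain ⟨F, hF⟩ := Polynomial.X_dvd_iff.mpr h0
    refine ⟨F, hF, ?_⟩
    have h1 := lineSubst_coeff_one x v (f i)
    rw [hF, Polynomial.coeff_X_mul] at h1
    rw [h1]
    have : ∀ k, C (eval x (pderiv k (f i))) * v k = ∑ j, C (J i k * J⁻¹ k j) * X j := by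
      intro k
      simp only [hv, Finset.mul_sum, map_mul, ← mul_assoc]
      rfl
    simp only [this]
    rw [Finset.sum_comm]
    have h2 : ∀ j, ∑ k, C (J i k * J⁻¹ k j) * X j =
        (C ((1 : Matrix σ σ K) i j) * X j : MvPolynomial σ K) := by
      intro j
      rw [← Finset.sum_mul, ← map_sum, ← Matrix.mul_nonsing_inv J (Ne.isUnit hJ), Matrix.mul_apply]
    simp only [h2]
    rw [Finset.sum_eq_single i]
    · simp
    · intro b _ hb
      simp [hb.symm]
    · simp
  choose F hF1 hF0 using hF
  have key := congrArg (fun p => (lineSubst x v p).coeff r) hc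
  simp only [map_sum, map_smul, map_mul, map_pow, map_prod, hF1, map_zero,
    Polynomial.coeff_zero, Polynomial.finsetSum_coeff] at key
  have key2 : ∀ p : Fin A × (σ → Fin A),
      (c p • ((lineSubst x v) g ^ (p.1 : ℕ) * ∏ i, (Polynomial.X * F i) ^ (p.2 i : ℕ))).coeff r
      = if ∑ i, (p.2 i : ℕ) = r then
          monomial (Finsupp.equivFunOnFinite.symm fun i => (p.2 i : ℕ)) (c p * eval x g ^ (p.1 : ℕ))
        else 0 := by
    intro p
    by_cases hcp : c p = 0
    · simp [hcp]
    have h1 : (c p • ((lineSubst x v) g ^ (p.1 : ℕ) * ∏ i, (Polynomial.X * F i) ^ (p.2 i : ℕ)))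
        = (c p • ((lineSubst x v) g ^ (p.1 : ℕ) * ∏ i, (F i) ^ (p.2 i : ℕ))) *
          Polynomial.X ^ (∑ i, (p.2 i : ℕ)) := by
      simp only [mul_pow, Finset.prod_mul_distrib, Finset.prod_pow_eq_pow_sum, smul_mul_assoc]
      congr 1; ring
    rw [h1, Polynomial.coeff_mul_X_pow']
    have := hr p hcp
    split_ifs with h2 h3 h3
    · rw [h3, Nat.sub_self]
      rw [Polynomial.coeff_smul, Polynomial.mul_coeff_zero, Polynomial.coeff_zero_eq_eval_zero,
        Polynomial.coeff_zero_eq_eval_zero, Polynomial.eval_pow, Polynomial.eval_prod]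
      simp only [Polynomial.eval_pow, ← Polynomial.coeff_zero_eq_eval_zero, hF0,
        lineSubst_coeff_zero]
      rw [MvPolynomial.smul_eq_C_mul, ← map_pow, ← mul_assoc, ← map_mul, MvPolynomial.monomial_eq]
      congr 1
      rw [Finsupp.prod_fintype]
      · simp
      · simp
    · omega
    · omega
    · rfl
  simp only [key2] at key
  have key3 := congrArg (coeff (Finsupp.equivFunOnFinite.symm fun i => (β₀ i : ℕ))) key
  simp only [coeff_sum, coeff_zero] at key3
  rw [Fintype.sum_prod_type] at key3
  rw [← key3]
  refine Finset.sum_congr rfl fun a _ => ?_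
  rw [Finset.sum_eq_single β₀]
  · simp [h₀]
  · intro β _ hβ
    split_ifs with h
    · rw [coeff_monomial, if_neg]
      intro h'
      apply hβ
      have := Finsupp.equivFunOnFinite.symm.injective h'
      funext i
      exact Fin.ext (congrFun this i)
    · simp
  · simp

open MvPolynomial in
theorem exists_relation {σ K : Type} [Field K] [Fintype σ] [DecidableEq σ] (D A : ℕ)
    (hA : (1 + Fintype.card σ * D) ^ Fintype.card σ < A)
    (f : σ → MvPolynomial σ K) (hf : ∀ i, (f i).totalDegree ≤ D)
    (g : MvPolynomial σ K) (hg : g.totalDegree ≤ 1) :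
    ∃ c : Fin A × (σ → Fin A) → K, c ≠ 0 ∧
      ∑ p, c p • (g ^ (p.1 : ℕ) * ∏ i, f i ^ (p.2 i : ℕ)) = 0 := by
  set N := Fintype.card σ with hN
  set M := A * (1 + N * D) with hM
  let w : Fin A × (σ → Fin A) → MvPolynomial σ K := fun p => g ^ (p.1 : ℕ) * ∏ i, f i ^ (p.2 i : ℕ)
  have hApos : 0 < A := by omega
  have hw : ∀ p, (w p).totalDegree < M := by
    intro p
    have h1 : (w p).totalDegree ≤ (p.1 : ℕ) * 1 + ∑ i, (p.2 i : ℕ) * D := by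
      refine (totalDegree_mul _ _).trans (add_le_add ?_ ?_)
      · exact (totalDegree_pow _ _).trans (Nat.mul_le_mul_left _ hg)
      · refine (totalDegree_finsetProd _ _).trans (Finset.sum_le_sum fun i _ => ?_)
        exact (totalDegree_pow _ _).trans (Nat.mul_le_mul_left _ (hf i))
    have h2 : ∑ i, (p.2 i : ℕ) * D ≤ ∑ _i : σ, (A - 1) * D :=
      Finset.sum_le_sum fun i _ => Nat.mul_le_mul_right _ (by have := (p.2 i).2; omega)
    rw [Finset.sum_const, Finset.card_univ, smul_eq_mul] at h2
    have h3 : (p.1 : ℕ) ≤ A - 1 := by have := p.1.2; omega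
    calc (w p).totalDegree ≤ (A - 1) * (1 + N * D) := by
          refine h1.trans ?_
          have : N * ((A - 1) * D) = (A - 1) * (N * D) := by ring
          rw [← hN] at h2
          rw [mul_add, ← this]
          omega
      _ < M := Nat.mul_lt_mul_of_pos_right (by omega) (by omega)
  let L : (Fin A × (σ → Fin A) → K) →ₗ[K] ((σ → Fin M) → K) :=
    { toFun := fun c m => coeff (Finsupp.equivFunOnFinite.symm fun i => (m i : ℕ)) (∑ p, c p • w p)
      map_add' := fun a b => by
        funext m; simp [add_smul, Finset.sum_add_distrib, coeff_sum]
      map_smul' := fun a b => by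
        funext m; simp [coeff_sum, Finset.mul_sum, mul_assoc] }
  have hdim : Module.finrank K ((σ → Fin M) → K) < Module.finrank K (Fin A × (σ → Fin A) → K) := by
    rw [Module.finrank_fintype_fun_eq_card, Module.finrank_fintype_fun_eq_card]
    simp only [Fintype.card_prod, Fintype.card_fun, Fintype.card_fin]
    rw [hM, mul_pow, mul_comm A]
    rw [mul_comm]
    rw [mul_comm (A ^ _) A]
    exact Nat.mul_lt_mul_of_pos_right hA (by positivity)
  have hker := LinearMap.ker_ne_bot_of_finrank_lt (f := L) hdim
  obtain ⟨c, hc, hc0⟩ := (Submodule.ne_bot_iff _).mp hker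
  refine ⟨c, hc0, ?_⟩
  ext m
  rw [coeff_zero]
  by_cases hm : ∀ i, m i < M
  · have := congrFun (LinearMap.mem_ker.mp hc) (fun i => ⟨m i, hm i⟩)
    have e : (Finsupp.equivFunOnFinite.symm fun i => m i) = m := by ext; simp
    simpa [L, e] using this
  · push Not at hm
    obtain ⟨i, hi⟩ := hm
    rw [coeff_sum]
    refine Finset.sum_eq_zero fun p _ => ?_
    rw [coeff_smul, coeff_eq_zero_of_totalDegree_lt, smul_zero]
    refine (hw p).trans_le (hi.trans ?_)
    by_cases h0 : m i = 0
    · omega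
    · exact Finset.single_le_sum (f := fun i => m i) (fun _ _ => Nat.zero_le _)
        (Finsupp.mem_support_iff.mpr h0)

open MvPolynomial in
theorem bezout_square (σ : Type) [Fintype σ] [DecidableEq σ] (D : ℕ) :
    ∃ C : ℕ, ∀ (K : Type) [Field K] (f : σ → MvPolynomial σ K),
      (∀ i, (f i).totalDegree ≤ D) → ∀ Z : Finset (σ → K),
      (∀ x ∈ Z, (∀ i, eval x (f i) = 0) ∧
        (Matrix.of fun i j => eval x (pderiv j (f i))).det ≠ 0) → Z.card ≤ C := by
  set A := (1 + Fintype.card σ * D) ^ Fintype.card σ + 1 with hA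
  refine ⟨A ^ Fintype.card σ, ?_⟩
  intro K _ f hf Z hZ
  have : DecidableEq K := Classical.decEq K
  have hcoord : ∀ j : σ, (Z.image fun x => x j).card ≤ A := by
    intro j
    obtain ⟨c, hc0, hc⟩ := exists_relation D A (by omega) f hf (X j)
      (by rw [totalDegree_X])
    obtain ⟨p₁, hp₁⟩ := Function.ne_iff.mp hc0
    classical
    let S : Finset (Fin A × (σ → Fin A)) := Finset.univ.filter fun p => c p ≠ 0
    have hS : S.Nonempty := ⟨p₁, by simpa [S] using hp₁⟩
    obtain ⟨p₀, hp₀, hmin⟩ := S.exists_min_image (fun p => ∑ i, (p.2 i : ℕ)) hS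
    have hmin' : ∀ p, c p ≠ 0 → ∑ i, (p₀.2 i : ℕ) ≤ ∑ i, (p.2 i : ℕ) := fun p hp =>
      hmin p (by simpa [S] using hp)
    let P : Polynomial K := ∑ a : Fin A, Polynomial.C (c (a, p₀.2)) * Polynomial.X ^ (a : ℕ)
    have hPc : ∀ a : Fin A, P.coeff a = c (a, p₀.2) := by
      intro a
      simp only [P, Polynomial.finsetSum_coeff, Polynomial.coeff_C_mul_X_pow]
      rw [Finset.sum_eq_single a]
      · simp
      · intro b _ hb
        rw [if_neg]
        intro h; exact hb (Fin.ext h.symm)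
      · simp
    have hP0 : P ≠ 0 := by
      intro h
      have := hPc p₀.1
      rw [h, Polynomial.coeff_zero] at this
      exact (by simpa [S] using hp₀ : c p₀ ≠ 0) this.symm
    have hPd : P.natDegree ≤ A := by
      refine Polynomial.natDegree_sum_le_of_forall_le _ _ fun a _ => ?_
      exact (Polynomial.natDegree_C_mul_X_pow_le _ _).trans a.2.le
    have hsub : (Z.image fun x => x j) ⊆ P.roots.toFinset := by
      intro y hy
      obtain ⟨x, hx, rfl⟩ := Finset.mem_image.mp hy
      rw [Multiset.mem_toFinset, Polynomial.mem_roots hP0, Polynomial.IsRoot.def]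
      have := bezout_local f (X j) x (hZ x hx).1 (hZ x hx).2 A _ c hc hmin' p₀.2 rfl
      simpa [P, Polynomial.eval_finsetSum] using this
    calc _ ≤ P.roots.toFinset.card := Finset.card_le_card hsub
      _ ≤ P.roots.card := Multiset.toFinset_card_le _
      _ ≤ P.natDegree := P.card_roots'
      _ ≤ A := hPd
  have hsub : Z ⊆ Fintype.piFinset fun j => Z.image fun x => x j := by
    intro x hx
    rw [Fintype.mem_piFinset]
    exact fun j => Finset.mem_image_of_mem _ hx
  refine (Finset.card_le_card hsub).trans ?_
  rw [Fintype.card_piFinset]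
  refine (Finset.prod_le_prod (fun _ _ => Nat.zero_le _) fun j _ => hcoord j).trans ?_
  simp

theorem exists_minor {σ ρ K : Type} [Field K] [Fintype σ] [Fintype ρ] [DecidableEq σ]
    (M : ρ → σ → K) (h : ∀ v : σ → K, (∀ r, ∑ i, M r i * v i = 0) → v = 0) :
    ∃ ι : σ → ρ, (Matrix.of fun i j => M (ι i) j).det ≠ 0 := by
  classical
  have hspan : Submodule.span K (Set.range M) = ⊤ := by
    have hr : (Matrix.of M).rank = Fintype.card σ := by
      rw [Matrix.rank]
      rw [LinearMap.finrank_range_of_inj]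
      · simp
      · rw [← LinearMap.ker_eq_bot, LinearMap.ker_eq_bot']
        intro v hv
        exact h v fun r => congrFun hv r
    rw [Matrix.rank_eq_finrank_span_row] at hr
    apply Submodule.eq_top_of_finrank_eq
    rw [Module.finrank_fintype_fun_eq_card]
    exact hr
  obtain ⟨κ, a, ha, hs, hli⟩ := exists_linearIndependent' K M
  let b := Module.Basis.mk hli (by rw [hs, hspan])
  let e : σ ≃ κ := (Pi.basisFun K σ).indexEquiv b
  refine ⟨a ∘ e, ?_⟩
  have hli2 : LinearIndependent K (fun i => M (a (e i))) := hli.comp e e.injective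
  have := Matrix.linearIndependent_rows_iff_isUnit (A := Matrix.of fun i j => M ((a ∘ e) i) j)
  have h2 := this.mp hli2
  exact ((Matrix.isUnit_iff_isUnit_det _).mp h2).ne_zero

open MvPolynomial in
/-- A polynomial system of bounded degree has boundedly many solutions which are rigid to first
order, i.e. do not deform over the dual numbers. -/
theorem bezout_dual (σ ρ : Type) [Fintype σ] [Fintype ρ] (D : ℕ) :
    ∃ C : ℕ, ∀ (K : Type) [Field K] (f : ρ → MvPolynomial σ K),
      (∀ i, (f i).totalDegree ≤ D) → ∀ Z : Finset (σ → K),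
      (∀ x ∈ Z, (∀ i, eval x (f i) = 0) ∧
        ∀ v : σ → K, (∀ i, aeval (fun i => (algebraMap K (DualNumber K) (x i) +
          algebraMap K (DualNumber K) (v i) * DualNumber.eps)) (f i) = 0) → v = 0) →
      Z.card ≤ C := by
  classical
  obtain ⟨C, hC⟩ := bezout_square σ D
  refine ⟨Fintype.card (σ → ρ) * C, ?_⟩
  intro K _ f hf Z hZ
  have hmin : ∀ x ∈ Z, ∃ ι : σ → ρ,
      (Matrix.of fun i j => eval x (pderiv j (f (ι i)))).det ≠ 0 := by
    intro x hx
    refine exists_minor (fun r i => eval x (pderiv i (f r))) fun v hv => (hZ x hx).2 v fun r => ?_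
    rw [aeval_dualNumber, (hZ x hx).1 r, hv r]
    simp
  have hsub : Z ⊆ Finset.univ.biUnion fun ι : σ → ρ =>
      Z.filter fun x => (Matrix.of fun i j => eval x (pderiv j (f (ι i)))).det ≠ 0 := by
    intro x hx
    obtain ⟨ι, hι⟩ := hmin x hx
    simp only [Finset.mem_biUnion, Finset.mem_univ, true_and, Finset.mem_filter]
    exact ⟨ι, hx, hι⟩
  refine (Finset.card_le_card hsub).trans (Finset.card_biUnion_le.trans ?_)
  refine (Finset.sum_le_card_nsmul _ _ C fun ι _ => ?_).trans (by simp)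
  refine hC K (fun i => f (ι i)) (fun i => hf _) _ fun x hx => ?_
  rw [Finset.mem_filter] at hx
  exact ⟨fun i => (hZ x hx.1).1 _, hx.2⟩

theorem exists_finset_separating {G K : Type} [Field K] (S : Set G) (d : ℕ) :
    ∀ W : Submodule K (G → K), FiniteDimensional K W → Module.finrank K W ≤ d →
      (∀ φ ∈ W, (∀ g ∈ S, φ g = 0) → φ = 0) →
      ∃ H : Finset G, (∀ h ∈ H, h ∈ S) ∧ H.card ≤ d ∧ ∀ φ ∈ W, (∀ h ∈ H, φ h = 0) → φ = 0 := by
  classical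
  induction d with
  | zero =>
    intro W _ hd _
    have : W = ⊥ := Submodule.finrank_eq_zero.mp (by omega)
    exact ⟨∅, by simp, by simp, fun φ hφ _ => by simpa [this] using hφ⟩
  | succ d ih =>
    intro W _ hd hW
    by_cases h : W = ⊥
    · exact ⟨∅, by simp, by simp, fun φ hφ _ => by simpa [h] using hφ⟩
    obtain ⟨φ, hφ, hφ0⟩ := (Submodule.ne_bot_iff _).mp h
    have : ∃ g ∈ S, φ g ≠ 0 := by
      by_contra! hh
      exact hφ0 (hW φ hφ hh)
    obtain ⟨g, hg, hgφ⟩ := this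
    set W' : Submodule K (G → K) := W ⊓ LinearMap.ker (LinearMap.proj g : (G → K) →ₗ[K] K) with hW'
    have hlt : W' < W := by
      refine lt_of_le_of_ne inf_le_left fun he => ?_
      rw [← he] at hφ
      exact hgφ hφ.2
    have hlt' := Submodule.finrank_lt_finrank_of_lt hlt
    have hfd : FiniteDimensional K W' := Submodule.finiteDimensional_of_le hlt.le
    obtain ⟨H, hH1, hH2, hH3⟩ := ih W' hfd (by omega) fun ψ hψ => hW ψ hψ.1
    refine ⟨insert g H, ?_, ?_, ?_⟩
    · intro h hh
      rcases Finset.mem_insert.mp hh with rfl | hh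
      · exact hg
      · exact hH1 h hh
    · exact (Finset.card_insert_le _ _).trans (by omega)
    · intro ψ hψ hz
      exact hH3 ψ ⟨hψ, hz g (Finset.mem_insert_self _ _)⟩
        fun h hh => hz h (Finset.mem_insert_of_mem hh)

theorem one_mem_prodSet {G : Type*} [Group G] (A : Set G) (r : ℕ) : (1 : G) ∈ prodSet A r :=
  Set.one_mem_pow (by simp)

theorem prodSet_mono {G : Type*} [Group G] (A : Set G) {r s : ℕ} (h : r ≤ s) :
    prodSet A r ⊆ prodSet A s :=
  Set.pow_right_monotone (by simp) h

theorem mul_mem_prodSet {G : Type*} [Group G] (A : Set G) {r s : ℕ} {x y : G}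
    (hx : x ∈ prodSet A r) (hy : y ∈ prodSet A s) : x * y ∈ prodSet A (r + s) := by
  rw [prodSet, pow_add]
  exact Set.mul_mem_mul hx hy

theorem inv_mem_prodSet {G : Type*} [Group G] (A : Set G) {r : ℕ} {x : G}
    (hx : x ∈ prodSet A r) : x⁻¹ ∈ prodSet A r := by
  have : (A ∪ A⁻¹ ∪ {1})⁻¹ = A ∪ A⁻¹ ∪ {1} := by
    ext x; simp [or_comm]
  rw [prodSet, ← this, inv_pow, Set.inv_mem_inv]
  exact hx

theorem mem_prodSet_one {G : Type*} [Group G] (A : Set G) {x : G} (hx : x ∈ A) :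
    x ∈ prodSet A 1 := by
  simp [prodSet, hx]

theorem eq_zero_of_translates {G K : Type} [Group G] [Field K] (A : Set G)
    (hA : Subgroup.closure A = ⊤) (N : Submodule K (G → K))
    (h1 : ∀ φ ∈ N, φ 1 = 0) (hN : ∀ φ ∈ N, ∀ a ∈ A ∪ A⁻¹, (fun g => φ (g * a)) ∈ N) : N = ⊥ := by
  have key : ∀ x : G, ∀ φ ∈ N, (fun g => φ (g * x)) ∈ N := by
    intro x
    have hx : x ∈ Subgroup.closure A := by rw [hA]; trivial
    rw [← Subgroup.mem_toSubmonoid, Subgroup.closure_toSubmonoid] at hx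
    induction hx using Submonoid.closure_induction with
    | mem a ha => exact fun φ hφ => hN φ hφ a ha
    | one => intro φ hφ; simpa using hφ
    | mul a b _ _ ha hb =>
      intro φ hφ
      have := ha _ (hb φ hφ)
      simpa [mul_assoc] using this
  rw [eq_bot_iff]
  intro φ hφ
  rw [Submodule.mem_bot]
  funext g
  simpa using h1 _ (key g φ hφ)

/-- The functions in `L` vanishing on `A_r`. -/
def vanishOn {G K : Type} [Group G] [Field K] (A : Set G) (L : Submodule K (G → K)) (r : ℕ) :
    Submodule K (G → K) where
  carrier := {φ | φ ∈ L ∧ ∀ g ∈ prodSet A r, φ g = 0}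
  add_mem' := fun ha hb => ⟨L.add_mem ha.1 hb.1, fun g hg => by simp [ha.2 g hg, hb.2 g hg]⟩
  zero_mem' := ⟨L.zero_mem, fun _ _ => rfl⟩
  smul_mem' := fun c _ ha => ⟨L.smul_mem c ha.1, fun g hg => by simp [ha.2 g hg]⟩

theorem vanishOn_finrank {G K : Type} [Group G] [Field K] (A : Set G)
    (hA : Subgroup.closure A = ⊤) (L : Submodule K (G → K)) [FiniteDimensional K L]
    (hL : ∀ φ ∈ L, ∀ a, (fun g => φ (g * a)) ∈ L) (j : ℕ) :
    vanishOn A L j = ⊥ ∨ Module.finrank K (vanishOn A L j) + j ≤ Module.finrank K L := by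
  have hle : ∀ j, vanishOn A L j ≤ L := fun j φ hφ => hφ.1
  induction j with
  | zero => right; exact Submodule.finrank_mono (hle 0)
  | succ j ih =>
    have hsub : vanishOn A L (j + 1) ≤ vanishOn A L j := fun φ hφ =>
      ⟨hφ.1, fun g hg => hφ.2 g (prodSet_mono A (Nat.le_succ j) hg)⟩
    have hfd : FiniteDimensional K (vanishOn A L j) := Submodule.finiteDimensional_of_le (hle j)
    rcases ih with h | h
    · left
      rw [eq_bot_iff, ← h]; exact hsub
    · by_cases he : vanishOn A L (j + 1) = vanishOn A L j
      · left
        refine eq_zero_of_translates A hA _ (fun φ hφ => hφ.2 1 (one_mem_prodSet A _)) ?_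
        intro φ hφ a ha
        rw [he]
        refine ⟨hL φ hφ.1 a, fun g hg => hφ.2 _ ?_⟩
        refine mul_mem_prodSet A hg ?_
        simp only [prodSet, pow_one]
        exact Or.inl ha
      · right
        have := Submodule.finrank_lt_finrank_of_lt (lt_of_le_of_ne hsub he)
        omega

theorem escape_group {G K : Type} [Group G] [Field K] (A : Set G)
    (hA : Subgroup.closure A = ⊤) (L : Submodule K (G → K)) [FiniteDimensional K L]
    (hL : ∀ φ ∈ L, ∀ a, (fun g => φ (g * a)) ∈ L) (d : ℕ) (hd : Module.finrank K L ≤ d) :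
    ∃ H : Finset G, (∀ h ∈ H, h ∈ prodSet A d) ∧ H.card ≤ d ∧
      ∀ φ ∈ L, (∀ h ∈ H, φ h = 0) → φ = 0 := by
  have h0 : vanishOn A L d = ⊥ := by
    rcases vanishOn_finrank A hA L hL d with h | h
    · exact h
    · have hfd : FiniteDimensional K (vanishOn A L d) :=
        Submodule.finiteDimensional_of_le (fun φ hφ => hφ.1)
      exact Submodule.finrank_eq_zero.mp (by omega)
  refine exists_finset_separating _ d L inferInstance hd fun φ hφ hz => ?_
  have : φ ∈ vanishOn A L d := ⟨hφ, hz⟩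
  rwa [h0, Submodule.mem_bot] at this

section degree
open MvPolynomial

theorem totalDegree_aeval_le {σ τ K : Type} [Field K] (u : σ → MvPolynomial τ K) (e : ℕ)
    (hu : ∀ i, (u i).totalDegree ≤ e) (p : MvPolynomial σ K) :
    (aeval u p).totalDegree ≤ p.totalDegree * e := by
  rw [aeval_def, eval₂_eq]
  refine totalDegree_finsetSum_le fun m hm => ?_
  refine (totalDegree_mul _ _).trans ?_
  rw [MvPolynomial.algebraMap_eq, totalDegree_C, zero_add]
  refine (totalDegree_finsetProd _ _).trans ?_
  calc ∑ i ∈ m.support, (u i ^ m i).totalDegree ≤ ∑ i ∈ m.support, m i * e :=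
        Finset.sum_le_sum fun i _ => (totalDegree_pow _ _).trans (Nat.mul_le_mul_left _ (hu i))
    _ = (m.sum fun _ k => k) * e := by rw [Finsupp.sum, Finset.sum_mul]
    _ ≤ _ := Nat.mul_le_mul_right _ (le_totalDegree hm)

/-- All entries have total degree at most `d`. -/
def EntryDeg {n m σ K : Type} [Field K] (M : Matrix n m (MvPolynomial σ K)) (d : ℕ) : Prop :=
  ∀ i j, (M i j).totalDegree ≤ d

variable {n m l σ K : Type} [Field K]

theorem EntryDeg.mono {M : Matrix n m (MvPolynomial σ K)} {d e : ℕ} (h : EntryDeg M d)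
    (hde : d ≤ e) : EntryDeg M e := fun i j => (h i j).trans hde

theorem EntryDeg.mul [Fintype m] {M : Matrix n m (MvPolynomial σ K)}
    {N : Matrix m l (MvPolynomial σ K)} {d e : ℕ} (hM : EntryDeg M d) (hN : EntryDeg N e) :
    EntryDeg (M * N) (d + e) := fun i j => by
  rw [Matrix.mul_apply]
  exact totalDegree_finsetSum_le fun k _ =>
    (totalDegree_mul _ _).trans (add_le_add (hM i k) (hN k j))

theorem EntryDeg.add {M N : Matrix n m (MvPolynomial σ K)} {d e : ℕ} (hM : EntryDeg M d)
    (hN : EntryDeg N e) : EntryDeg (M + N) (max d e) := fun i j =>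
  (totalDegree_add _ _).trans (max_le_max (hM i j) (hN i j))

theorem EntryDeg.sub {M N : Matrix n m (MvPolynomial σ K)} {d e : ℕ} (hM : EntryDeg M d)
    (hN : EntryDeg N e) : EntryDeg (M - N) (max d e) := fun i j =>
  (totalDegree_sub _ _).trans (max_le_max (hM i j) (hN i j))

theorem EntryDeg.smul {M : Matrix n m (MvPolynomial σ K)} {d e : ℕ} (hM : EntryDeg M d)
    {p : MvPolynomial σ K} (hp : p.totalDegree ≤ e) : EntryDeg (p • M) (e + d) := fun i j => by
  rw [Matrix.smul_apply, smul_eq_mul]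
  exact (totalDegree_mul _ _).trans (add_le_add hp (hM i j))

theorem EntryDeg.map_C (M : Matrix n m K) : EntryDeg (σ := σ) (M.map C) 0 := fun i j => by
  simp

theorem EntryDeg.one [DecidableEq n] : EntryDeg (1 : Matrix n n (MvPolynomial σ K)) 0 :=
  fun i j => by
    rw [Matrix.one_apply]; split_ifs <;> simp

theorem EntryDeg.pow [Fintype n] [DecidableEq n] {M : Matrix n n (MvPolynomial σ K)} {d : ℕ}
    (hM : EntryDeg M d) (k : ℕ) : EntryDeg (M ^ k) (k * d) := by
  induction k with
  | zero => simpa using EntryDeg.one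
  | succ k ih => rw [pow_succ, add_mul, one_mul]; exact ih.mul hM

theorem EntryDeg.sum {ι : Type} (s : Finset ι) (M : ι → Matrix n m (MvPolynomial σ K)) {d : ℕ}
    (hM : ∀ i ∈ s, EntryDeg (M i) d) : EntryDeg (∑ i ∈ s, M i) d := fun i j => by
  rw [Matrix.sum_apply]
  exact totalDegree_finsetSum_le fun k hk => hM k hk i j

theorem EntryDeg.trace [Fintype n] {M : Matrix n n (MvPolynomial σ K)} {d : ℕ}
    (hM : EntryDeg M d) : M.trace.totalDegree ≤ d :=
  totalDegree_finsetSum_le fun k _ => hM k k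

theorem EntryDeg.det [Fintype n] [DecidableEq n] {M : Matrix n n (MvPolynomial σ K)} {d : ℕ}
    (hM : EntryDeg M d) : M.det.totalDegree ≤ Fintype.card n * d := by
  rw [Matrix.det_apply]
  refine totalDegree_finsetSum_le fun s _ => ?_
  have : (Equiv.Perm.sign s • ∏ i, M (s i) i).totalDegree ≤ (∏ i, M (s i) i).totalDegree := by
    rcases Int.units_eq_one_or (Equiv.Perm.sign s) with h | h <;> simp [h]
  refine this.trans ((totalDegree_finsetProd _ _).trans ?_)
  exact (Finset.sum_le_sum fun i _ => hM _ _).trans (by simp)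

theorem EntryDeg.adjugate [Fintype n] [DecidableEq n] {M : Matrix n n (MvPolynomial σ K)} {d : ℕ}
    (hM : EntryDeg M d) : EntryDeg M.adjugate (Fintype.card n * d) := fun i j => by
  rw [Matrix.adjugate_apply]
  refine EntryDeg.det fun a b => ?_
  rw [Matrix.updateRow_apply]
  split_ifs
  · rw [Pi.single_apply]; split_ifs <;> simp
  · exact hM _ _

end degree

section escape
open MvPolynomial

/-- The generic `n × n` matrix. -/
noncomputable def genMat (n : ℕ) (K : Type) [Field K] :
    Matrix (Fin n) (Fin n) (MvPolynomial (Fin n × Fin n) K) :=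
  Matrix.of fun i j => X (i, j)

theorem genMat_entryDeg (n : ℕ) (K : Type) [Field K] : EntryDeg (genMat n K) 1 := fun i j => by
  simp [genMat]

/-- Evaluation of a polynomial in `n × n` variables at a matrix. -/
noncomputable def evalMat {n : ℕ} {K R : Type} [Field K] [CommRing R] [Algebra K R]
    (M : Matrix (Fin n) (Fin n) R) : MvPolynomial (Fin n × Fin n) K →ₐ[K] R :=
  aeval fun p => M p.1 p.2

theorem evalMat_genMat {n : ℕ} {K R : Type} [Field K] [CommRing R] [Algebra K R]
    (M : Matrix (Fin n) (Fin n) R) : (genMat n K).map (evalMat M) = M := by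
  ext i j; simp [genMat, evalMat]

/-- Restrictions of polynomials of degree at most `D` to `SL_n(K)`. -/
noncomputable def polyFun (n D : ℕ) (K : Type) [Field K] :
    Submodule K (Matrix.SpecialLinearGroup (Fin n) K → K) :=
  (restrictTotalDegree (Fin n × Fin n) K D).map
    (LinearMap.pi fun g => (evalMat (g : Matrix (Fin n) (Fin n) K)).toLinearMap)

theorem mem_polyFun {n D : ℕ} {K : Type} [Field K]
    {φ : Matrix.SpecialLinearGroup (Fin n) K → K} :
    φ ∈ polyFun n D K ↔ ∃ p : MvPolynomial (Fin n × Fin n) K, p.totalDegree ≤ D ∧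
      ∀ g, φ g = evalMat (g : Matrix (Fin n) (Fin n) K) p := by
  rw [polyFun, Submodule.mem_map]
  constructor
  · rintro ⟨p, hp, rfl⟩
    exact ⟨p, (mem_restrictTotalDegree _ _ _).mp hp, fun g => rfl⟩
  · rintro ⟨p, hp, h⟩
    refine ⟨p, (mem_restrictTotalDegree _ _ _).mpr hp, ?_⟩
    funext g
    rw [h g, LinearMap.pi_apply]
    rfl

theorem polyFun_le (n D : ℕ) (K : Type) [Field K] : polyFun n D K ≤
    Submodule.span K (Set.range fun (m : Fin n × Fin n → Fin (D + 1))
      (g : Matrix.SpecialLinearGroup (Fin n) K) =>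
      ∏ p, (g : Matrix (Fin n) (Fin n) K) p.1 p.2 ^ (m p : ℕ)) := by
  intro φ hφ
  obtain ⟨p, hp, h⟩ := mem_polyFun.mp hφ
  have : φ = ∑ m ∈ p.support, coeff m p • fun (g : Matrix.SpecialLinearGroup (Fin n) K) =>
      ∏ q, (g : Matrix (Fin n) (Fin n) K) q.1 q.2 ^ (m q) := by
    funext g
    rw [h g, evalMat, aeval_def, eval₂_eq']
    simp
  rw [this]
  refine Submodule.sum_mem _ fun m hm => Submodule.smul_mem _ _ (Submodule.subset_span ?_)
  refine ⟨fun q => ⟨m q, ?_⟩, ?_⟩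
  · have h1 := (le_totalDegree hm).trans hp
    by_cases h0 : m q = 0
    · omega
    · have := Finset.single_le_sum (f := fun i => m i) (fun _ _ => Nat.zero_le _)
        (Finsupp.mem_support_iff.mpr h0)
      have h2 : (m.sum fun _ e => e) = ∑ i ∈ m.support, m i := rfl
      omega
  · rfl

instance (n D : ℕ) (K : Type) [Field K] : FiniteDimensional K (polyFun n D K) :=
  have : FiniteDimensional K (Submodule.span K (Set.range fun (m : Fin n × Fin n → Fin (D + 1))
      (g : Matrix.SpecialLinearGroup (Fin n) K) =>
      ∏ p, (g : Matrix (Fin n) (Fin n) K) p.1 p.2 ^ (m p : ℕ))) :=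
    FiniteDimensional.span_of_finite K (Set.finite_range _)
  Submodule.finiteDimensional_of_le (polyFun_le n D K)

theorem finrank_polyFun_le (n D : ℕ) (K : Type) [Field K] :
    Module.finrank K (polyFun n D K) ≤ (D + 1) ^ (n * n) := by
  have : FiniteDimensional K (Submodule.span K (Set.range fun (m : Fin n × Fin n → Fin (D + 1))
      (g : Matrix.SpecialLinearGroup (Fin n) K) =>
      ∏ p, (g : Matrix (Fin n) (Fin n) K) p.1 p.2 ^ (m p : ℕ))) :=
    FiniteDimensional.span_of_finite K (Set.finite_range _)
  refine (Submodule.finrank_mono (polyFun_le n D K)).trans ((finrank_range_le_card _).trans ?_)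
  simp

theorem polyFun_translate {n D : ℕ} {K : Type} [Field K]
    (φ : Matrix.SpecialLinearGroup (Fin n) K → K) (hφ : φ ∈ polyFun n D K)
    (a : Matrix.SpecialLinearGroup (Fin n) K) : (fun g => φ (g * a)) ∈ polyFun n D K := by
  obtain ⟨p, hp, h⟩ := mem_polyFun.mp hφ
  set T : Matrix (Fin n) (Fin n) (MvPolynomial (Fin n × Fin n) K) :=
    genMat n K * (a : Matrix (Fin n) (Fin n) K).map C with hT
  refine mem_polyFun.mpr ⟨aeval (fun q => T q.1 q.2) p, ?_, fun g => ?_⟩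
  · refine (totalDegree_aeval_le _ 1 (fun i => ?_) p).trans (by simpa using hp)
    exact ((genMat_entryDeg n K).mul (EntryDeg.map_C _)) _ _
  · rw [h (g * a)]
    have : (evalMat (g : Matrix (Fin n) (Fin n) K)).comp (aeval fun q => T q.1 q.2)
        = evalMat ((g * a : Matrix.SpecialLinearGroup (Fin n) K) : Matrix (Fin n) (Fin n) K) := by
      apply MvPolynomial.algHom_ext
      intro q
      simp [hT, evalMat, genMat, Matrix.mul_apply]
    rw [← this]
    rfl

/-- A polynomial which is homogeneous as a function on matrices over the algebraic closure. -/
def HomogFun {n : ℕ} {K : Type} [Field K] (f : MvPolynomial (Fin n × Fin n) K) : Prop :=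
  ∃ m : ℕ, ∀ (c : AlgebraicClosure K) (M : Matrix (Fin n) (Fin n) (AlgebraicClosure K)),
    evalMat (c • M) f = c ^ m * evalMat M f

theorem evalMat_map {n : ℕ} {K R S : Type} [Field K] [CommRing R] [Algebra K R] [CommRing S]
    [Algebra K S] (φ : R →ₐ[K] S) (M : Matrix (Fin n) (Fin n) R)
    (f : MvPolynomial (Fin n × Fin n) K) : evalMat (M.map φ) f = φ (evalMat M f) := by
  have : (evalMat (M.map φ) : MvPolynomial (Fin n × Fin n) K →ₐ[K] S) = φ.comp (evalMat M) := by
    apply MvPolynomial.algHom_ext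
    intro q
    simp [evalMat]
  rw [this]; rfl

theorem exists_SL_closure {n : ℕ} (hn : 1 ≤ n) {K : Type} [Field K]
    (f : MvPolynomial (Fin n × Fin n) K) (hf : f ≠ 0) (hh : HomogFun f) :
    ∃ M : Matrix (Fin n) (Fin n) (AlgebraicClosure K), M.det = 1 ∧ evalMat M f ≠ 0 := by
  have hdet : (genMat n K).det ≠ 0 := by
    intro h
    have := congrArg (evalMat (1 : Matrix (Fin n) (Fin n) K)) h
    rw [AlgHom.map_det, AlgHom.mapMatrix_apply, evalMat_genMat] at this
    simp at this
  have hinj : Function.Injective (MvPolynomial.map (σ := Fin n × Fin n)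
      (algebraMap K (AlgebraicClosure K))) := map_injective _ (algebraMap K _).injective
  have h0 : MvPolynomial.map (algebraMap K (AlgebraicClosure K)) (f * (genMat n K).det) ≠ 0 := by
    rw [Ne, map_eq_zero_iff _ hinj]
    exact mul_ne_zero hf hdet
  have : ∃ x, eval x (MvPolynomial.map (algebraMap K (AlgebraicClosure K))
      (f * (genMat n K).det)) ≠ 0 := by
    by_contra! hx
    exact h0 (MvPolynomial.funext fun x => by rw [hx x, map_zero])
  obtain ⟨x, hx⟩ := this
  set M : Matrix (Fin n) (Fin n) (AlgebraicClosure K) := Matrix.of fun i j => x (i, j) with hM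
  have hx' : evalMat M (f * (genMat n K).det) ≠ 0 := by
    rw [eval_map, ← aeval_def] at hx
    exact hx
  rw [map_mul, AlgHom.map_det, AlgHom.mapMatrix_apply, evalMat_genMat] at hx'
  obtain ⟨hx1, hx2⟩ := mul_ne_zero_iff.mp hx'
  obtain ⟨c, hc⟩ := IsAlgClosed.exists_pow_nat_eq (M.det)⁻¹ (show 0 < n by omega)
  obtain ⟨m, hm⟩ := hh
  refine ⟨c • M, ?_, ?_⟩
  · rw [Matrix.det_smul, Fintype.card_fin, hc, inv_mul_cancel₀ hx2]
  · rw [hm]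
    refine mul_ne_zero (pow_ne_zero _ ?_) hx1
    rintro rfl
    rw [zero_pow (by omega)] at hc
    exact inv_ne_zero hx2 hc.symm

theorem exists_SL_ne_zero {n : ℕ} (hn : 1 ≤ n) {K : Type} [Field K] [Fintype K]
    (f : MvPolynomial (Fin n × Fin n) K) (hf : f ≠ 0) (hh : HomogFun f)
    (hK : f.totalDegree * (n + 1) + n < Fintype.card K) :
    ∃ g : Matrix.SpecialLinearGroup (Fin n) K, evalMat (g : Matrix (Fin n) (Fin n) K) f ≠ 0 := by
  classical
  obtain ⟨y, hy1, hy2⟩ := exists_SL_closure hn f hf hh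
  let i₀ : Fin n := ⟨0, by omega⟩
  let T : Matrix (Fin n) (Fin n) (MvPolynomial (Fin n × Fin n) K) := Matrix.of fun i j =>
    if i = i₀ then genMat n K i j else (genMat n K).det * genMat n K i j
  have hdd : (genMat n K).det.totalDegree ≤ n := by simpa using (genMat_entryDeg n K).det
  have hT : EntryDeg T (n + 1) := by
    intro i j
    simp only [T, Matrix.of_apply]
    split_ifs
    · exact (genMat_entryDeg n K i j).trans (by omega)
    · exact (totalDegree_mul _ _).trans (add_le_add hdd (genMat_entryDeg n K i j))
  set G : MvPolynomial (Fin n × Fin n) K := evalMat T f * (genMat n K).det with hG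
  have hGeval : ∀ {R : Type} [CommRing R] [Algebra K R] (M : Matrix (Fin n) (Fin n) R),
      evalMat M G =
        evalMat (Matrix.of fun i j => if i = i₀ then M i j else M.det * M i j) f * M.det := by
    intro R _ _ M
    rw [hG, map_mul, AlgHom.map_det, AlgHom.mapMatrix_apply, evalMat_genMat, ← evalMat_map]
    congr 3
    ext i j
    have h1 : evalMat M (genMat n K).det = M.det := by
      rw [AlgHom.map_det, AlgHom.mapMatrix_apply, evalMat_genMat]
    have h2 : evalMat M (genMat n K i j) = M i j := congrFun (congrFun (evalMat_genMat (K := K) M) i) j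
    simp only [T, Matrix.map_apply, Matrix.of_apply]
    split_ifs
    · exact h2
    · rw [map_mul, h1, h2]
  have hG0 : G ≠ 0 := by
    intro h
    have := hGeval y
    rw [h, map_zero, hy1] at this
    simp only [one_mul, ite_self, mul_one] at this
    exact hy2 this.symm
  have hGd : G.totalDegree < Fintype.card K := by
    refine lt_of_le_of_lt ((totalDegree_mul _ _).trans (add_le_add ?_ hdd)) hK
    exact totalDegree_aeval_le _ _ (fun i => hT _ _) f
  have : ∃ x, eval x G ≠ 0 := by
    by_contra! hx
    refine hG0 (eq_zero_of_eval_zero_at_prod_finset G (fun _ => Finset.univ) (fun i => ?_)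
      fun x _ => hx x)
    rw [Finset.card_univ]
    exact (degreeOf_le_totalDegree _ _).trans_lt hGd
  obtain ⟨x, hx⟩ := this
  set M : Matrix (Fin n) (Fin n) K := Matrix.of fun i j => x (i, j) with hM
  have hx' : evalMat M G ≠ 0 := by
    rw [← coe_aeval_eq_eval] at hx
    exact hx
  rw [hGeval] at hx'
  obtain ⟨hx1, hx2⟩ := mul_ne_zero_iff.mp hx'
  set g : Matrix (Fin n) (Fin n) K := M.updateRow i₀ (M.det⁻¹ • M i₀) with hg
  have hgdet : g.det = 1 := by
    rw [hg, Matrix.det_updateRow_smul, Matrix.updateRow_eq_self, inv_mul_cancel₀ hx2]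
  have hgM : (Matrix.of fun i j => if i = i₀ then M i j else M.det * M i j) = M.det • g := by
    ext i j
    by_cases h : i = i₀
    · subst h
      simp [hg, hx2]
    · simp [hg, h]
  refine ⟨⟨g, hgdet⟩, ?_⟩
  rw [hgM] at hx1
  intro h0
  apply hx1
  obtain ⟨m, hm⟩ := hh
  have hinj := (algebraMap K (AlgebraicClosure K)).injective
  apply hinj
  have e1 := evalMat_map (Algebra.ofId K (AlgebraicClosure K)) (M.det • g) f
  have e2 := evalMat_map (Algebra.ofId K (AlgebraicClosure K)) g f
  have e3 : (M.det • g).map (Algebra.ofId K (AlgebraicClosure K)) =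
      (algebraMap K (AlgebraicClosure K) M.det) • g.map (Algebra.ofId K (AlgebraicClosure K)) := by
    ext i j; simp [Algebra.ofId_apply]
  rw [e3, hm, e2] at e1
  rw [map_zero]
  rw [Algebra.ofId_apply, Algebra.ofId_apply] at e1
  rw [← e1]
  have : evalMat g f = 0 := h0
  rw [this]; simp

/-- A generating set of `SL_n(K)` contains in a bounded power a bounded subset on which no
homogeneous polynomial of bounded degree vanishes identically. -/
theorem exists_escape (n D : ℕ) (hn : 1 ≤ n) : ∃ k C : ℕ, ∀ (K : Type) [Field K] [Fintype K],
    C ≤ Fintype.card K → ∀ A : Set (Matrix.SpecialLinearGroup (Fin n) K),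
    Subgroup.closure A = ⊤ → ∃ H : Finset (Matrix.SpecialLinearGroup (Fin n) K),
      (∀ h ∈ H, h ∈ prodSet A k) ∧ H.card ≤ C ∧
      ∀ f : MvPolynomial (Fin n × Fin n) K, f.totalDegree ≤ D → f ≠ 0 → HomogFun f →
        ∃ h ∈ H, evalMat (h : Matrix (Fin n) (Fin n) K) f ≠ 0 := by
  refine ⟨(D + 1) ^ (n * n), (D + 1) ^ (n * n) + D * (n + 1) + n + 1, ?_⟩
  intro K _ _ hK A hA
  obtain ⟨H, hH1, hH2, hH3⟩ := escape_group A hA (polyFun n D K)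
    (fun φ hφ a => polyFun_translate φ hφ a) _ (finrank_polyFun_le n D K)
  refine ⟨H, hH1, by omega, fun f hfD hf hh => ?_⟩
  by_contra! hz
  have hlt : f.totalDegree * (n + 1) + n < Fintype.card K := by
    have := Nat.mul_le_mul_right (n + 1) hfD
    omega
  obtain ⟨g, hg⟩ := exists_SL_ne_zero hn f hf hh hlt
  have := hH3 (fun g => evalMat (g : Matrix (Fin n) (Fin n) K) f)
    (mem_polyFun.mpr ⟨f, hfD, fun _ => rfl⟩) hz
  exact hg (congrFun this g)

end escape

/-- A basis of the ambient space can be extracted from a spanning predicate. -/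
theorem exists_basis_of_span_eq_top {F V : Type} [Field F] [AddCommGroup V] [Module F V]
    [FiniteDimensional F V] (s : Set V) (hs : Submodule.span F s = ⊤) :
    ∃ b : Module.Basis (Fin (Module.finrank F V)) F V, ∀ i, b i ∈ s := by
  obtain ⟨κ, a, ha, h1, hli⟩ := exists_linearIndependent' F (Subtype.val : s → V)
  rw [Subtype.range_coe, hs] at h1
  let b := Module.Basis.mk hli (by rw [h1])
  have := Module.Basis.mk_apply hli (by rw [h1])
  have : Fintype κ := FiniteDimensional.fintypeBasisIndex b
  refine ⟨b.reindex (Fintype.equivFinOfCardEq (Module.finrank_eq_card_basis b).symm), fun i => ?_⟩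
  rw [Module.Basis.reindex_apply, Module.Basis.mk_apply]
  exact (a _).2

theorem exists_proper_left {F U W : Type} [Field F] [AddCommGroup U] [Module F U]
    [FiniteDimensional F U] [AddCommGroup W] [Module F W] [FiniteDimensional F W]
    (S : Submodule F (U →ₗ[F] W)) (hS : Module.finrank F S < Module.finrank F U) :
    ∃ P : Submodule F (Module.Dual F U), P ≠ ⊤ ∧ ∀ φ ∉ P, ∀ x : W, φ.smulRight x ∈ S → x = 0 := by
  refine ⟨Submodule.span F {φ | ∃ x : W, x ≠ 0 ∧ φ.smulRight x ∈ S}, fun htop => ?_, ?_⟩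
  · obtain ⟨b, hb⟩ := exists_basis_of_span_eq_top _ htop
    choose x hx0 hxS using hb
    have hli : LinearIndependent F fun i => (⟨_, hxS i⟩ : S) := by
      rw [Fintype.linearIndependent_iff]
      intro c hc
      have hc' : ∑ i, c i • (b i).smulRight (x i) = 0 := by
        simpa using congrArg Subtype.val hc
      intro j
      have hev : ∀ u, ∑ i, (c i * b i u) • x i = 0 := by
        intro u
        have := LinearMap.congr_fun hc' u
        simpa [LinearMap.sum_apply, smul_smul] using this
      obtain ⟨u, hu⟩ := (Module.evalEquiv F U).surjective (b.coord j)
      have hu' : ∀ i, b i u = if i = j then 1 else 0 := by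
        intro i
        have := LinearMap.congr_fun hu (b i)
        simp only [Module.evalEquiv_apply, Module.Basis.coord_apply, Module.Basis.repr_self,
          Finsupp.single_apply] at this
        exact this
      have := hev u
      simp only [hu'] at this
      simp only [mul_ite, mul_one, mul_zero, ite_smul, zero_smul, Finset.sum_ite_eq',
        Finset.mem_univ, if_true] at this
      exact (smul_eq_zero.mp this).resolve_right (hx0 j)
    have := hli.fintype_card_le_finrank
    rw [Fintype.card_fin, Subspace.dual_finrank_eq] at this
    omega
  · intro φ hφ x hx
    by_contra h
    exact hφ (Submodule.subset_span ⟨x, h, hx⟩)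

theorem exists_proper_right {F U W : Type} [Field F] [AddCommGroup U] [Module F U]
    [FiniteDimensional F U] [AddCommGroup W] [Module F W] [FiniteDimensional F W]
    (S : Submodule F (U →ₗ[F] W)) (hS : Module.finrank F S < Module.finrank F W) :
    ∃ P : Submodule F W, P ≠ ⊤ ∧ ∀ x ∉ P, ∀ φ : Module.Dual F U, φ.smulRight x ∈ S → φ = 0 := by
  refine ⟨Submodule.span F {x | ∃ φ : Module.Dual F U, φ ≠ 0 ∧ φ.smulRight x ∈ S},
    fun htop => ?_, ?_⟩
  · obtain ⟨b, hb⟩ := exists_basis_of_span_eq_top _ htop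
    choose φ hx0 hxS using hb
    have hli : LinearIndependent F fun i => (⟨_, hxS i⟩ : S) := by
      rw [Fintype.linearIndependent_iff]
      intro c hc
      have hc' : ∑ i, c i • (φ i).smulRight (b i) = 0 := by
        simpa using congrArg Subtype.val hc
      intro j
      by_contra hj
      apply hx0 j
      ext u
      have := LinearMap.congr_fun hc' u
      simp only [LinearMap.sum_apply, LinearMap.smul_apply, LinearMap.smulRight_apply, smul_smul,
        LinearMap.zero_apply] at this
      have := Fintype.linearIndependent_iff.mp b.linearIndependent _ this j
      exact (mul_eq_zero.mp this).resolve_left hj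
    have := hli.fintype_card_le_finrank
    rw [Fintype.card_fin] at this
    omega
  · intro φ hφ x hx
    by_contra h
    exact hφ (Submodule.subset_span ⟨x, h, hx⟩)

theorem exists_notMem_three {F V : Type} [Field F] [Infinite F] [AddCommGroup V] [Module F V]
    (P Q R : Submodule F V) (hP : P ≠ ⊤) (hQ : Q ≠ ⊤) (hR : R ≠ ⊤) :
    ∃ v, v ∉ P ∧ v ∉ Q ∧ v ∉ R := by
  classical
  have := Subspace.biUnion_ne_univ_of_top_notMem (k := F) (E := V) (s := {P, Q, R})
    (by simp [hP.symm, hQ.symm, hR.symm])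
  obtain ⟨v, hv⟩ := (Set.ne_univ_iff_exists_notMem _).mp this
  refine ⟨v, ?_, ?_, ?_⟩ <;> intro h <;> apply hv <;> simp [h]

/-- A subspace of endomorphisms of dimension less than `n` is detected by the diagonal
coefficients with respect to a suitable basis. -/
theorem exists_biorthogonal {F : Type} [Field F] [Infinite F] (n : ℕ) :
    ∀ (V : Type) [AddCommGroup V] [Module F V] [FiniteDimensional F V],
      Module.finrank F V = n → ∀ S : Submodule F (V →ₗ[F] V), Module.finrank F S + 1 ≤ n →
      ∃ (b : Fin n → V) (ψ : Fin n → Module.Dual F V),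
        (∀ i j, ψ i (b j) = if i = j then 1 else 0) ∧
        ∀ s ∈ S, (∀ k, ψ k (s (b k)) = 0) → s = 0 := by
  induction n with
  | zero => intro V _ _ _ _ S hS; omega
  | succ n ih =>
    intro V _ _ _ hV S hS
    by_cases hbot : S = ⊥
    · let b := Module.finBasisOfFinrankEq F V hV
      refine ⟨b, b.coord, fun i j => ?_, fun s hs _ => by simpa [hbot] using hs⟩
      simp [Finsupp.single_apply, eq_comm]
    obtain ⟨s₀, hs₀, hs₀0⟩ := (Submodule.ne_bot_iff _).mp hbot
    obtain ⟨P₁, hP₁, hP₁'⟩ := exists_proper_left S (by omega)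
    have hQ₁ : LinearMap.ker (Module.Dual.transpose (R := F) s₀) ≠ ⊤ := by
      intro h
      apply hs₀0
      ext u
      rw [LinearMap.zero_apply, ← Module.forall_dual_apply_eq_zero_iff F]
      intro φ
      have : φ ∈ LinearMap.ker (Module.Dual.transpose (R := F) s₀) := by rw [h]; trivial
      exact LinearMap.congr_fun (LinearMap.mem_ker.mp this) u
    obtain ⟨φ, hφ1, hφ2, -⟩ := exists_notMem_three P₁ _ _ hP₁ hQ₁ hQ₁
    have hφs : φ ∘ₗ s₀ ≠ 0 := fun h => hφ2 (LinearMap.mem_ker.mpr h)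
    have hφ0 : φ ≠ 0 := by rintro rfl; exact hφs (LinearMap.zero_comp _)
    set U := LinearMap.ker φ with hU
    have hUn : Module.finrank F U = n := by
      have := Module.Dual.finrank_ker_add_one_of_ne_zero hφ0
      rw [← hU] at this
      omega
    let R : (V →ₗ[F] V) →ₗ[F] (U →ₗ[F] V) :=
      { toFun := fun s => s ∘ₗ U.subtype
        map_add' := fun _ _ => rfl
        map_smul' := fun _ _ => rfl }
    have hR : ∀ s ∈ S, R s = 0 → s = 0 := by
      intro s hs h
      obtain ⟨w, hw⟩ : ∃ w, φ w ≠ 0 := by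
        by_contra! hh
        exact hφ0 (LinearMap.ext hh)
      have hsx : s = φ.smulRight ((φ w)⁻¹ • s w) := by
        ext u
        have hu : u - (φ u * (φ w)⁻¹) • w ∈ U := by
          rw [hU, LinearMap.mem_ker, map_sub, map_smul, smul_eq_mul, mul_assoc,
            inv_mul_cancel₀ hw, mul_one, sub_self]
        have := LinearMap.congr_fun h ⟨_, hu⟩
        simp only [R, LinearMap.coe_mk, AddHom.coe_mk, LinearMap.comp_apply, Submodule.subtype_apply,
          map_sub, map_smul, LinearMap.zero_apply] at this
        rw [LinearMap.smulRight_apply, smul_smul]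
        exact sub_eq_zero.mp this
      have := hP₁' φ hφ1 _ (hsx ▸ hs)
      rw [this] at hsx
      rw [hsx, LinearMap.smulRight_zero]
    obtain ⟨P₂, hP₂, hP₂'⟩ := exists_proper_right (S.map R) (by
      have := Submodule.finrank_map_le R S
      omega)
    have hker : ∀ χ : Module.Dual F V, χ ≠ 0 → LinearMap.ker χ ≠ ⊤ := by
      intro χ hχ h
      exact hχ (LinearMap.ker_eq_top.mp h)
    obtain ⟨v, hv1, hv2, hv3⟩ := exists_notMem_three P₂ _ _ hP₂ (hker φ hφ0) (hker _ hφs)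
    have hv2 : φ v ≠ 0 := fun h => hv2 h
    have hv3 : φ (s₀ v) ≠ 0 := fun h => hv3 h
    let π : V →ₗ[F] U := LinearMap.codRestrict U (LinearMap.id - ((φ v)⁻¹ • φ).smulRight v) (by
      intro w
      rw [hU, LinearMap.mem_ker]
      simp [mul_comm, hv2])
    have hπ : ∀ w, ((π w : U) : V) = w - ((φ v)⁻¹ * φ w) • v := fun w => rfl
    let c : (V →ₗ[F] V) →ₗ[F] (U →ₗ[F] U) :=
      { toFun := fun s => π ∘ₗ s ∘ₗ U.subtype
        map_add' := fun a b => by ext; simp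
        map_smul' := fun a b => by ext; simp }
    let ev : (V →ₗ[F] V) →ₗ[F] F :=
      { toFun := fun s => φ (s v)
        map_add' := fun a b => by simp
        map_smul' := fun a b => by simp }
    set S' := S ⊓ LinearMap.ker ev with hS'
    have hlt : S' < S := by
      refine lt_of_le_of_ne inf_le_left fun h => ?_
      rw [← h] at hs₀
      exact hv3 hs₀.2
    have hfin := Submodule.finrank_lt_finrank_of_lt hlt
    have hinj : ∀ s ∈ S, c s = 0 → s = 0 := by
      intro s hs h
      refine hR s hs ?_
      let α : Module.Dual F U := ((φ v)⁻¹ • φ) ∘ₗ s ∘ₗ U.subtype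
      have hsα : R s = α.smulRight v := by
        ext u
        have h1 := congrArg Subtype.val (LinearMap.congr_fun h u)
        exact sub_eq_zero.mp h1
      have := hP₂' v hv1 α (hsα ▸ Submodule.mem_map_of_mem hs)
      rw [hsα, this]
      ext; simp
    obtain ⟨b', ψ', hbi, hsep⟩ := ih U hUn (S'.map c) (by
      have := Submodule.finrank_map_le c S'
      omega)
    refine ⟨Fin.cons v fun i => (b' i : V), Fin.cons ((φ v)⁻¹ • φ) fun i => ψ' i ∘ₗ π, ?_, ?_⟩
    · intro i j
      refine Fin.cases ?_ (fun i => ?_) i <;> refine Fin.cases ?_ (fun j => ?_) j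
      · simp [hv2]
      · have : φ (b' j) = 0 := (b' j).2
        simp [this, (Fin.succ_ne_zero j).symm]
      · have : π v = 0 := by
          ext; rw [hπ]; simp [hv2]
        simp [this]
      · have hb0 : φ (b' j) = 0 := (b' j).2
        have : π (b' j) = b' j := by
          ext; rw [hπ]; simp [hb0]
        simp [this, hbi]
    · intro s hs hk
      have h0 : ev s = 0 := by
        have := hk 0
        show φ (s v) = 0
        simpa [hv2] using this
      refine hinj s hs (hsep (c s) (Submodule.mem_map_of_mem ⟨hs, h0⟩) fun k => ?_)
      have := hk k.succ
      show ψ' k (π (s (b' k))) = 0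
      simpa using this

section splitting
open Polynomial

/-- Triviality of the kernel of a linear system is preserved by extension of scalars. -/
theorem linearSystem_baseChange {ι κ K L : Type} [Fintype ι] [Fintype κ] [Field K] [Field L]
    [Algebra K L] (s : κ → ι → K) (h : ∀ c : ι → K, (∀ k, ∑ b, s k b * c b = 0) → c = 0)
    (c : ι → L) (hc : ∀ k, ∑ b, algebraMap K L (s k b) * c b = 0) : c = 0 := by
  classical
  obtain ⟨J, hJ⟩ := exists_minor s h
  have h2 : ((algebraMap K L).mapMatrix (Matrix.of fun i j => s (J i) j)).det ≠ 0 := by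
    rw [← RingHom.map_det]
    simpa using hJ
  refine Matrix.eq_zero_of_mulVec_eq_zero h2 (funext fun i => ?_)
  simpa [Matrix.mulVec, dotProduct] using hc (J i)

/-- The matrix is diagonalizable over the algebraic closure, with distinct eigenvalues. -/
def SplitReg {n : ℕ} {K : Type} [Field K] (b : Matrix (Fin n) (Fin n) K) : Prop :=
  ∃ (P P' : Matrix (Fin n) (Fin n) (AlgebraicClosure K)) (e : Fin n → AlgebraicClosure K),
    P' * P = 1 ∧ P * P' = 1 ∧ Function.Injective e ∧
      (algebraMap K (AlgebraicClosure K)).mapMatrix b = P * Matrix.diagonal e * P'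

theorem splitReg_of_separable {n : ℕ} {K : Type} [Field K] (b : Matrix (Fin n) (Fin n) K)
    (hb : b.charpoly.Separable) : SplitReg b := by
  classical
  set B := (algebraMap K (AlgebraicClosure K)).mapMatrix b with hB
  have hBc : B.charpoly.Separable := by
    rw [hB, RingHom.mapMatrix_apply, Matrix.charpoly_map]
    exact hb.map
  have hnd := nodup_roots hBc
  have hcard : B.charpoly.roots.toFinset.card = n := by
    rw [Multiset.toFinset_card_of_nodup hnd]
    rw [← (IsAlgClosed.splits B.charpoly).natDegree_eq_card_roots, Matrix.charpoly_natDegree_eq_dim,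
      Fintype.card_fin]
  let e' := (B.charpoly.roots.toFinset.equivFinOfCardEq hcard).symm
  let e : Fin n → AlgebraicClosure K := fun i => (e' i : AlgebraicClosure K)
  have he : Function.Injective e := Subtype.val_injective.comp e'.injective
  have hroot : ∀ i, B.charpoly.eval (e i) = 0 := by
    intro i
    have := (e' i).2
    rw [Multiset.mem_toFinset, mem_roots (B.charpoly_monic.ne_zero)] at this
    exact this
  have hv : ∀ i, ∃ v : Fin n → AlgebraicClosure K, v ≠ 0 ∧ B.mulVec v = e i • v := by
    intro i
    have := hroot i
    rw [Matrix.eval_charpoly] at this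
    obtain ⟨v, hv0, hv⟩ := Matrix.exists_mulVec_eq_zero_iff.mpr this
    refine ⟨v, hv0, ?_⟩
    rw [Matrix.sub_mulVec, sub_eq_zero] at hv
    rw [← hv, Matrix.scalar_apply]
    ext k; simp [Matrix.mulVec_diagonal]
  choose v hv0 hv using hv
  have hli : LinearIndependent (AlgebraicClosure K) v := by
    refine Module.End.eigenvectors_linearIndependent' (Matrix.toLin' B) e he v fun i => ?_
    refine ⟨?_, hv0 i⟩
    rw [Module.End.mem_eigenspace_iff, Matrix.toLin'_apply]
    exact hv i
  set P : Matrix (Fin n) (Fin n) (AlgebraicClosure K) := Matrix.of fun i k => v k i with hP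
  have hPu : IsUnit P := by
    rw [← Matrix.linearIndependent_cols_iff_isUnit]
    exact hli
  have hPd : IsUnit P.det := (Matrix.isUnit_iff_isUnit_det _).mp hPu
  refine ⟨P, P⁻¹, e, Matrix.nonsing_inv_mul _ hPd, Matrix.mul_nonsing_inv _ hPd, he, ?_⟩
  have : B * P = P * Matrix.diagonal e := by
    ext i k
    have := congrFun (hv k) i
    rw [Matrix.mul_diagonal]
    simpa [Matrix.mul_apply, Matrix.mulVec, dotProduct, hP, mul_comm] using this
  rw [← this, Matrix.mul_assoc, Matrix.mul_nonsing_inv _ hPd, mul_one]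

/-- The Gram determinant of the trace form on the powers of `w`. -/
noncomputable def gramDet {n : ℕ} {R : Type} [CommRing R] (w : Matrix (Fin n) (Fin n) R) : R :=
  (Matrix.of fun i j : Fin n => (w ^ (i + j : ℕ)).trace).det

theorem gramDet_kernel {n : ℕ} {K : Type} [Field K] (w : Matrix (Fin n) (Fin n) K)
    (hw : gramDet w ≠ 0) (c : Fin n → K)
    (h : ∀ j : Fin n, ((∑ i, c i • w ^ (i : ℕ)) * w ^ (j : ℕ)).trace = 0) : c = 0 := by
  refine Matrix.eq_zero_of_mulVec_eq_zero hw (funext fun j => ?_)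
  rw [Pi.zero_apply, ← h j, Finset.sum_mul, Matrix.trace_sum]
  simp only [Matrix.mulVec, dotProduct, Matrix.of_apply, Matrix.smul_mul, ← pow_add,
    Matrix.trace_smul, smul_eq_mul]
  exact Finset.sum_congr rfl fun i _ => by rw [mul_comm, add_comm]

theorem separable_of_gramDet {n : ℕ} {K : Type} [Field K] [PerfectField K]
    (w : Matrix (Fin n) (Fin n) K) (hw : gramDet w ≠ 0) : w.charpoly.Separable := by
  have hpoly : ∀ p : K[X], p.natDegree < n →
      (∀ j : Fin n, (aeval w p * w ^ (j : ℕ)).trace = 0) → p = 0 := by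
    intro p hp h
    have h1 : aeval w p = ∑ i : Fin n, p.coeff i • w ^ (i : ℕ) := by
      rw [aeval_eq_sum_range' hp, Finset.sum_range]
    have h2 := gramDet_kernel w hw (fun i => p.coeff i) (by rw [← h1]; exact h)
    ext k
    by_cases hk : k < n
    · exact congrFun h2 ⟨k, hk⟩
    · rw [coeff_zero, coeff_eq_zero_of_natDegree_lt (by omega)]
  have hint : IsIntegral K w := Matrix.isIntegral w
  have hm := minpoly.monic hint
  have hdvd := Matrix.minpoly_dvd_charpoly w
  have hle := natDegree_le_of_dvd hdvd w.charpoly_monic.ne_zero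
  rw [Matrix.charpoly_natDegree_eq_dim, Fintype.card_fin] at hle
  have hdeg : (minpoly K w).natDegree = n := by
    by_contra hne
    exact hm.ne_zero (hpoly _ (by omega) fun j => by rw [minpoly.aeval]; simp)
  have heq : minpoly K w = w.charpoly := by
    refine (eq_of_monic_of_dvd_of_natDegree_le hm w.charpoly_monic hdvd ?_).symm
    rw [hdeg, Matrix.charpoly_natDegree_eq_dim, Fintype.card_fin]
  rw [← heq, PerfectField.separable_iff_squarefree]
  intro p ⟨q, hq⟩
  by_contra hpu
  have hf0 := hm.ne_zero
  rw [hq] at hf0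
  have hp0 : p ≠ 0 := fun h => hf0 (by rw [h]; ring)
  have hq0 : q ≠ 0 := fun h => hf0 (by rw [h]; ring)
  have hpd : 0 < p.natDegree := by
    rw [Nat.pos_iff_ne_zero]
    intro h
    exact hpu (isUnit_iff_degree_eq_zero.mpr (by rw [degree_eq_natDegree hp0, h]; rfl))
  have hN2 : aeval w (p * q) * aeval w (p * q) = 0 := by
    rw [← map_mul]
    have : p * q * (p * q) = minpoly K w * q := by rw [hq]; ring
    rw [this, map_mul, minpoly.aeval, zero_mul]
  have hNn : IsNilpotent (aeval w (p * q)) := ⟨2, by rw [pow_two, hN2]⟩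
  have hdeg2 := congrArg natDegree hq
  rw [hdeg, mul_assoc, natDegree_mul hp0 (mul_ne_zero hp0 hq0)] at hdeg2
  have := hpoly (p * q) (by omega) fun j => by
    have hc : Commute (aeval w (p * q)) (w ^ (j : ℕ)) := by
      have : w ^ (j : ℕ) = aeval w (X ^ (j : ℕ) : K[X]) := by simp
      rw [this]
      exact Commute.all _ _ |>.map (aeval w)
    exact (Matrix.isNilpotent_trace_of_isNilpotent (hc.isNilpotent_mul_right hNn)).eq_zero
  exact mul_ne_zero hp0 hq0 this

theorem conj_diag_pow {n : ℕ} {L : Type} [Field L] (g g' : Matrix (Fin n) (Fin n) L)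
    (hg : g' * g = 1) (e : Fin n → L) (j : ℕ) (hg2 : g * g' = 1) :
    (g * Matrix.diagonal e * g') ^ j = g * Matrix.diagonal (fun i => e i ^ j) * g' := by
  induction j with
  | zero => simp [hg2]
  | succ j ih =>
    rw [pow_succ, ih]
    calc _ = g * Matrix.diagonal (fun i => e i ^ j) * (g' * g) * Matrix.diagonal e * g' := by
          simp only [Matrix.mul_assoc]
      _ = _ := by
          rw [hg, mul_one, Matrix.mul_assoc g, Matrix.diagonal_mul_diagonal]
          simp only [pow_succ]

theorem trace_conj_diag_mul {n : ℕ} {L : Type} [Field L] (g g' s : Matrix (Fin n) (Fin n) L)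
    (e : Fin n → L) :
    (g * Matrix.diagonal e * g' * s).trace = ∑ k, (g' * s * g) k k * e k := by
  have : (g * Matrix.diagonal e * g' * s).trace = (Matrix.diagonal e * (g' * s * g)).trace := by
    rw [Matrix.mul_assoc, Matrix.mul_assoc, Matrix.trace_mul_comm]
    simp only [Matrix.mul_assoc]
  rw [this]
  simp [Matrix.trace, Matrix.diagonal_mul, mul_comm]

theorem gramDet_conj_diag {n : ℕ} {L : Type} [Field L] (g g' : Matrix (Fin n) (Fin n) L)
    (hg : g' * g = 1) (hg2 : g * g' = 1) (e : Fin n → L) (he : Function.Injective e) :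
    gramDet (g * Matrix.diagonal e * g') ≠ 0 := by
  have : (Matrix.of fun i j : Fin n => ((g * Matrix.diagonal e * g') ^ (i + j : ℕ)).trace)
      = (Matrix.vandermonde e).transpose * Matrix.vandermonde e := by
    ext i j
    rw [Matrix.vandermonde_transpose_mul_vandermonde, Matrix.of_apply, conj_diag_pow g g' hg e _ hg2]
    have := trace_conj_diag_mul g g' 1 (fun k => e k ^ (i + j : ℕ))
    rw [mul_one] at this
    rw [this]
    simp [hg]
  rw [gramDet, this, Matrix.det_mul, Matrix.det_transpose]
  have := Matrix.det_vandermonde_ne_zero_iff.mpr he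
  exact mul_ne_zero this this

/-- Matrix form of the detection of a small space of matrices by diagonal coefficients. -/
theorem exists_conj_diagonal {L : Type} [Field L] [Infinite L] {n d : ℕ}
    (s : Fin d → Matrix (Fin n) (Fin n) L) (hd : d + 1 ≤ n)
    (hs : ∀ c : Fin d → L, ∑ a, c a • s a = 0 → c = 0) :
    ∃ g g' : Matrix (Fin n) (Fin n) L, g' * g = 1 ∧ g * g' = 1 ∧
      ∀ c : Fin d → L, (∀ k, (g' * (∑ a, c a • s a) * g) k k = 0) → c = 0 := by
  classical
  obtain ⟨b, ψ, hbi, hsep⟩ := exists_biorthogonal n (Fin n → L) (by simp)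
    (Submodule.span L (Set.range fun a => Matrix.toLin' (s a))) (by
      have := finrank_range_le_card (R := L) (fun a => Matrix.toLin' (s a))
      rw [Fintype.card_fin, Set.finrank] at this
      omega)
  let g : Matrix (Fin n) (Fin n) L := Matrix.of fun i k => b k i
  let g' : Matrix (Fin n) (Fin n) L := Matrix.of fun k i => ψ k (Pi.single i 1)
  have hψ : ∀ k (x : Fin n → L), ∑ i, g' k i * x i = ψ k x := by
    intro k x
    conv_rhs => rw [pi_eq_sum_univ' x]
    rw [map_sum]
    refine Finset.sum_congr rfl fun i _ => ?_
    rw [map_smul, smul_eq_mul, mul_comm]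
    congr 2
  have hg : g' * g = 1 := by
    ext i j
    rw [Matrix.mul_apply, Matrix.one_apply, ← hbi i j]
    exact hψ i (b j)
  refine ⟨g, g', hg, mul_eq_one_comm.mp hg, fun c hc => hs c ?_⟩
  have h0 : Matrix.toLin' (∑ a, c a • s a) = 0 := by
    refine hsep _ ?_ fun k => ?_
    · rw [map_sum]
      refine Submodule.sum_mem _ fun a _ => ?_
      rw [map_smul]
      exact Submodule.smul_mem _ _ (Submodule.subset_span ⟨a, rfl⟩)
    · rw [← hc k, Matrix.mul_assoc, Matrix.mul_apply]
      rw [← hψ]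
      rfl
  exact (LinearEquiv.map_eq_zero_iff _).mp h0

end splitting

section escapes
open MvPolynomial

/-- No nonzero homogeneous polynomial of degree at most `D` vanishes on `H`. -/
def Escapes {n : ℕ} {K : Type} [Field K] (H : Finset (Matrix.SpecialLinearGroup (Fin n) K))
    (D : ℕ) : Prop :=
  ∀ f : MvPolynomial (Fin n × Fin n) K, f.totalDegree ≤ D → f ≠ 0 → HomogFun f →
    ∃ h ∈ H, evalMat (h : Matrix (Fin n) (Fin n) K) f ≠ 0

theorem HomogFun.mul {n : ℕ} {K : Type} [Field K] {f g : MvPolynomial (Fin n × Fin n) K}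
    (hf : HomogFun f) (hg : HomogFun g) : HomogFun (f * g) := by
  obtain ⟨a, ha⟩ := hf
  obtain ⟨b, hb⟩ := hg
  refine ⟨a + b, fun c M => ?_⟩
  rw [map_mul, map_mul, ha, hb]; ring

theorem homogFun_det {n d : ℕ} {K : Type} [Field K]
    (N : Matrix (Fin d) (Fin d) (MvPolynomial (Fin n × Fin n) K)) (r s : Fin d → ℕ)
    (hN : ∀ i j (c : AlgebraicClosure K) M,
      evalMat (c • M) (N i j) = c ^ (r i + s j) * evalMat M (N i j)) : HomogFun N.det := by
  refine ⟨∑ i, r i + ∑ j, s j, fun c M => ?_⟩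
  rw [AlgHom.map_det, AlgHom.map_det]
  have : (evalMat (c • M)).mapMatrix N = Matrix.of fun i j => c ^ r i *
      (Matrix.of fun i j => c ^ s j * (evalMat M).mapMatrix N i j) i j := by
    ext i j
    simp only [AlgHom.mapMatrix_apply, Matrix.map_apply, Matrix.of_apply, hN, pow_add, mul_assoc]
  rw [this, Matrix.det_mul_column, Matrix.det_mul_row, Finset.prod_pow_eq_pow_sum,
    Finset.prod_pow_eq_pow_sum, pow_add, mul_assoc]

theorem map_trace_mapMatrix {n : ℕ} {R S K : Type} [Field K] [CommRing R] [CommRing S] [Algebra K R]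
    [Algebra K S] (f : R →ₐ[K] S) (M : Matrix (Fin n) (Fin n) R) :
    f M.trace = (f.mapMatrix M).trace := by
  simp [Matrix.trace]

theorem evalMat_mapMatrix_genMat {n : ℕ} {K R : Type} [Field K] [CommRing R] [Algebra K R]
    (M : Matrix (Fin n) (Fin n) R) : (evalMat M).mapMatrix (genMat n K) = M :=
  evalMat_genMat M

theorem evalMat_mapMatrix_C {n : ℕ} {K R : Type} [Field K] [CommRing R] [Algebra K R]
    (M : Matrix (Fin n) (Fin n) R) (P : Matrix (Fin n) (Fin n) K) :
    (evalMat M).mapMatrix (P.map C) = (algebraMap K R).mapMatrix P := by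
  ext i j; simp [evalMat]

theorem algebraMap_mapMatrix_self {n : ℕ} {K : Type} [Field K] (P : Matrix (Fin n) (Fin n) K) :
    (algebraMap K K).mapMatrix P = P := by
  ext i j; simp

theorem matrix_baseChange {n d : ℕ} {K L : Type} [Field K] [Field L] [Algebra K L]
    (s : Fin d → Matrix (Fin n) (Fin n) K) (hs : ∀ c : Fin d → K, ∑ a, c a • s a = 0 → c = 0)
    (c : Fin d → L) (hc : ∑ a, c a • (algebraMap K L).mapMatrix (s a) = 0) : c = 0 := by
  refine linearSystem_baseChange (κ := Fin n × Fin n) (fun k b => s b k.1 k.2) ?_ c ?_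
  · intro c hc
    apply hs
    ext i j
    simpa [Matrix.sum_apply, mul_comm] using hc (i, j)
  · intro k
    have := congrFun (congrFun hc k.1) k.2
    simpa [Matrix.sum_apply, mul_comm] using this

theorem escape_trace {n d : ℕ} {K : Type} [Field K]
    (H : Finset (Matrix.SpecialLinearGroup (Fin n) K)) (hH : Escapes H (3 * n * n + n))
    (P Q : Matrix (Fin n) (Fin n) K) (hP : IsUnit P.det) (hQ : IsUnit Q.det)
    (s : Fin d → Matrix (Fin n) (Fin n) K) (hd : d + 1 ≤ n)
    (hs : ∀ c : Fin d → K, ∑ a, c a • s a = 0 → c = 0) :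
    ∃ h ∈ H, gramDet (P * (h : Matrix (Fin n) (Fin n) K) * Q) ≠ 0 ∧ ∀ c : Fin d → K,
      (∀ j : Fin n, ((P * (h : Matrix (Fin n) (Fin n) K) * Q) ^ (j : ℕ) *
        ∑ a, c a • s a).trace = 0) → c = 0 := by
  classical
  set α := algebraMap K (AlgebraicClosure K) with hα
  obtain ⟨g, g', hg1, hg2, hg⟩ := exists_conj_diagonal
    (fun a => α.mapMatrix (s a)) hd (matrix_baseChange s hs)
  obtain ⟨e, he⟩ : ∃ e : Fin n → AlgebraicClosure K, Function.Injective e :=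
    ⟨fun i => Infinite.natEmbedding _ i, (Infinite.natEmbedding _).injective.comp Fin.val_injective⟩
  set w₀ := g * Matrix.diagonal e * g' with hw₀
  have hinj : ∀ c : Fin d → AlgebraicClosure K,
      (∀ j : Fin n, ∑ a, (w₀ ^ (j : ℕ) * α.mapMatrix (s a)).trace * c a = 0) → c = 0 := by
    intro c hc
    refine hg c fun k => ?_
    have : (fun k => (g' * (∑ a, c a • α.mapMatrix (s a)) * g) k k) = 0 := by
      refine Matrix.eq_zero_of_forall_pow_sum_mul_pow_eq_zero he fun j => ?_
      rw [← trace_conj_diag_mul, ← conj_diag_pow g g' hg1 e j hg2, ← hc j, Finset.mul_sum,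
        Matrix.trace_sum]
      refine Finset.sum_congr rfl fun a _ => ?_
      rw [Matrix.mul_smul, Matrix.trace_smul, smul_eq_mul, mul_comm]
    exact congrFun this k
  obtain ⟨J, hJ⟩ := exists_minor _ hinj
  set W : Matrix (Fin n) (Fin n) (MvPolynomial (Fin n × Fin n) K) :=
    P.map C * genMat n K * Q.map C with hW
  have hWeval : ∀ {R : Type} [CommRing R] [Algebra K R] (M : Matrix (Fin n) (Fin n) R),
      (evalMat M).mapMatrix W =
        (algebraMap K R).mapMatrix P * M * (algebraMap K R).mapMatrix Q := by
    intro R _ _ M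
    rw [hW, map_mul, map_mul, evalMat_mapMatrix_C, evalMat_mapMatrix_C, evalMat_mapMatrix_genMat]
  set f₂ := (Matrix.of fun a b : Fin d => (W ^ (J a : ℕ) * (s b).map C).trace).det with hf₂
  have hWd : EntryDeg W 1 := ((EntryDeg.map_C P).mul (genMat_entryDeg n K)).mul (EntryDeg.map_C Q)
  have hf1eval : ∀ {R : Type} [CommRing R] [Algebra K R] (M : Matrix (Fin n) (Fin n) R),
      evalMat M (gramDet W) =
        gramDet ((algebraMap K R).mapMatrix P * M * (algebraMap K R).mapMatrix Q) := by
    intro R _ _ M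
    rw [gramDet, gramDet, AlgHom.map_det, ← hWeval]
    congr 1
    ext i j
    simp only [AlgHom.mapMatrix_apply, Matrix.map_apply, Matrix.of_apply]
    rw [map_trace_mapMatrix, map_pow]
    rfl
  have hf2eval : ∀ {R : Type} [CommRing R] [Algebra K R] (M : Matrix (Fin n) (Fin n) R),
      evalMat M f₂ = (Matrix.of fun a b : Fin d =>
        (((algebraMap K R).mapMatrix P * M * (algebraMap K R).mapMatrix Q) ^ (J a : ℕ)
          * (algebraMap K R).mapMatrix (s b)).trace).det := by
    intro R _ _ M
    rw [hf₂, AlgHom.map_det, ← hWeval]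
    congr 1
    ext i j
    simp only [AlgHom.mapMatrix_apply, Matrix.map_apply, Matrix.of_apply]
    rw [map_trace_mapMatrix, map_mul, map_pow, evalMat_mapMatrix_C]
    rfl
  have hscal : ∀ (c : AlgebraicClosure K) (M : Matrix (Fin n) (Fin n) (AlgebraicClosure K)),
      (evalMat (c • M)).mapMatrix W = c • (evalMat M).mapMatrix W := by
    intro c M
    rw [hWeval, hWeval]; simp
  have hh1 : HomogFun (gramDet W) := by
    refine homogFun_det _ (fun i => i) (fun i => i) fun i j c M => ?_
    rw [Matrix.of_apply, map_trace_mapMatrix, map_trace_mapMatrix, map_pow, map_pow, hscal,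
      smul_pow, Matrix.trace_smul, smul_eq_mul]
  have hh2 : HomogFun f₂ := by
    refine homogFun_det _ (fun i => J i) (fun i => 0) fun i j c M => ?_
    rw [Matrix.of_apply, map_trace_mapMatrix, map_trace_mapMatrix, map_mul, map_mul, map_pow,
      map_pow, hscal, smul_pow, Matrix.smul_mul, Matrix.trace_smul, smul_eq_mul,
      evalMat_mapMatrix_C, evalMat_mapMatrix_C, add_zero]
  have hPα : IsUnit (α.mapMatrix P).det := by
    rw [← RingHom.map_det]; exact hP.map _
  have hQα : IsUnit (α.mapMatrix Q).det := by
    rw [← RingHom.map_det]; exact hQ.map _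
  have hf0 : gramDet W * f₂ ≠ 0 := by
    intro h
    have h1 := congrArg (evalMat ((α.mapMatrix P)⁻¹ * w₀ * (α.mapMatrix Q)⁻¹)) h
    rw [map_mul, hf1eval, hf2eval, map_zero] at h1
    have hc : α.mapMatrix P * ((α.mapMatrix P)⁻¹ * w₀ * (α.mapMatrix Q)⁻¹) * α.mapMatrix Q = w₀ := by
      calc _ = (α.mapMatrix P * (α.mapMatrix P)⁻¹) * w₀ * ((α.mapMatrix Q)⁻¹ * α.mapMatrix Q) := by
            simp only [Matrix.mul_assoc]
        _ = _ := by rw [Matrix.mul_nonsing_inv _ hPα, Matrix.nonsing_inv_mul _ hQα, one_mul, mul_one]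
    rw [← hα, hc] at h1
    exact mul_ne_zero (gramDet_conj_diag g g' hg1 hg2 e he) hJ h1
  have hdeg : (gramDet W * f₂).totalDegree ≤ 3 * n * n + n := by
    refine (totalDegree_mul _ _).trans ?_
    have h1 : (gramDet W).totalDegree ≤ n * (2 * n) := by
      have : EntryDeg (Matrix.of fun i j : Fin n => (W ^ (i + j : ℕ)).trace) (2 * n) := by
        intro i j
        exact (hWd.pow _).trace.trans (by have := i.2; have := j.2; omega)
      simpa [gramDet] using this.det
    have h2 : f₂.totalDegree ≤ d * n := by
      have : EntryDeg (Matrix.of fun a b : Fin d => (W ^ (J a : ℕ) * (s b).map C).trace) n := by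
        intro i j
        exact ((hWd.pow _).mul (EntryDeg.map_C _)).trace.trans (by have := (J i).2; omega)
      simpa using this.det
    have h3 : d * n ≤ n * n := Nat.mul_le_mul_right _ (by omega)
    nlinarith
  obtain ⟨h, hhH, hh⟩ := hH _ hdeg hf0 (hh1.mul hh2)
  rw [map_mul, hf1eval, hf2eval, algebraMap_mapMatrix_self, algebraMap_mapMatrix_self] at hh
  obtain ⟨ha, hb⟩ := mul_ne_zero_iff.mp hh
  refine ⟨h, hhH, ha, fun c hc => ?_⟩
  refine Matrix.eq_zero_of_mulVec_eq_zero hb (funext fun i => ?_)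
  rw [Pi.zero_apply, ← hc (J i), Finset.mul_sum, Matrix.trace_sum]
  simp only [Matrix.mulVec, dotProduct, Matrix.of_apply, algebraMap_mapMatrix_self]
  refine Finset.sum_congr rfl fun a _ => ?_
  rw [Matrix.mul_smul, Matrix.trace_smul, smul_eq_mul, mul_comm]

theorem escape_conj {n d : ℕ} {K : Type} [Field K]
    (H : Finset (Matrix.SpecialLinearGroup (Fin n) K)) (hH : Escapes H (3 * n * n + n))
    (b : Matrix (Fin n) (Fin n) K) (hb : SplitReg b)
    (s : Fin d → Matrix (Fin n) (Fin n) K) (hd : d + 1 ≤ n)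
    (hs : ∀ c : Fin d → K, ∑ a, c a • s a = 0 → c = 0) :
    ∃ h ∈ H, ∀ c : Fin d → K,
      (∀ j : Fin n, ((h : Matrix (Fin n) (Fin n) K) * b ^ (j : ℕ) *
        (h⁻¹ : Matrix.SpecialLinearGroup (Fin n) K) * ∑ a, c a • s a).trace = 0) → c = 0 := by
  classical
  set α := algebraMap K (AlgebraicClosure K) with hα
  obtain ⟨p, p', e, hp1, hp2, he, hbp⟩ := hb
  obtain ⟨g, g', hg1, hg2, hg⟩ := exists_conj_diagonal
    (fun a => α.mapMatrix (s a)) hd (matrix_baseChange s hs)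
  set h₀ := g * p' with hh₀
  have hinj : ∀ c : Fin d → AlgebraicClosure K,
      (∀ j : Fin n, ∑ a, (h₀ * α.mapMatrix b ^ (j : ℕ) * h₀.adjugate *
        α.mapMatrix (s a)).trace * c a = 0) → c = 0 := by
    intro c hc
    refine hg c fun k => ?_
    have hdet : h₀.det ≠ 0 := by
      intro h
      have : (h₀ * (p * g')).det = 1 := by
        have : h₀ * (p * g') = g * (p' * p) * g' := by simp only [hh₀, Matrix.mul_assoc]
        rw [this, hp1, mul_one, hg2, Matrix.det_one]
      rw [Matrix.det_mul, h, zero_mul] at this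
      exact zero_ne_one this
    have hadj : h₀.adjugate = h₀.det • (p * g') := by
      have h1 : h₀ * (p * g') = 1 := by
        have : h₀ * (p * g') = g * (p' * p) * g' := by simp only [hh₀, Matrix.mul_assoc]
        rw [this, hp1, mul_one, hg2]
      calc h₀.adjugate = h₀.adjugate * (h₀ * (p * g')) := by rw [h1, mul_one]
        _ = _ := by rw [← Matrix.mul_assoc, Matrix.adjugate_mul, Matrix.smul_mul, one_mul]
    have hkey : ∀ j : ℕ, h₀ * α.mapMatrix b ^ j * h₀.adjugate =
        h₀.det • (g * Matrix.diagonal (fun i => e i ^ j) * g') := by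
      intro j
      rw [hbp, conj_diag_pow p p' hp1 e j hp2, hadj, Matrix.mul_smul]
      congr 1
      calc _ = g * (p' * p) * Matrix.diagonal (fun i => e i ^ j) * (p' * p) * g' := by
            simp only [hh₀, Matrix.mul_assoc]
        _ = _ := by rw [hp1, mul_one, mul_one]
    have : (fun k => (g' * (∑ a, c a • α.mapMatrix (s a)) * g) k k) = 0 := by
      refine Matrix.eq_zero_of_forall_pow_sum_mul_pow_eq_zero he fun j => ?_
      rw [← trace_conj_diag_mul]
      have := hc j
      simp only [hkey, Matrix.smul_mul, Matrix.trace_smul, smul_eq_mul] at this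
      simp only [mul_assoc h₀.det] at this
      rw [← Finset.mul_sum] at this
      have := (mul_eq_zero.mp this).resolve_left hdet
      rw [← this, Finset.mul_sum, Matrix.trace_sum]
      refine Finset.sum_congr rfl fun a _ => ?_
      rw [Matrix.mul_smul, Matrix.trace_smul, smul_eq_mul, mul_comm]
    exact congrFun this k
  obtain ⟨J, hJ⟩ := exists_minor _ hinj
  set f₂ := (Matrix.of fun a b' : Fin d => (genMat n K * (b.map C) ^ (J a : ℕ) *
    (genMat n K).adjugate * (s b').map C).trace).det with hf₂
  have hentry : ∀ {R : Type} [CommRing R] [Algebra K R] (M : Matrix (Fin n) (Fin n) R) (i j : Fin d),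
      evalMat M (genMat n K * (b.map C) ^ (J i : ℕ) *
        (genMat n K).adjugate * (s j).map C).trace =
      (M * ((algebraMap K R).mapMatrix b) ^ (J i : ℕ) * M.adjugate
          * (algebraMap K R).mapMatrix (s j)).trace := by
    intro R _ _ M i j
    rw [map_trace_mapMatrix, map_mul, map_mul, map_mul, map_pow, evalMat_mapMatrix_C,
      evalMat_mapMatrix_C, AlgHom.map_adjugate, evalMat_mapMatrix_genMat]
  have hf2eval : ∀ {R : Type} [CommRing R] [Algebra K R] (M : Matrix (Fin n) (Fin n) R),
      evalMat M f₂ = (Matrix.of fun a b' : Fin d =>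
        (M * ((algebraMap K R).mapMatrix b) ^ (J a : ℕ) * M.adjugate
          * (algebraMap K R).mapMatrix (s b')).trace).det := by
    intro R _ _ M
    rw [hf₂, AlgHom.map_det]
    congr 1
    ext i j
    exact hentry M i j
  have hh2 : HomogFun f₂ := by
    refine homogFun_det _ (fun i => 1 + (n - 1)) (fun i => 0) fun i j c M => ?_
    rw [Matrix.of_apply, hentry, hentry, Matrix.adjugate_smul]
    simp only [Matrix.smul_mul, Matrix.mul_smul, Matrix.trace_smul, smul_eq_mul, add_zero,
      Fintype.card_fin]
    ring
  have hf0 : f₂ ≠ 0 := by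
    intro h
    have h1 := congrArg (evalMat h₀) h
    rw [hf2eval, map_zero] at h1
    exact hJ h1
  have hdeg : f₂.totalDegree ≤ 3 * n * n + n := by
    have : EntryDeg (Matrix.of fun a b' : Fin d => (genMat n K * (b.map C) ^ (J a : ℕ) *
        (genMat n K).adjugate * (s b').map C).trace) (1 + n) := by
      intro i j
      have h1 := ((((genMat_entryDeg n K).mul ((EntryDeg.map_C b).pow (J i))).mul
        (genMat_entryDeg n K).adjugate).mul (EntryDeg.map_C (s j))).trace
      simpa using h1
    have h2 := this.det
    rw [Fintype.card_fin] at h2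
    refine h2.trans ?_
    have : d * (1 + n) ≤ n * (1 + n) := Nat.mul_le_mul_right _ (by omega)
    nlinarith
  obtain ⟨h, hhH, hh⟩ := hH _ hdeg hf0 hh2
  rw [hf2eval, algebraMap_mapMatrix_self] at hh
  refine ⟨h, hhH, fun c hc => ?_⟩
  refine Matrix.eq_zero_of_mulVec_eq_zero hh (funext fun i => ?_)
  rw [Pi.zero_apply, ← hc (J i), Finset.mul_sum, Matrix.trace_sum]
  simp only [Matrix.mulVec, dotProduct, Matrix.of_apply, algebraMap_mapMatrix_self]
  refine Finset.sum_congr rfl fun a _ => ?_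
  rw [Matrix.mul_smul, Matrix.trace_smul, smul_eq_mul, mul_comm, Matrix.SpecialLinearGroup.coe_inv]

end escapes

section pencil

/-- In a linear family of linear maps over an infinite field, a member of maximal rank satisfies
the first order condition for maximality. -/
theorem exists_range_maximal {L V U W : Type} [Field L] [Infinite L] [AddCommGroup V] [Module L V]
    [AddCommGroup U] [Module L U] [AddCommGroup W] [Module L W]
    [FiniteDimensional L W] (B : V →ₗ[L] U →ₗ[L] W) :
    ∃ h₀, ∀ c ∈ LinearMap.ker (B h₀), ∀ h, B h c ∈ LinearMap.range (B h₀) := by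
  classical
  obtain ⟨h₀, hmax⟩ : ∃ h₀, ∀ h, Module.finrank L (LinearMap.range (B h)) ≤
      Module.finrank L (LinearMap.range (B h₀)) := by
    let S : Set ℕ := Set.range fun h => Module.finrank L (LinearMap.range (B h))
    have hS : S.Nonempty := ⟨_, 0, rfl⟩
    have hbd : BddAbove S := ⟨Module.finrank L W, by
      rintro _ ⟨h, rfl⟩; exact Submodule.finrank_le _⟩
    obtain ⟨h₀, h₀S⟩ := Nat.sSup_mem hS hbd
    exact ⟨h₀, fun h => by
      have := le_csSup hbd (⟨h, rfl⟩ : Module.finrank L (LinearMap.range (B h)) ∈ S)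
      simp only at h₀S
      omega⟩
  refine ⟨h₀, fun c hc h => ?_⟩
  by_contra hnot
  set r := Module.finrank L (LinearMap.range (B h₀)) with hr
  let b := Module.finBasis L (LinearMap.range (B h₀))
  have hb : ∀ i, ∃ u, B h₀ u = b i := fun i => (b i).2
  choose u hu using hb
  have hli : LinearIndependent L (Fin.cons (B h c) (fun i => (b i : W)) : Fin (r + 1) → W) := by
    rw [linearIndependent_finCons]
    refine ⟨?_, ?_⟩
    · exact b.linearIndependent.map' (LinearMap.range (B h₀)).subtype (Submodule.ker_subtype _)
    · intro hmem
      apply hnot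
      refine Submodule.span_le.mpr ?_ hmem
      rintro _ ⟨i, rfl⟩
      exact (b i).2
  set w : Fin (r + 1) → W := Fin.cons (B h c) (fun i => (b i : W)) with hw
  obtain ⟨T, hT⟩ : ∃ T : W →ₗ[L] (Fin (r + 1) → L), ∀ i, T (w i) = Pi.single i 1 := by
    have hker : LinearMap.ker (Fintype.linearCombination L w) = ⊥ := by
      rw [LinearMap.ker_eq_bot]
      exact linearIndependent_iff_injective_fintypeLinearCombination.mp hli
    obtain ⟨T, hT⟩ := LinearMap.exists_leftInverse_of_injective _ hker
    refine ⟨T, fun i => ?_⟩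
    have := LinearMap.congr_fun hT (Pi.single i 1)
    simpa [Fintype.linearCombination_apply_single] using this
  let x : Fin (r + 1) → W := Fin.cons 0 fun i => B h (u i)
  let N : Matrix (Fin (r + 1)) (Fin (r + 1)) L := Matrix.of fun i j => T (x i) j
  let p : Polynomial L := Polynomial.X * (1 + (Polynomial.X : Polynomial L) • N.map Polynomial.C).det
  have hpe : ∀ s, p.eval s = s * (1 + s • N).det := by
    intro s
    simp only [p, Polynomial.eval_mul, Polynomial.eval_X]
    congr 1
    rw [← Polynomial.coe_evalRingHom, RingHom.map_det]
    congr 1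
    ext i j
    by_cases hij : i = j <;> simp [hij, mul_comm s]
  have hp : p ≠ 0 := by
    refine mul_ne_zero Polynomial.X_ne_zero fun h0 => ?_
    have := congrArg (Polynomial.eval 0) h0
    rw [← Polynomial.coe_evalRingHom, RingHom.map_det] at this
    have h1 : (Polynomial.evalRingHom (0 : L)).mapMatrix
        (1 + (Polynomial.X : Polynomial L) • N.map Polynomial.C) = 1 := by
      ext i j
      by_cases hij : i = j <;> simp [hij, Matrix.one_apply]
    rw [h1] at this
    simp at this
  obtain ⟨s, hs⟩ : ∃ s, p.eval s ≠ 0 := by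
    by_contra! hh
    exact hp (Polynomial.funext fun s => by rw [hh s, Polynomial.eval_zero])
  rw [hpe] at hs
  obtain ⟨hs0, hsN⟩ := mul_ne_zero_iff.mp hs
  have hmem : ∀ i, w i + s • x i ∈ LinearMap.range (B (h₀ + s • h)) := by
    intro i
    refine Fin.cases ?_ (fun i => ?_) i
    · refine ⟨s⁻¹ • c, ?_⟩
      have : B h₀ c = 0 := hc
      simp [w, x, this, smul_smul, hs0]
    · exact ⟨u i, by simp [w, x, hu]⟩
  have hli2 : LinearIndependent L (fun i =>
      (⟨_, hmem i⟩ : LinearMap.range (B (h₀ + s • h)))) := by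
    refine LinearIndependent.of_comp (T ∘ₗ Submodule.subtype _) ?_
    have : (⇑(T ∘ₗ (LinearMap.range (B (h₀ + s • h))).subtype) ∘ fun i => ⟨_, hmem i⟩) =
        (1 + s • N).row := by
      funext i
      ext j
      simp only [Function.comp_apply, LinearMap.comp_apply, Submodule.subtype_apply, map_add, hT,
        map_smul, Pi.add_apply, Pi.smul_apply, Matrix.row, Matrix.add_apply, Matrix.smul_apply,
        N, Matrix.of_apply, Matrix.one_apply, Pi.single_apply, eq_comm]
    rw [this, Matrix.linearIndependent_rows_iff_isUnit, Matrix.isUnit_iff_isUnit_det]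
    exact isUnit_iff_ne_zero.mpr hsN
  have h1 := hli2.fintype_card_le_finrank
  rw [Fintype.card_fin] at h1
  have := hmax (h₀ + s • h)
  omega

theorem exists_linearIndependent_mulVec {L : Type} [Field L] {n : ℕ}
    (η : Matrix (Fin n) (Fin n) L) (hη : ∀ t : L, η ≠ t • 1) :
    ∃ (v : Fin n → L) (ψ : Fin n → L), ψ ⬝ᵥ v = 0 ∧ ψ ⬝ᵥ (η.mulVec v) = 1 := by
  classical
  obtain ⟨v, hv⟩ : ∃ v, LinearIndependent L ![v, η.mulVec v] := by
    by_contra! hh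
    obtain ⟨a, ha⟩ := LinearMap.exists_eq_smul_id_of_forall_notLinearIndependent
      (f := Matrix.toLin' η) (by simpa using hh)
    apply hη a
    have := congrArg LinearMap.toMatrix' ha
    simpa using this
  have hker : LinearMap.ker (Fintype.linearCombination L ![v, η.mulVec v]) = ⊥ := by
    rw [LinearMap.ker_eq_bot]
    exact linearIndependent_iff_injective_fintypeLinearCombination.mp hv
  obtain ⟨T, hT⟩ := LinearMap.exists_leftInverse_of_injective _ hker
  let ψ' : (Fin n → L) →ₗ[L] L := LinearMap.proj 1 ∘ₗ T
  have hψ : ∀ x, (fun i => ψ' (Pi.single i 1)) ⬝ᵥ x = ψ' x := by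
    intro x
    conv_rhs => rw [pi_eq_sum_univ' x]
    simp only [dotProduct, map_sum, map_smul, smul_eq_mul]
    refine Finset.sum_congr rfl fun i _ => ?_
    rw [mul_comm]
  have h0 := LinearMap.congr_fun hT (Pi.single 0 1)
  have h1 := LinearMap.congr_fun hT (Pi.single 1 1)
  refine ⟨v, fun i => ψ' (Pi.single i 1), ?_, ?_⟩
  · rw [hψ]
    have := congrFun h0 1
    simpa [ψ', Fintype.linearCombination_apply_single] using this
  · rw [hψ]
    have := congrFun h1 1
    simpa [ψ', Fintype.linearCombination_apply_single] using this

theorem finrank_ge_of_forall_mem {L : Type} [Field L] {n : ℕ}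
    (η μ : Matrix (Fin n) (Fin n) L) (hη : ∀ t : L, η ≠ t • 1)
    (S : Submodule L (Matrix (Fin n) (Fin n) L)) (hS : ∀ h, η * h + h * μ ∈ S) :
    n ≤ Module.finrank L S := by
  obtain ⟨v, ψ, h0, h1⟩ := exists_linearIndependent_mulVec η hη
  let T : (Fin n → L) →ₗ[L] S :=
    { toFun := fun φ => ⟨η * Matrix.vecMulVec v φ + Matrix.vecMulVec v φ * μ, hS _⟩
      map_add' := fun a b => by
        ext1
        simp only [Matrix.vecMulVec_add, mul_add, add_mul, Submodule.coe_add]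
        abel
      map_smul' := fun a b => by
        ext1
        simp [Matrix.vecMulVec_smul, smul_add] }
  have hT : Function.Injective T := by
    rw [← LinearMap.ker_eq_bot, LinearMap.ker_eq_bot']
    intro φ hφ
    have h2 : η * Matrix.vecMulVec v φ + Matrix.vecMulVec v φ * μ = 0 := congrArg Subtype.val hφ
    have h3 := congrArg (Matrix.vecMul ψ) h2
    rw [Matrix.mul_vecMulVec, Matrix.vecMulVec_mul, Matrix.vecMul_add, Matrix.vecMul_vecMulVec,
      Matrix.vecMul_vecMulVec, h0, h1] at h3
    simpa using h3
  simpa using LinearMap.finrank_le_finrank_of_injective hT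

theorem exists_generic_injective {L : Type} [Field L] [Infinite L] {n d : ℕ}
    (η μ : Fin d → Matrix (Fin n) (Fin n) L) (hd : d + 1 ≤ n)
    (hno : ∀ (c : Fin d → L) (t : L), ∑ a, c a • η a = t • 1 → ∑ a, c a • μ a = -t • 1 → c = 0) :
    ∃ h : Matrix (Fin n) (Fin n) L,
      ∀ c : Fin d → L, (∑ a, c a • η a) * h + h * (∑ a, c a • μ a) = 0 → c = 0 := by
  let B : Matrix (Fin n) (Fin n) L →ₗ[L] (Fin d → L) →ₗ[L] Matrix (Fin n) (Fin n) L :=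
    LinearMap.mk₂ L (fun h c => (∑ a, c a • η a) * h + h * (∑ a, c a • μ a))
      (fun h h' c => by simp only [mul_add, add_mul]; abel)
      (fun t h c => by simp [smul_add])
      (fun h c c' => by
        simp only [Pi.add_apply, add_smul, Finset.sum_add_distrib, mul_add, add_mul]; abel)
      (fun t h c => by
        simp only [Pi.smul_apply, smul_assoc, ← Finset.smul_sum, smul_add, Matrix.smul_mul,
          Matrix.mul_smul])
  have hB : ∀ h c, B h c = (∑ a, c a • η a) * h + h * (∑ a, c a • μ a) := fun h c => rfl
  obtain ⟨h₀, hh⟩ := exists_range_maximal B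
  refine ⟨h₀, fun c hc => ?_⟩
  by_contra hc0
  set S := LinearMap.range (B h₀) with hS
  have hrank : Module.finrank L S < n := by
    have h1 := LinearMap.finrank_range_le (B h₀)
    rw [Module.finrank_fin_fun, ← hS] at h1
    omega
  have hmem : ∀ h, (∑ a, c a • η a) * h + h * (∑ a, c a • μ a) ∈ S := hh c hc
  by_cases h1 : ∀ t : L, ∑ a, c a • η a ≠ t • 1
  · have := finrank_ge_of_forall_mem _ _ h1 S hmem
    omega
  by_cases h2 : ∀ t : L, ∑ a, c a • μ a ≠ t • 1
  · have := finrank_ge_of_forall_mem (∑ a, c a • μ a).transpose (∑ a, c a • η a).transpose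
      (fun t ht => h2 t (by rw [← Matrix.transpose_transpose (∑ a, c a • μ a), ht]; simp))
      (S.map (Matrix.transposeLinearEquiv (Fin n) (Fin n) L L).toLinearMap) (fun h => ?_)
    · have h3 := Submodule.finrank_map_le
        (Matrix.transposeLinearEquiv (Fin n) (Fin n) L L).toLinearMap S
      omega
    · refine ⟨_, hmem h.transpose, ?_⟩
      simp [Matrix.transpose_mul, add_comm]
  push Not at h1 h2
  obtain ⟨a, ha⟩ := h1
  obtain ⟨b, hb⟩ := h2
  by_cases hab : a + b = 0
  · exact hc0 (hno c a ha (by rw [hb, eq_neg_of_add_eq_zero_right hab]))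
  · have htop : S = ⊤ := by
      rw [eq_top_iff]
      intro m _
      have := hmem ((a + b)⁻¹ • m)
      rw [ha, hb] at this
      simp only [Matrix.smul_mul, Matrix.mul_smul, one_mul, mul_one] at this
      rw [smul_comm _ a, ← add_smul, smul_smul, mul_inv_cancel₀ hab, one_smul] at this
      exact this
    rw [htop, finrank_top, Module.finrank_matrix] at hrank
    simp only [Fintype.card_fin, Module.finrank_self, mul_one] at hrank
    nlinarith

end pencil

section escapes
open MvPolynomial

theorem escape_pair {n d : ℕ} {K : Type} [Field K]
    (H : Finset (Matrix.SpecialLinearGroup (Fin n) K)) (hH : Escapes H (3 * n * n + n))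
    (η μ : Fin d → Matrix (Fin n) (Fin n) K) (hd : d + 1 ≤ n)
    (hno : ∀ (c : Fin d → K) (t : K), ∑ a, c a • η a = t • 1 → ∑ a, c a • μ a = -t • 1 →
      c = 0 ∧ t = 0) :
    ∃ h ∈ H, ∀ c : Fin d → K, (∑ a, c a • η a) * (h : Matrix (Fin n) (Fin n) K) +
      (h : Matrix (Fin n) (Fin n) K) * (∑ a, c a • μ a) = 0 → c = 0 := by
  classical
  set α := algebraMap K (AlgebraicClosure K) with hα
  obtain ⟨h₀, hh₀⟩ := exists_generic_injective (fun a => α.mapMatrix (η a))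
    (fun a => α.mapMatrix (μ a)) hd (by
    intro c t h1 h2
    let s : (Fin n × Fin n) ⊕ (Fin n × Fin n) → Option (Fin d) → K := fun k a =>
      match k, a with
      | .inl k, none => -(1 : Matrix (Fin n) (Fin n) K) k.1 k.2
      | .inl k, some a => η a k.1 k.2
      | .inr k, none => (1 : Matrix (Fin n) (Fin n) K) k.1 k.2
      | .inr k, some a => μ a k.1 k.2
    have key := linearSystem_baseChange (L := AlgebraicClosure K) s (by
      intro c hc
      obtain ⟨h3, h4⟩ := hno (fun a => c (some a)) (c none) (by
        ext i j
        have := hc (.inl (i, j))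
        simp only [s, Fintype.sum_option] at this
        simp only [Matrix.sum_apply, Matrix.smul_apply, smul_eq_mul]
        simp only [mul_comm (c _)]
        linear_combination this) (by
        ext i j
        have := hc (.inr (i, j))
        simp only [s, Fintype.sum_option] at this
        simp only [Matrix.sum_apply, Matrix.smul_apply, smul_eq_mul]
        simp only [mul_comm (c (some _))]
        linear_combination this)
      funext a
      cases a with
      | none => exact h4
      | some a => exact congrFun h3 a) (fun a => a.elim t c) (by
      rintro (⟨i, j⟩ | ⟨i, j⟩)
      · have := congrFun (congrFun h1 i) j
        simp only [Matrix.sum_apply, Matrix.smul_apply, smul_eq_mul, RingHom.mapMatrix_apply,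
          Matrix.map_apply, mul_comm (c _)] at this
        simp only [s, Fintype.sum_option, Option.elim]
        by_cases hij : i = j <;> simp [hij, Matrix.one_apply] at this ⊢ <;>
          linear_combination this
      · have := congrFun (congrFun h2 i) j
        simp only [Matrix.sum_apply, Matrix.smul_apply, smul_eq_mul, RingHom.mapMatrix_apply,
          Matrix.map_apply, mul_comm (c _)] at this
        simp only [s, Fintype.sum_option, Option.elim]
        by_cases hij : i = j <;> simp [hij, Matrix.one_apply] at this ⊢ <;>
          linear_combination this)
    funext a
    exact congrFun key (some a))
  have hinj : ∀ c : Fin d → AlgebraicClosure K, (∀ k : Fin n × Fin n,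
      ∑ a, (α.mapMatrix (η a) * h₀ + h₀ * α.mapMatrix (μ a)) k.1 k.2 * c a = 0) → c = 0 := by
    intro c hc
    refine hh₀ c ?_
    ext i j
    rw [Matrix.zero_apply, ← hc (i, j), Finset.sum_mul, Finset.mul_sum, ← Finset.sum_add_distrib,
      Matrix.sum_apply]
    refine Finset.sum_congr rfl fun a _ => ?_
    rw [Matrix.smul_mul, Matrix.mul_smul, ← smul_add, Matrix.smul_apply, smul_eq_mul, mul_comm]
  obtain ⟨J, hJ⟩ := exists_minor _ hinj
  set f := (Matrix.of fun a b : Fin d =>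
    ((η b).map C * genMat n K + genMat n K * (μ b).map C :
      Matrix (Fin n) (Fin n) (MvPolynomial (Fin n × Fin n) K)) (J a).1 (J a).2).det with hf
  have hentry : ∀ {R : Type} [CommRing R] [Algebra K R] (M : Matrix (Fin n) (Fin n) R) (i j : Fin d),
      evalMat M (((η j).map C * genMat n K + genMat n K * (μ j).map C :
        Matrix (Fin n) (Fin n) (MvPolynomial (Fin n × Fin n) K)) (J i).1 (J i).2) =
      ((algebraMap K R).mapMatrix (η j) * M + M * (algebraMap K R).mapMatrix (μ j))
        (J i).1 (J i).2 := by
    intro R _ _ M i j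
    have : (evalMat M).mapMatrix ((η j).map C * genMat n K + genMat n K * (μ j).map C) =
      (algebraMap K R).mapMatrix (η j) * M + M * (algebraMap K R).mapMatrix (μ j) := by
      rw [map_add, map_mul, map_mul, evalMat_mapMatrix_C, evalMat_mapMatrix_C,
        evalMat_mapMatrix_genMat]
    rw [← this]; rfl
  have hfeval : ∀ {R : Type} [CommRing R] [Algebra K R] (M : Matrix (Fin n) (Fin n) R),
      evalMat M f = (Matrix.of fun a b : Fin d => ((algebraMap K R).mapMatrix (η b) * M +
        M * (algebraMap K R).mapMatrix (μ b)) (J a).1 (J a).2).det := by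
    intro R _ _ M
    rw [hf, AlgHom.map_det]
    congr 1
    ext i j
    exact hentry M i j
  have hh : HomogFun f := by
    refine homogFun_det _ (fun i => 1) (fun i => 0) fun i j c M => ?_
    rw [Matrix.of_apply, hentry, hentry]
    simp only [Matrix.mul_smul, Matrix.smul_mul, ← smul_add, Matrix.smul_apply, smul_eq_mul]
    ring
  have hf0 : f ≠ 0 := by
    intro h
    have h1 := congrArg (evalMat h₀) h
    rw [hfeval, map_zero] at h1
    exact hJ h1
  have hdeg : f.totalDegree ≤ 3 * n * n + n := by
    have : EntryDeg (Matrix.of fun a b : Fin d =>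
        ((η b).map C * genMat n K + genMat n K * (μ b).map C :
          Matrix (Fin n) (Fin n) (MvPolynomial (Fin n × Fin n) K)) (J a).1 (J a).2) 1 := by
      intro i j
      exact (((EntryDeg.map_C (η j)).mul (genMat_entryDeg n K)).add
        ((genMat_entryDeg n K).mul (EntryDeg.map_C (μ j)))) _ _
    have h2 := this.det
    rw [Fintype.card_fin] at h2
    exact h2.trans (by nlinarith)
  obtain ⟨h, hhH, hne⟩ := hH _ hdeg hf0 hh
  rw [hfeval] at hne
  refine ⟨h, hhH, fun c hc => ?_⟩
  refine Matrix.eq_zero_of_mulVec_eq_zero hne (funext fun i => ?_)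
  have hi := congrFun (congrFun hc (J i).1) (J i).2
  rw [Finset.sum_mul, Finset.mul_sum, ← Finset.sum_add_distrib, Matrix.sum_apply] at hi
  rw [Pi.zero_apply, ← Matrix.zero_apply (J i).1 (J i).2, ← hi]
  simp only [Matrix.mulVec, dotProduct, Matrix.of_apply, algebraMap_mapMatrix_self]
  refine Finset.sum_congr rfl fun a _ => ?_
  rw [Matrix.smul_mul, Matrix.mul_smul, ← smul_add, Matrix.smul_apply, smul_eq_mul, mul_comm]

end escapes

section chain

/-- The matrix over the dual numbers with prescribed components. -/
noncomputable def dualMat {m n : Type} {K : Type} [Field K] (A A' : Matrix m n K) :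
    Matrix m n (DualNumber K) :=
  Matrix.of fun i j => algebraMap K (DualNumber K) (A i j) +
    algebraMap K (DualNumber K) (A' i j) * DualNumber.eps

theorem dualNumber_ext_iff {K : Type} [Field K] (a a' b b' : K) :
    algebraMap K (DualNumber K) a + algebraMap K (DualNumber K) a' * DualNumber.eps =
      algebraMap K (DualNumber K) b + algebraMap K (DualNumber K) b' * DualNumber.eps ↔
    a = b ∧ a' = b' := by
  simp only [TrivSqZeroExt.ext_iff]
  simp [TrivSqZeroExt.algebraMap_eq_inl]

theorem dualMat_inj {m n : Type} {K : Type} [Field K] {A A' B B' : Matrix m n K} :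
    dualMat A A' = dualMat B B' ↔ A = B ∧ A' = B' := by
  constructor
  · intro h
    have : ∀ i j, A i j = B i j ∧ A' i j = B' i j := fun i j =>
      (dualNumber_ext_iff _ _ _ _).mp (congrFun (congrFun h i) j)
    exact ⟨by ext i j; exact (this i j).1, by ext i j; exact (this i j).2⟩
  · rintro ⟨rfl, rfl⟩; rfl

theorem dualMat_mul {n : ℕ} {K : Type} [Field K] (A A' B B' : Matrix (Fin n) (Fin n) K) :
    dualMat A A' * dualMat B B' = dualMat (A * B) (A * B' + A' * B) := by
  refine Matrix.ext fun i j => ?_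
  simp only [dualMat, Matrix.mul_apply, Matrix.of_apply, Matrix.add_apply, map_add, map_sum,
    map_mul, Finset.sum_mul, add_mul]
  rw [← Finset.sum_add_distrib, ← Finset.sum_add_distrib]
  refine Finset.sum_congr rfl fun k _ => ?_
  have := DualNumber.eps_mul_eps (R := K)
  linear_combination (algebraMap K (DualNumber K) (A' i k) * algebraMap K (DualNumber K) (B' k j)) *
    this

theorem dualMat_add {m n : Type} {K : Type} [Field K] (A A' B B' : Matrix m n K) :
    dualMat A A' + dualMat B B' = dualMat (A + B) (A' + B') := by
  refine Matrix.ext fun i j => ?_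
  simp only [dualMat, Matrix.of_apply, Matrix.add_apply, map_add]
  ring

theorem dualMat_zero_right {m n : Type} {K : Type} [Field K] (A : Matrix m n K) :
    dualMat A 0 = A.map (algebraMap K (DualNumber K)) := by
  refine Matrix.ext fun i j => ?_
  simp [dualMat]

theorem dualMat_one {n : ℕ} {K : Type} [Field K] :
    dualMat (1 : Matrix (Fin n) (Fin n) K) 0 = 1 := by
  rw [dualMat_zero_right, Matrix.map_one _ (map_zero _) (map_one _)]

/-- The product `h₀ t₀ h₁ t₁ ⋯`. -/
def chainProd {R : Type} [Ring R] : ∀ {j : ℕ}, (Fin j → R) → (Fin j → R) → R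
  | 0, _, _ => 1
  | _ + 1, h, t => h 0 * t 0 * chainProd (Fin.tail h) (Fin.tail t)

/-- The derivative of `chainProd h` at `t` in the direction `s`. -/
def chainDeriv {R : Type} [Ring R] : ∀ {j : ℕ}, (Fin j → R) → (Fin j → R) → (Fin j → R) → R
  | 0, _, _, _ => 0
  | _ + 1, h, t, s => h 0 * t 0 * chainDeriv (Fin.tail h) (Fin.tail t) (Fin.tail s) +
      h 0 * s 0 * chainProd (Fin.tail h) (Fin.tail t)

theorem map_chainProd {R S : Type} [Ring R] [Ring S] (f : R →+* S) : ∀ {j : ℕ} (h t : Fin j → R),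
    f (chainProd h t) = chainProd (fun i => f (h i)) (fun i => f (t i))
  | 0, _, _ => map_one f
  | j + 1, h, t => by
    simp only [chainProd, map_mul]
    rw [map_chainProd f]
    rfl

theorem chainProd_dualMat {n : ℕ} {K : Type} [Field K] :
    ∀ {j : ℕ} (h t s : Fin j → Matrix (Fin n) (Fin n) K),
    chainProd (fun i => dualMat (h i) 0) (fun i => dualMat (t i) (s i)) =
      dualMat (chainProd h t) (chainDeriv h t s)
  | 0, _, _, _ => dualMat_one.symm
  | j + 1, h, t, s => by
    have := chainProd_dualMat (Fin.tail h) (Fin.tail t) (Fin.tail s)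
    simp only [chainProd, chainDeriv]
    rw [dualMat_mul, zero_mul, add_zero]
    change _ * chainProd (fun i => dualMat (Fin.tail h i) 0)
      (fun i => dualMat (Fin.tail t i) (Fin.tail s i)) = _
    rw [this, dualMat_mul]

theorem isUnit_chainProd {R : Type} [Ring R] : ∀ {j : ℕ} (h t : Fin j → R),
    (∀ i, IsUnit (h i)) → (∀ i, IsUnit (t i)) → IsUnit (chainProd h t)
  | 0, _, _, _, _ => isUnit_one
  | _ + 1, _, _, hh, ht =>
    ((hh 0).mul (ht 0)).mul (isUnit_chainProd _ _ (fun i => hh i.succ) (fun i => ht i.succ))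

theorem chainDeriv_smul {n : ℕ} {K : Type} [Field K] :
    ∀ {j : ℕ} (h t : Fin j → Matrix (Fin n) (Fin n) K) (c : Fin j → K),
    chainDeriv h t (fun i => c i • t i) = (∑ i, c i) • chainProd h t
  | 0, _, _, _ => by simp [chainDeriv]
  | j + 1, h, t, c => by
    have := chainDeriv_smul (Fin.tail h) (Fin.tail t) (Fin.tail c)
    rw [Fin.sum_univ_succ]
    simp only [chainProd, chainDeriv]
    change h 0 * t 0 * chainDeriv (Fin.tail h) (Fin.tail t)
      (fun i => Fin.tail c i • Fin.tail t i) + _ = _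
    rw [this]
    simp only [Matrix.mul_smul, Matrix.smul_mul]
    rw [← add_smul, add_comm]
    rfl

end chain

section torus

theorem pow_sum_injective {n : ℕ} {K : Type} [Field K] (b : Matrix (Fin n) (Fin n) K)
    (hb : SplitReg b) (c : Fin n → K) (hc : ∑ j, c j • b ^ (j : ℕ) = 0) : c = 0 := by
  obtain ⟨P, P', e, h1, h2, he, hbe⟩ := hb
  set α := algebraMap K (AlgebraicClosure K) with hα
  have hd := congrArg α.mapMatrix hc
  rw [map_sum, map_zero] at hd
  have h3 : ∀ k, ∑ j : Fin n, e k ^ (j : ℕ) * α (c j) = 0 := by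
    intro k
    have h4 := congrArg (fun X => (P' * X * P) k k) hd
    simp only [Finset.mul_sum, Finset.sum_mul, Matrix.sum_apply, mul_zero, zero_mul,
      Matrix.zero_apply] at h4
    rw [← h4]
    refine Finset.sum_congr rfl fun j _ => ?_
    have h5 : α.mapMatrix (c j • b ^ (j : ℕ)) = α (c j) • (α.mapMatrix b) ^ (j : ℕ) := by
      rw [← map_pow]; ext; simp
    rw [h5, hbe, conj_diag_pow P P' h1 e j h2, Matrix.mul_smul, Matrix.smul_mul, Matrix.smul_apply]
    have h6 : P' * (P * Matrix.diagonal (fun i => e i ^ (j : ℕ)) * P') * P =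
        Matrix.diagonal (fun i => e i ^ (j : ℕ)) := by
      calc _ = (P' * P) * Matrix.diagonal (fun i => e i ^ (j : ℕ)) * (P' * P) := by
            simp only [Matrix.mul_assoc]
        _ = _ := by rw [h1, one_mul, mul_one]
    rw [h6, Matrix.diagonal_apply_eq, smul_eq_mul, mul_comm]
  have h7 : (fun j => α (c j)) = 0 := by
    refine Matrix.eq_zero_of_mulVec_eq_zero (Matrix.det_vandermonde_ne_zero_iff.mpr he) ?_
    funext k
    exact h3 k
  funext j
  exact (map_eq_zero α).mp (congrFun h7 j)

/-- The centralizer of a regular semisimple matrix is spanned by its powers. -/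
theorem exists_eq_pow_sum {n : ℕ} {K : Type} [Field K] (b : Matrix (Fin n) (Fin n) K)
    (hb : SplitReg b) (X : Matrix (Fin n) (Fin n) K) (hX : X * b = b * X) :
    ∃ x : Fin n → K, X = ∑ j, x j • b ^ (j : ℕ) := by
  by_contra! hnot
  have hinj : ∀ c : Option (Fin n) → K,
      (∀ k : Fin n × Fin n, ∑ a, a.elim (X k.1 k.2) (fun j => (b ^ (j : ℕ)) k.1 k.2) * c a = 0) →
      c = 0 := by
    intro c hc
    have h1 : c none • X + ∑ j, c (some j) • b ^ (j : ℕ) = 0 := by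
      ext i j
      have := hc (i, j)
      rw [Fintype.sum_option] at this
      simpa [Matrix.sum_apply, mul_comm] using this
    have h0 : c none = 0 := by
      by_contra h0
      refine hnot (fun j => -((c none)⁻¹ * c (some j))) ?_
      have := congrArg (fun Y => (c none)⁻¹ • Y) h1
      simp only [smul_add, smul_smul, inv_mul_cancel₀ h0, one_smul, smul_zero, Finset.smul_sum]
        at this
      rw [eq_neg_of_add_eq_zero_left this, ← Finset.sum_neg_distrib]
      simp
    rw [h0, zero_smul, zero_add] at h1
    have := pow_sum_injective b hb _ h1
    funext a
    cases a with
    | none => exact h0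
    | some j => exact congrFun this j
  obtain ⟨P, P', e, h1, h2, he, hbe⟩ := hb
  set α := algebraMap K (AlgebraicClosure K) with hα
  set Y := P' * α.mapMatrix X * P with hY
  have hYX : α.mapMatrix X = P * Y * P' := by
    calc α.mapMatrix X = (P * P') * α.mapMatrix X * (P * P') := by rw [h2, one_mul, mul_one]
      _ = _ := by simp only [hY, Matrix.mul_assoc]
  have hcomm : Y * Matrix.diagonal e = Matrix.diagonal e * Y := by
    have h3 : Matrix.diagonal e = P' * α.mapMatrix b * P := by
      calc Matrix.diagonal e = (P' * P) * Matrix.diagonal e * (P' * P) := by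
            rw [h1, one_mul, mul_one]
        _ = _ := by rw [hbe]; simp only [Matrix.mul_assoc]
    have h4 := congrArg α.mapMatrix hX
    rw [map_mul, map_mul] at h4
    calc Y * Matrix.diagonal e = P' * (α.mapMatrix X * (P * P') * α.mapMatrix b) * P := by
          rw [h3]; simp only [hY, Matrix.mul_assoc]
      _ = P' * (α.mapMatrix b * (P * P') * α.mapMatrix X) * P := by
          rw [h2, mul_one, mul_one, h4]
      _ = _ := by rw [h3]; simp only [hY, Matrix.mul_assoc]
  have hdiag : Y = Matrix.diagonal fun i => Y i i := by
    ext i j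
    by_cases hij : i = j
    · subst hij; simp
    · rw [Matrix.diagonal_apply_ne _ hij]
      have := congrFun (congrFun hcomm i) j
      rw [Matrix.mul_diagonal, Matrix.diagonal_mul] at this
      have h5 : (e j - e i) * Y i j = 0 := by linear_combination this
      exact (mul_eq_zero.mp h5).resolve_left (sub_ne_zero.mpr fun h => hij (he h).symm)
  have hV : IsUnit (Matrix.vandermonde e).det :=
    isUnit_iff_ne_zero.mpr (Matrix.det_vandermonde_ne_zero_iff.mpr he)
  set x := (Matrix.vandermonde e)⁻¹.mulVec fun i => Y i i with hx
  have hxY : ∀ i, ∑ j : Fin n, e i ^ (j : ℕ) * x j = Y i i := by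
    intro i
    have : (Matrix.vandermonde e).mulVec x = fun i => Y i i := by
      rw [hx, Matrix.mulVec_mulVec, Matrix.mul_nonsing_inv _ hV, Matrix.one_mulVec]
    exact congrFun this i
  have hfin : α.mapMatrix X = ∑ j, x j • (α.mapMatrix b) ^ (j : ℕ) := by
    have h6 : ∑ j, x j • (α.mapMatrix b) ^ (j : ℕ) =
        P * (∑ j, x j • Matrix.diagonal fun i => e i ^ (j : ℕ)) * P' := by
      rw [Finset.mul_sum, Finset.sum_mul]
      refine Finset.sum_congr rfl fun j _ => ?_
      rw [hbe, conj_diag_pow P P' h1 e j h2, Matrix.mul_smul, Matrix.smul_mul]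
    rw [h6, hYX]
    congr 2
    rw [hdiag]
    ext i j
    by_cases hij : i = j
    · subst hij
      rw [Matrix.diagonal_apply_eq, ← hxY i, Matrix.sum_apply]
      refine Finset.sum_congr rfl fun k _ => ?_
      simp [mul_comm]
    · simp [Matrix.sum_apply, hij]
  have := linearSystem_baseChange (L := AlgebraicClosure K) _ hinj (fun a => a.elim (-1) x) (by
    intro k
    have := congrFun (congrFun hfin k.1) k.2
    rw [Fintype.sum_option]
    simp only [Option.elim]
    rw [RingHom.mapMatrix_apply, Matrix.map_apply] at this
    rw [this, Matrix.sum_apply, mul_neg_one, neg_add_eq_zero]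
    refine Finset.sum_congr rfl fun j _ => ?_
    rw [← map_pow, Matrix.smul_apply, smul_eq_mul, mul_comm]
    rfl)
  have h8 := congrFun this none
  simp at h8

theorem exists_trace_orthogonal {n d : ℕ} {K : Type} [Field K]
    (S : Submodule K (Matrix (Fin n) (Fin n) K)) (hS : Module.finrank K S + d ≤ n * n) :
    ∃ s : Fin d → Matrix (Fin n) (Fin n) K, (∀ c : Fin d → K, ∑ a, c a • s a = 0 → c = 0) ∧
      ∀ a, ∀ σ ∈ S, (σ * s a).trace = 0 := by
  let T : Matrix (Fin n) (Fin n) K →ₗ[K] Module.Dual K S :=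
    LinearMap.mk₂ K (fun r (σ : S) => ((σ : Matrix (Fin n) (Fin n) K) * r).trace)
      (fun r r' σ => by simp [mul_add])
      (fun t r σ => by simp)
      (fun r σ σ' => by simp [add_mul])
      (fun t r σ => by simp)
  have h1 := LinearMap.finrank_range_add_finrank_ker T
  have h2 := Submodule.finrank_le (LinearMap.range T)
  rw [Subspace.dual_finrank_eq] at h2
  rw [Module.finrank_matrix] at h1
  simp only [Fintype.card_fin, Module.finrank_self, mul_one] at h1
  obtain ⟨f, hf⟩ := exists_linearIndependent_of_le_finrank
    (R := K) (M := LinearMap.ker T) (n := d) (by omega)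
  refine ⟨fun a => f a, fun c hc => ?_, fun a σ hσ => ?_⟩
  · funext a
    refine Fintype.linearIndependent_iff.mp hf c ?_ a
    ext1
    simpa using hc
  · have := (f a).2
    rw [LinearMap.mem_ker] at this
    exact LinearMap.congr_fun this ⟨σ, hσ⟩

theorem exists_conj_disjoint {n : ℕ} {K : Type} [Field K]
    (H : Finset (Matrix.SpecialLinearGroup (Fin n) K)) (hH : Escapes H (3 * n * n + n))
    (b : Matrix (Fin n) (Fin n) K) (hb : SplitReg b) (hn : 1 ≤ n)
    (S : Submodule K (Matrix (Fin n) (Fin n) K)) (h1S : 1 ∈ S)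
    (hS : Module.finrank K S + (n - 1) ≤ n * n)
    (P : Matrix (Fin n) (Fin n) K) (hP : IsUnit P.det) :
    ∃ h ∈ H, ∀ X : Matrix (Fin n) (Fin n) K, X * b = b * X →
      P * ((h : Matrix (Fin n) (Fin n) K) * X * (h⁻¹ : Matrix.SpecialLinearGroup (Fin n) K)) * P⁻¹ ∈ S
        → ∃ c : K, X = c • 1 := by
  classical
  obtain ⟨s, hs, hsS⟩ := exists_trace_orthogonal S hS
  obtain ⟨h, hhH, hh⟩ := escape_conj H hH b hb (fun a => P⁻¹ * s a * P) (by omega) (by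
    intro c hc
    apply hs
    have := congrArg (fun X => P * X * P⁻¹) hc
    simp only [Finset.mul_sum, Finset.sum_mul, mul_zero, zero_mul] at this
    rw [← this]
    refine Finset.sum_congr rfl fun a _ => ?_
    rw [Matrix.mul_smul, Matrix.smul_mul]
    congr 1
    calc s a = (P * P⁻¹) * s a * (P * P⁻¹) := by
          rw [Matrix.mul_nonsing_inv _ hP, one_mul, mul_one]
      _ = _ := by simp only [Matrix.mul_assoc])
  refine ⟨h, hhH, fun X hXb hXS => ?_⟩
  set hi : Matrix (Fin n) (Fin n) K :=
    ((h⁻¹ : Matrix.SpecialLinearGroup (Fin n) K) : Matrix (Fin n) (Fin n) K) with hhi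
  obtain ⟨J, hJ⟩ := exists_minor
    (fun (j : Fin n) a => ((h : Matrix (Fin n) (Fin n) K) * b ^ (j : ℕ) * hi * (P⁻¹ * s a * P)).trace)
    (by
      intro c hc
      refine hh c fun j => ?_
      rw [← hc j, Finset.mul_sum, Matrix.trace_sum]
      refine Finset.sum_congr rfl fun a _ => ?_
      rw [Matrix.mul_smul, Matrix.trace_smul, smul_eq_mul, mul_comm])
  let T : (Fin n → K) →ₗ[K] (Fin (n - 1) → K) := Matrix.mulVecLin (Matrix.of fun a (j : Fin n) =>
    ((h : Matrix (Fin n) (Fin n) K) * b ^ (j : ℕ) * hi * (P⁻¹ * s a * P)).trace)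
  have hTx : ∀ (x : Fin n → K) a, T x a =
      (P * ((h : Matrix (Fin n) (Fin n) K) * (∑ j, x j • b ^ (j : ℕ)) * hi) * P⁻¹ * s a).trace := by
    intro x a
    have : (P * ((h : Matrix (Fin n) (Fin n) K) * (∑ j, x j • b ^ (j : ℕ)) * hi) * P⁻¹ * s a).trace
        = ((h : Matrix (Fin n) (Fin n) K) * (∑ j, x j • b ^ (j : ℕ)) * hi * (P⁻¹ * s a * P)).trace
        := by
      rw [Matrix.mul_assoc, Matrix.mul_assoc, Matrix.trace_mul_comm]
      simp only [Matrix.mul_assoc]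
    rw [this, Finset.mul_sum, Finset.sum_mul, Finset.sum_mul, Matrix.trace_sum]
    simp only [T, Matrix.mulVecLin_apply, Matrix.mulVec, dotProduct, Matrix.of_apply]
    refine Finset.sum_congr rfl fun j _ => ?_
    simp only [Matrix.mul_smul, Matrix.smul_mul, Matrix.trace_smul, smul_eq_mul, mul_comm]
  have hsurj : Function.Surjective T := by
    intro y
    set M := (Matrix.of fun a' a => ((h : Matrix (Fin n) (Fin n) K) * b ^ (J a' : ℕ) * hi *
      (P⁻¹ * s a * P)).trace) with hM
    have hMT : IsUnit M.transpose.det := by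
      rw [Matrix.det_transpose]; exact isUnit_iff_ne_zero.mpr hJ
    set z := M.transpose⁻¹.mulVec y with hz
    have hz' : M.transpose.mulVec z = y := by
      rw [hz, Matrix.mulVec_mulVec, Matrix.mul_nonsing_inv _ hMT, Matrix.one_mulVec]
    refine ⟨∑ a', z a' • Pi.single (J a') 1, ?_⟩
    rw [← hz', map_sum]
    funext a
    simp only [map_smul, Finset.sum_apply, Pi.smul_apply, smul_eq_mul, T, Matrix.mulVecLin_apply,
      Matrix.mulVec_single_one, Matrix.mulVec, dotProduct, Matrix.transpose_apply, hM,
      Matrix.of_apply, Matrix.col]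
    exact Finset.sum_congr rfl fun _ _ => mul_comm _ _
  have hker : Module.finrank K (LinearMap.ker T) = 1 := by
    have := LinearMap.finrank_range_add_finrank_ker T
    rw [LinearMap.range_eq_top.mpr hsurj, finrank_top, Module.finrank_fin_fun,
      Module.finrank_fin_fun] at this
    omega
  obtain ⟨x, rfl⟩ := exists_eq_pow_sum b hb X hXb
  have hxk : x ∈ LinearMap.ker T := by
    rw [LinearMap.mem_ker]
    funext a
    rw [hTx]
    exact hsS a _ hXS
  have hone : ∑ j : Fin n, (Pi.single (⟨0, hn⟩ : Fin n) (1 : K) : Fin n → K) j • b ^ (j : ℕ) = 1 := by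
    rw [Finset.sum_eq_single ⟨0, hn⟩]
    · simp
    · intro j _ hj; simp [hj]
    · simp
  have h1k : (Pi.single (⟨0, hn⟩ : Fin n) (1 : K) : Fin n → K) ∈ LinearMap.ker T := by
    rw [LinearMap.mem_ker]
    funext a
    rw [hTx, hone, mul_one]
    have hhi1 : (h : Matrix (Fin n) (Fin n) K) * hi = 1 := by
      rw [hhi, ← Matrix.SpecialLinearGroup.coe_mul, mul_inv_cancel,
        Matrix.SpecialLinearGroup.coe_one]
    rw [hhi1, mul_one, Matrix.mul_nonsing_inv _ hP]
    exact hsS a _ h1S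
  obtain ⟨c, hc⟩ := (finrank_eq_one_iff_of_nonzero' (⟨_, h1k⟩ : LinearMap.ker T) (by
    intro h0
    have := congrFun (congrArg Subtype.val h0) ⟨0, hn⟩
    simp at this)).mp hker ⟨x, hxk⟩
  refine ⟨c, ?_⟩
  have hc' := congrArg Subtype.val hc
  simp only [Submodule.coe_smul] at hc'
  rw [← hone, ← hc', Finset.smul_sum]
  refine Finset.sum_congr rfl fun j _ => ?_
  rw [Pi.smul_apply, smul_smul, smul_eq_mul]

end torus

section toruschain

theorem torus_chain {n : ℕ} {K : Type} [Field K]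
    (H : Finset (Matrix.SpecialLinearGroup (Fin n) K)) (hH : Escapes H (3 * n * n + n))
    (b : Matrix (Fin n) (Fin n) K) (hb : SplitReg b) (hn : 1 ≤ n) (j : ℕ) :
    ∀ (S : Submodule K (Matrix (Fin n) (Fin n) K)), 1 ∈ S →
      Module.finrank K S + j * (n - 1) ≤ n * n →
    ∀ P : Matrix (Fin n) (Fin n) K, IsUnit P →
    ∀ t : Fin j → Matrix (Fin n) (Fin n) K, (∀ i, IsUnit (t i)) → (∀ i, t i * b = b * t i) →
    ∃ h : Fin j → Matrix.SpecialLinearGroup (Fin n) K, (∀ i, h i ∈ H) ∧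
      ∀ s : Fin j → Matrix (Fin n) (Fin n) K, (∀ i, s i * b = b * s i) → ∀ σ ∈ S,
        P * chainDeriv (fun i => (h i : Matrix (Fin n) (Fin n) K)) t s =
          σ * (P * chainProd (fun i => (h i : Matrix (Fin n) (Fin n) K)) t) →
        ∃ c : Fin j → K, ∀ i, s i = c i • t i := by
  induction j with
  | zero =>
    intro S _ _ P _ t _ _
    exact ⟨Fin.elim0, fun i => i.elim0, fun s _ σ _ _ => ⟨Fin.elim0, fun i => i.elim0⟩⟩
  | succ j ih =>
    intro S h1S hdim P hP t ht htb
    have hPd : IsUnit P.det := (Matrix.isUnit_iff_isUnit_det _).mp hP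
    obtain ⟨h₀, hh₀, hsc⟩ := exists_conj_disjoint H hH b hb hn S h1S (by nlinarith) P hPd
    set m : Matrix (Fin n) (Fin n) K := (h₀ : Matrix (Fin n) (Fin n) K) with hm
    set mi : Matrix (Fin n) (Fin n) K :=
      ((h₀⁻¹ : Matrix.SpecialLinearGroup (Fin n) K) : Matrix (Fin n) (Fin n) K) with hmi
    have hmmi : m * mi = 1 := by
      rw [hm, hmi, ← Matrix.SpecialLinearGroup.coe_mul, mul_inv_cancel,
        Matrix.SpecialLinearGroup.coe_one]
    have hmim : mi * m = 1 := mul_eq_one_comm.mp hmmi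
    have hPi : P * P⁻¹ = 1 := Matrix.mul_nonsing_inv _ hPd
    have hPi' : P⁻¹ * P = 1 := Matrix.nonsing_inv_mul _ hPd
    set S' := S ⊔ Submodule.span K
      (Set.range fun k : Fin (n - 1) => P * (m * b ^ (k + 1 : ℕ) * mi) * P⁻¹) with hS'
    have hdim' : Module.finrank K S' + j * (n - 1) ≤ n * n := by
      have h1 := Submodule.finrank_add_le_finrank_add_finrank S (Submodule.span K
        (Set.range fun k : Fin (n - 1) => P * (m * b ^ (k + 1 : ℕ) * mi) * P⁻¹))
      have h2 := finrank_range_le_card (R := K)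
        (fun k : Fin (n - 1) => P * (m * b ^ (k + 1 : ℕ) * mi) * P⁻¹)
      rw [Fintype.card_fin, Set.finrank] at h2
      rw [← hS'] at h1
      have h3 : (j + 1) * (n - 1) = j * (n - 1) + (n - 1) := by ring
      omega
    have hmem : ∀ X, X * b = b * X → P * (m * X * mi) * P⁻¹ ∈ S' := by
      intro X hX
      obtain ⟨x, rfl⟩ := exists_eq_pow_sum b hb X hX
      simp only [Finset.mul_sum, Finset.sum_mul, Matrix.mul_smul, Matrix.smul_mul]
      refine Submodule.sum_mem _ fun k _ => Submodule.smul_mem _ _ ?_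
      rcases Nat.eq_zero_or_pos (k : ℕ) with hk | hk
      · rw [hk, pow_zero, mul_one, hmmi, mul_one, hPi]
        exact Submodule.mem_sup_left h1S
      · refine Submodule.mem_sup_right (Submodule.subset_span ⟨⟨k - 1, by omega⟩, ?_⟩)
        simp only [Nat.sub_add_cancel hk]
    have hmu : IsUnit m := IsUnit.of_mul_eq_one _ hmmi
    have hP' : IsUnit (P * (m * t 0)) := hP.mul (hmu.mul (ht 0))
    obtain ⟨h', hh', hrig⟩ := ih S' (Submodule.mem_sup_left h1S) hdim' (P * (m * t 0)) hP'
      (Fin.tail t) (fun i => ht i.succ) (fun i => htb i.succ)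
    refine ⟨Fin.cons h₀ h', fun i => Fin.cases hh₀ hh' i, fun s hs σ hσ heq => ?_⟩
    set hT : Fin j → Matrix (Fin n) (Fin n) K := fun i => (h' i : Matrix (Fin n) (Fin n) K) with hhT
    have heq' : P * (m * t 0 * chainDeriv hT (Fin.tail t) (Fin.tail s) +
        m * s 0 * chainProd hT (Fin.tail t)) =
        σ * (P * (m * t 0 * chainProd hT (Fin.tail t))) := heq
    set W₁ := chainProd hT (Fin.tail t) with hW
    set D₁ := chainDeriv hT (Fin.tail t) (Fin.tail s) with hD
    have htd : IsUnit (t 0).det := (Matrix.isUnit_iff_isUnit_det _).mp (ht 0)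
    set u := (t 0)⁻¹ with hu
    have htu : t 0 * u = 1 := Matrix.mul_nonsing_inv _ htd
    have hut : u * t 0 = 1 := Matrix.nonsing_inv_mul _ htd
    have hub : u * b = b * u := by
      calc u * b = u * (b * t 0) * u := by rw [Matrix.mul_assoc, Matrix.mul_assoc, htu, mul_one]
        _ = (u * t 0) * b * u := by rw [← htb 0, Matrix.mul_assoc u (t 0) b]
        _ = b * u := by rw [hut, one_mul]
    have hsub : (s 0 * u) * b = b * (s 0 * u) := by
      rw [Matrix.mul_assoc, hub, ← Matrix.mul_assoc, hs 0, Matrix.mul_assoc]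
    set τ := P * (m * (s 0 * u) * mi) * P⁻¹ with hτ
    have hτP : τ * (P * (m * t 0)) = P * (m * s 0) := by
      calc τ * (P * (m * t 0)) = P * m * s 0 * (u * ((mi * ((P⁻¹ * P) * m)) * t 0)) := by
            simp only [hτ, Matrix.mul_assoc]
        _ = _ := by rw [hPi', one_mul, hmim, one_mul, hut, mul_one, Matrix.mul_assoc]
    have hstep : P * (m * t 0) * D₁ = (σ - τ) * (P * (m * t 0) * W₁) := by
      rw [sub_mul, ← Matrix.mul_assoc τ, hτP]
      simp only [Matrix.mul_assoc, mul_add] at heq' ⊢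
      rw [eq_sub_iff_add_eq]
      exact heq'
    obtain ⟨c, hc⟩ := hrig (Fin.tail s) (fun i => hs i.succ) (σ - τ)
      (Submodule.sub_mem _ (Submodule.mem_sup_left hσ) (hmem _ hsub)) hstep
    have hD₁ : D₁ = (∑ i, c i) • W₁ := by
      have : Fin.tail s = fun i => c i • Fin.tail t i := funext hc
      rw [hD, this, chainDeriv_smul]
    have hWu : IsUnit W₁ := isUnit_chainProd _ _
      (fun i => IsUnit.of_mul_eq_one ((h' i)⁻¹ : Matrix.SpecialLinearGroup (Fin n) K).1 (by
        have : ((h' i * (h' i)⁻¹ : Matrix.SpecialLinearGroup (Fin n) K) :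
          Matrix (Fin n) (Fin n) K) = 1 := by
          rw [mul_inv_cancel, Matrix.SpecialLinearGroup.coe_one]
        rwa [Matrix.SpecialLinearGroup.coe_mul] at this)) (fun i => ht i.succ)
    have hτ' : τ = σ - (∑ i, c i) • 1 := by
      have h1 : ((∑ i, c i) • 1) * (P * (m * t 0) * W₁) = (σ - τ) * (P * (m * t 0) * W₁) := by
        rw [← hstep, hD₁]; simp
      have := (hP'.mul hWu).mul_right_cancel h1
      rw [this]; abel
    obtain ⟨c₀, hc₀⟩ := hsc (s 0 * u) hsub (by
      change τ ∈ S
      rw [hτ']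
      exact Submodule.sub_mem _ hσ (Submodule.smul_mem _ _ h1S))
    refine ⟨Fin.cons c₀ c, fun i => Fin.cases ?_ hc i⟩
    calc s 0 = s 0 * (u * t 0) := by rw [hut, mul_one]
      _ = _ := by rw [← Matrix.mul_assoc, hc₀, Matrix.smul_mul, one_mul]; rfl

end toruschain

section matrixequations
open MvPolynomial

/-- The generic matrix with index `i` in a family of matrices. -/
noncomputable def famMat {ι : Type} {n : ℕ} {K : Type} [Field K] (i : ι) :
    Matrix (Fin n) (Fin n) (MvPolynomial (ι × Fin n × Fin n) K) :=
  Matrix.of fun p q => X (i, p, q)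

theorem famMat_entryDeg {ι : Type} {n : ℕ} {K : Type} [Field K] (i : ι) :
    EntryDeg (famMat i : Matrix (Fin n) (Fin n) (MvPolynomial (ι × Fin n × Fin n) K)) 1 :=
  fun p q => by simp [famMat]

/-- Evaluation of a polynomial at a family of matrices. -/
noncomputable def evalFam {ι : Type} {n : ℕ} {K R : Type} [Field K] [CommRing R] [Algebra K R]
    (M : ι → Matrix (Fin n) (Fin n) R) : MvPolynomial (ι × Fin n × Fin n) K →ₐ[K] R :=
  aeval fun p => M p.1 p.2.1 p.2.2

theorem evalFam_famMat {ι : Type} {n : ℕ} {K R : Type} [Field K] [CommRing R] [Algebra K R]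
    (M : ι → Matrix (Fin n) (Fin n) R) (i : ι) :
    (evalFam (K := K) M).mapMatrix (famMat i) = M i := by
  ext p q; simp [famMat, evalFam]

theorem evalFam_map_C {ι : Type} {n : ℕ} {K R : Type} [Field K] [CommRing R] [Algebra K R]
    (M : ι → Matrix (Fin n) (Fin n) R) (g : Matrix (Fin n) (Fin n) K) :
    (evalFam (K := K) M).mapMatrix (g.map C) = g.map (algebraMap K R) := by
  ext p q; simp [evalFam]

/-- The first order neighbourhood of a family of matrices. -/
noncomputable def evalTangent {ι : Type} {n : ℕ} {K : Type} [Field K]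
    (x v : ι → Matrix (Fin n) (Fin n) K) :
    MvPolynomial (ι × Fin n × Fin n) K →ₐ[K] DualNumber K :=
  evalFam fun i => dualMat (x i) (v i)

theorem evalTangent_famMat {ι : Type} {n : ℕ} {K : Type} [Field K]
    (x v : ι → Matrix (Fin n) (Fin n) K) (i : ι) :
    (evalTangent x v).mapMatrix (famMat i) = dualMat (x i) (v i) :=
  evalFam_famMat _ i

theorem evalTangent_map_C {ι : Type} {n : ℕ} {K : Type} [Field K]
    (x v : ι → Matrix (Fin n) (Fin n) K) (g : Matrix (Fin n) (Fin n) K) :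
    (evalTangent x v).mapMatrix (g.map C) = dualMat g 0 := by
  rw [dualMat_zero_right]
  exact evalFam_map_C _ g

theorem bezout_matrix (ι κ : Type) [Fintype ι] [Fintype κ] (n D : ℕ) :
    ∃ C : ℕ, ∀ (K : Type) [Field K]
      (F : κ → Matrix (Fin n) (Fin n) (MvPolynomial (ι × Fin n × Fin n) K)),
      (∀ k, EntryDeg (F k) D) → ∀ Z : Finset (ι → Matrix (Fin n) (Fin n) K),
      (∀ x ∈ Z, (∀ k, (evalFam x).mapMatrix (F k) = 0) ∧
        ∀ v, (∀ k, (evalTangent x v).mapMatrix (F k) = 0) → v = 0) → Z.card ≤ C := by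
  classical
  obtain ⟨C, hC⟩ := bezout_dual (ι × Fin n × Fin n) (κ × Fin n × Fin n) D
  refine ⟨C, fun K _ F hF Z hZ => ?_⟩
  let e : (ι → Matrix (Fin n) (Fin n) K) → (ι × Fin n × Fin n → K) :=
    fun x p => x p.1 p.2.1 p.2.2
  have he : Function.Injective e := fun x y h => by
    funext i
    ext p q
    exact congrFun h (i, p, q)
  rw [← Finset.card_image_of_injective Z he]
  refine hC K (fun p => F p.1 p.2.1 p.2.2) (fun p => hF _ _ _) _ fun y hy => ?_
  obtain ⟨x, hx, rfl⟩ := Finset.mem_image.mp hy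
  obtain ⟨h1, h2⟩ := hZ x hx
  refine ⟨fun p => ?_, fun v hv => ?_⟩
  · have := congrFun (congrFun (h1 p.1) p.2.1) p.2.2
    simpa [evalFam, e, aeval_def] using this
  · let w : ι → Matrix (Fin n) (Fin n) K := fun i => Matrix.of fun p q => v (i, p, q)
    have hw : w = 0 := h2 w fun k => by
      refine Matrix.ext fun p q => ?_
      exact hv (k, p, q)
    funext p
    exact congrFun (congrFun (congrFun hw p.1) p.2.1) p.2.2

theorem EntryDeg.chainProd {σ K : Type} [Field K] {n : ℕ} {d e : ℕ} :
    ∀ {j : ℕ} (h t : Fin j → Matrix (Fin n) (Fin n) (MvPolynomial σ K)),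
    (∀ i, EntryDeg (h i) d) → (∀ i, EntryDeg (t i) e) → EntryDeg (chainProd h t) (j * (d + e))
  | 0, _, _, _, _ => EntryDeg.one.mono (by simp)
  | j + 1, h, t, hh, ht =>
    (((hh 0).mul (ht 0)).mul (EntryDeg.chainProd (Fin.tail h) (Fin.tail t)
      (fun i => hh i.succ) (fun i => ht i.succ))).mono (by rw [Nat.succ_mul, Nat.add_comm])

end matrixequations

section torusfibre
open MvPolynomial

theorem algHom_mapMatrix_smul {n : ℕ} {K R S : Type} [Field K] [CommRing R] [CommRing S]
    [Algebra K R] [Algebra K S] (f : R →ₐ[K] S) (r : R) (M : Matrix (Fin n) (Fin n) R) :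
    f.mapMatrix (r • M) = f r • f.mapMatrix M := by
  ext i j; simp

theorem dualMat_smul {n : ℕ} {K : Type} [Field K] (a a' : K) (A A' : Matrix (Fin n) (Fin n) K) :
    (algebraMap K (DualNumber K) a + algebraMap K (DualNumber K) a' * DualNumber.eps) •
      dualMat A A' = dualMat (a • A) (a • A' + a' • A) := by
  refine Matrix.ext fun i j => ?_
  simp only [dualMat, Matrix.smul_apply, Matrix.of_apply, Matrix.add_apply, smul_eq_mul, map_add,
    map_mul]
  have heps : (DualNumber.eps : DualNumber K) * DualNumber.eps = 0 := DualNumber.eps_mul_eps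
  linear_combination (algebraMap K (DualNumber K) a' * algebraMap K (DualNumber K) (A' i j)) * heps

theorem torus_fibre (n : ℕ) : ∃ C₁ : ℕ, ∀ (K : Type) [Field K] (b g : Matrix (Fin n) (Fin n) K)
    (_ : g ≠ 0) (h : Fin (n + 1) → Matrix (Fin n) (Fin n) K)
    (pos : Fin (n + 1) → Fin n × Fin n) (Z : Finset (Fin (n + 1) → Matrix (Fin n) (Fin n) K)),
    (∀ x ∈ Z, (∀ i, x i * b = b * x i) ∧ (∀ i, x i (pos i).1 (pos i).2 = 1) ∧
      (∃ c : K, c ≠ 0 ∧ chainProd h x = c • g) ∧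
      ∀ s : Fin (n + 1) → Matrix (Fin n) (Fin n) K, (∀ i, s i * b = b * s i) → ∀ r : K,
        chainDeriv h x s = r • chainProd h x → ∃ c : Fin (n + 1) → K, ∀ i, s i = c i • x i) →
    Z.card ≤ C₁ := by
  obtain ⟨C₁, hC⟩ := bezout_matrix (Fin (n + 1)) ((Fin (n + 1) ⊕ Fin (n + 1)) ⊕ Unit) n
    ((n + 1) * (0 + 1) + 1)
  refine ⟨C₁, fun K _ b g hg h pos Z hZ => ?_⟩
  obtain ⟨p₀, q₀, hpq⟩ : ∃ p q, g p q ≠ 0 := by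
    by_contra! hh
    exact hg (by ext p q; exact hh p q)
  let W := chainProd (fun i => (h i).map (C (σ := Fin (n + 1) × Fin n × Fin n)))
    (fun i => famMat (K := K) (n := n) i)
  have hW : EntryDeg W ((n + 1) * (0 + 1)) :=
    EntryDeg.chainProd _ _ (fun i => EntryDeg.map_C _) (fun i => famMat_entryDeg i)
  let F : (Fin (n + 1) ⊕ Fin (n + 1)) ⊕ Unit →
      Matrix (Fin n) (Fin n) (MvPolynomial (Fin (n + 1) × Fin n × Fin n) K) :=
    Sum.elim (Sum.elim (fun i => famMat (K := K) (n := n) i * b.map C - b.map C * famMat i)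
      (fun i => (famMat (K := K) i (pos i).1 (pos i).2) • 1 - 1))
      fun _ => (C (g p₀ q₀) : MvPolynomial (Fin (n + 1) × Fin n × Fin n) K) • W -
        (W p₀ q₀) • g.map C
  have hF1 : ∀ i, F (Sum.inl (Sum.inl i)) = famMat i * b.map C - b.map C * famMat i :=
    fun _ => rfl
  have hF2 : ∀ i, F (Sum.inl (Sum.inr i)) = (famMat i (pos i).1 (pos i).2) • 1 - 1 :=
    fun _ => rfl
  have hF3 : ∀ u, F (Sum.inr u) =
      (C (g p₀ q₀) : MvPolynomial (Fin (n + 1) × Fin n × Fin n) K) • W - (W p₀ q₀) • g.map C :=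
    fun _ => rfl
  refine hC K F ?_ Z fun x hx => ?_
  · rintro ((i | i) | u)
    · rw [hF1]
      exact (((famMat_entryDeg i).mul (EntryDeg.map_C b)).sub
        ((EntryDeg.map_C b).mul (famMat_entryDeg i))).mono (by simp)
    · rw [hF2]
      exact ((EntryDeg.one.smul (famMat_entryDeg i _ _)).sub EntryDeg.one).mono (by simp)
    · rw [hF3]
      refine ((hW.smul (e := 0) (by simp)).sub ((EntryDeg.map_C g).smul (hW _ _))).mono ?_
      simp
  obtain ⟨hxb, hxpos, ⟨c, hc, hxg⟩, hrig⟩ := hZ x hx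
  constructor
  · have hWx : (evalFam x).mapMatrix W = c • g := by
      rw [← hxg]
      refine (map_chainProd (S := Matrix (Fin n) (Fin n) K)
        (R := Matrix (Fin n) (Fin n) (MvPolynomial (Fin (n + 1) × Fin n × Fin n) K))
        (evalFam (K := K) x).mapMatrix.toRingHom _ _).trans ?_
      congr 1 <;> funext i
      · exact (evalFam_map_C x (h i)).trans (by ext; simp)
      · exact evalFam_famMat x i
    have hgC : (evalFam x).mapMatrix (g.map C) = g :=
      (evalFam_map_C x g).trans (by ext; simp)
    have hbC : (evalFam x).mapMatrix (b.map C) = b :=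
      (evalFam_map_C x b).trans (by ext; simp)
    have hW0 : evalFam x (W p₀ q₀) = c * g p₀ q₀ := congrFun (congrFun hWx p₀) q₀
    have hX0 : ∀ i p q, evalFam (K := K) x (famMat i p q) = x i p q := fun i p q =>
      congrFun (congrFun (evalFam_famMat x i) p) q
    rintro ((i | i) | u)
    · rw [hF1, map_sub, map_mul, map_mul, hbC, evalFam_famMat, hxb, sub_self]
    · rw [hF2, map_sub, algHom_mapMatrix_smul, map_one, hX0, hxpos, one_smul, sub_self]
    · rw [hF3, map_sub, algHom_mapMatrix_smul, algHom_mapMatrix_smul, hgC, hWx, hW0]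
      rw [show evalFam (K := K) x (C (g p₀ q₀)) = g p₀ q₀ from (evalFam x).commutes _, smul_smul,
        mul_comm, sub_self]
  · intro v hv
    have hWx : (evalTangent x v).mapMatrix W = dualMat (chainProd h x) (chainDeriv h x v) := by
      rw [← chainProd_dualMat]
      refine (map_chainProd (S := Matrix (Fin n) (Fin n) (DualNumber K))
        (R := Matrix (Fin n) (Fin n) (MvPolynomial (Fin (n + 1) × Fin n × Fin n) K))
        (evalTangent x v).mapMatrix.toRingHom _ _).trans ?_
      congr 1 <;> funext i
      · exact evalTangent_map_C x v (h i)
      · exact evalTangent_famMat x v i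
    have hX0 : ∀ i p q, evalTangent x v (famMat i p q) = dualMat (x i) (v i) p q := fun i p q =>
      congrFun (congrFun (evalTangent_famMat x v i) p) q
    have hvb : ∀ i, v i * b = b * v i := by
      intro i
      have := hv (Sum.inl (Sum.inl i))
      rw [hF1, map_sub, map_mul, map_mul, evalTangent_famMat, evalTangent_map_C, dualMat_mul,
        dualMat_mul, sub_eq_zero, dualMat_inj] at this
      simpa using this.2
    have hvpos : ∀ i, v i (pos i).1 (pos i).2 = 0 := by
      intro i
      have := hv (Sum.inl (Sum.inr i))
      rw [hF2, map_sub, algHom_mapMatrix_smul, map_one, hX0, ← dualMat_one, dualMat, Matrix.of_apply,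
        dualMat_smul, sub_eq_zero, dualMat_inj] at this
      have h2 := congrFun (congrFun this.2 (pos i).1) (pos i).1
      simpa using h2
    have hprod : ∃ r : K, chainDeriv h x v = r • chainProd h x := by
      have := hv (Sum.inr ())
      have hCg : evalTangent x v (C (g p₀ q₀)) = algebraMap K (DualNumber K) (g p₀ q₀) +
          algebraMap K (DualNumber K) 0 * DualNumber.eps := by
        rw [map_zero, zero_mul, add_zero]
        exact (evalTangent x v).commutes _
      have hW0 : evalTangent x v (W p₀ q₀) = dualMat (chainProd h x) (chainDeriv h x v) p₀ q₀ :=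
        congrFun (congrFun hWx p₀) q₀
      rw [hF3, map_sub, algHom_mapMatrix_smul, algHom_mapMatrix_smul, hWx, hW0,
        evalTangent_map_C, hCg, dualMat_smul, sub_eq_zero] at this
      rw [show dualMat (chainProd h x) (chainDeriv h x v) p₀ q₀ =
        algebraMap K (DualNumber K) (chainProd h x p₀ q₀) +
        algebraMap K (DualNumber K) (chainDeriv h x v p₀ q₀) * DualNumber.eps from rfl,
        dualMat_smul, dualMat_inj] at this
      have h2 := this.2
      rw [zero_smul, add_zero, smul_zero, zero_add] at h2
      refine ⟨(g p₀ q₀)⁻¹ * chainDeriv h x v p₀ q₀ * c⁻¹, ?_⟩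
      rw [hxg, smul_smul, mul_assoc _ c⁻¹, inv_mul_cancel₀ hc, mul_one, ← smul_smul, ← h2,
        smul_smul, inv_mul_cancel₀ hpq, one_smul]
    obtain ⟨r, hr⟩ := hprod
    obtain ⟨e, he⟩ := hrig v hvb r hr
    funext i
    have h1 := hvpos i
    rw [he i, Matrix.smul_apply, hxpos, smul_eq_mul, mul_one] at h1
    rw [he i, h1, zero_smul]; rfl

end torusfibre

section torusbound

theorem card_le_of_smul_eq {n : ℕ} {K : Type} [Field K] [Fintype K] (hn : 1 ≤ n)
    (T : Finset (Matrix.SpecialLinearGroup (Fin n) K))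
    (hT : ∀ t ∈ T, ∀ t' ∈ T, ∃ c : K, (t : Matrix (Fin n) (Fin n) K) = c • (t' : Matrix _ _ K)) :
    T.card ≤ n := by
  classical
  rcases T.eq_empty_or_nonempty with rfl | ⟨t', ht'⟩
  · simp
  have hc : ∀ t, ∃ c : K, t ∈ T → (t : Matrix (Fin n) (Fin n) K) = c • (t' : Matrix _ _ K) := by
    intro t
    by_cases h : t ∈ T
    · obtain ⟨c, hc⟩ := hT t h t' ht'
      exact ⟨c, fun _ => hc⟩
    · exact ⟨0, fun h' => absurd h' h⟩
  choose c hc using hc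
  have h1 : T.card ≤ (Polynomial.nthRoots n (1 : K)).toFinset.card := by
    refine Finset.card_le_card_of_injOn c (fun t ht => ?_) fun t ht t₁ ht₁ he => ?_
    · rw [Finset.mem_coe, Multiset.mem_toFinset, Polynomial.mem_nthRoots hn]
      have h := congrArg Matrix.det (hc t ht)
      rw [Matrix.det_smul, Fintype.card_fin, t.2, t'.2, mul_one] at h
      exact h.symm
    · apply Subtype.ext
      rw [hc t ht, hc t₁ ht₁, he]
  exact h1.trans ((Multiset.toFinset_card_le _).trans (Polynomial.card_nthRoots n 1))

theorem torus_bound (n : ℕ) (hn : 2 ≤ n) (c₀ : ℕ) : ∃ C : ℕ, ∀ (K : Type) [Field K] [Fintype K]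
    (H : Finset (Matrix.SpecialLinearGroup (Fin n) K)), Escapes H (3 * n * n + n) → H.card ≤ c₀ →
    ∀ (A : Set (Matrix.SpecialLinearGroup (Fin n) K)) (k₀ : ℕ), (∀ h ∈ H, h ∈ prodSet A k₀) →
    ∀ b : Matrix (Fin n) (Fin n) K, SplitReg b →
    ∀ T : Finset (Matrix.SpecialLinearGroup (Fin n) K),
      (∀ t ∈ T, t ∈ prodSet A 2 ∧ (t : Matrix (Fin n) (Fin n) K) * b = b * t) →
      T.card ^ (n + 1) ≤ C * (prodSet A ((n + 1) * (k₀ + 2))).ncard := by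
  classical
  obtain ⟨C₁, hC₁⟩ := torus_fibre n
  refine ⟨n ^ (n + 1) * (C₁ * (c₀ ^ (n + 1) * (n * n) ^ (n + 1))),
    fun K _ _ H hH hHc A k₀ hA b hb T hT => ?_⟩
  have hfin : Finite (Matrix.SpecialLinearGroup (Fin n) K) := Subtype.finite
  have hne : Nonempty (Fin n) := ⟨⟨0, by omega⟩⟩
  have hpos : ∀ t : Matrix.SpecialLinearGroup (Fin n) K, ∃ p : Fin n × Fin n,
      (t : Matrix (Fin n) (Fin n) K) p.1 p.2 ≠ 0 := by
    intro t
    by_contra! hh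
    have h0 : (t : Matrix (Fin n) (Fin n) K) = 0 := by ext p q; exact hh (p, q)
    have h1 := t.2
    rw [h0, Matrix.det_zero] at h1
    exact zero_ne_one h1
  choose pos hpos using hpos
  let norm : Matrix.SpecialLinearGroup (Fin n) K → Matrix (Fin n) (Fin n) K :=
    fun t => ((t : Matrix (Fin n) (Fin n) K) (pos t).1 (pos t).2)⁻¹ • (t : Matrix _ _ K)
  have hnorm : ∀ t : Matrix.SpecialLinearGroup (Fin n) K,
      ((t : Matrix (Fin n) (Fin n) K) (pos t).1 (pos t).2) • norm t = t := fun t => by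
    simp only [norm]
    rw [smul_smul, mul_inv_cancel₀ (hpos t), one_smul]
  set B := T.image norm with hB
  have hTB : T.card ≤ n * B.card := by
    refine Finset.card_le_mul_card_image T n fun β _ => ?_
    refine card_le_of_smul_eq (by omega) _ fun t ht t' ht' => ?_
    rw [Finset.mem_filter] at ht ht'
    refine ⟨((t : Matrix (Fin n) (Fin n) K) (pos t).1 (pos t).2) *
      ((t' : Matrix (Fin n) (Fin n) K) (pos t').1 (pos t').2)⁻¹, ?_⟩
    conv_lhs => rw [← hnorm t, ht.2, ← ht'.2]
    simp only [norm, smul_smul]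
  have hunit : ∀ t : Matrix.SpecialLinearGroup (Fin n) K,
      IsUnit (t : Matrix (Fin n) (Fin n) K) := fun t =>
    (Matrix.isUnit_iff_isUnit_det _).mpr (by rw [t.2]; exact isUnit_one)
  let AK := (Set.toFinite (prodSet A ((n + 1) * (k₀ + 2)))).toFinset
  have hAK : AK.card = (prodSet A ((n + 1) * (k₀ + 2))).ncard :=
    (Set.ncard_eq_toFinset_card _ _).symm
  let Tgt := Fintype.piFinset (fun _ : Fin (n + 1) => H) ×ˢ
    (Finset.univ : Finset (Fin (n + 1) → Fin n × Fin n)) ×ˢ AK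
  have hS : Module.finrank K (Submodule.span K {(1 : Matrix (Fin n) (Fin n) K)}) ≤ 1 := by
    have := finrank_span_le_card (R := K) ({(1 : Matrix (Fin n) (Fin n) K)} : Set _)
    simpa using this
  have hlift : ∀ β ∈ B, ∃ t ∈ T, ∃ c : K, c ≠ 0 ∧ c • β = t ∧ β (pos t).1 (pos t).2 = 1 := by
    intro β hβ
    obtain ⟨t, ht, rfl⟩ := Finset.mem_image.mp hβ
    refine ⟨t, ht, _, hpos t, hnorm t, ?_⟩
    simp only [norm, Matrix.smul_apply, smul_eq_mul]
    exact inv_mul_cancel₀ (hpos t)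
  choose! lift hliftT hlift using hlift
  choose! cf hcf0 hcf hlpos using hlift
  have hmemA : ∀ j : ℕ, ∀ h t : Fin j → Matrix.SpecialLinearGroup (Fin n) K,
      (∀ i, h i ∈ prodSet A k₀) → (∀ i, t i ∈ prodSet A 2) →
      ∃ g ∈ prodSet A (j * (k₀ + 2)), (g : Matrix (Fin n) (Fin n) K) =
        chainProd (fun i => (h i : Matrix (Fin n) (Fin n) K)) (fun i => (t i : Matrix _ _ K)) := by
    intro j
    induction j with
    | zero => exact fun h t _ _ => ⟨1, one_mem_prodSet A _, rfl⟩
    | succ j ih =>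
      intro h t hh ht
      obtain ⟨g, hg, hge⟩ := ih (Fin.tail h) (Fin.tail t) (fun i => hh i.succ) fun i => ht i.succ
      refine ⟨h 0 * t 0 * g, ?_, ?_⟩
      · have := mul_mem_prodSet A (mul_mem_prodSet A (hh 0) (ht 0)) hg
        rwa [show (j + 1) * (k₀ + 2) = k₀ + 2 + j * (k₀ + 2) by ring]
      · rw [Matrix.SpecialLinearGroup.coe_mul, Matrix.SpecialLinearGroup.coe_mul, hge]; rfl
  have hscale : ∀ j : ℕ, ∀ (h x t : Fin j → Matrix (Fin n) (Fin n) K) (c : Fin j → K),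
      (∀ i, c i ≠ 0) → (∀ i, c i • x i = t i) →
      ∃ r : K, r ≠ 0 ∧ chainProd h x = r • chainProd h t := by
    intro j
    induction j with
    | zero => exact fun h x t c _ _ => ⟨1, one_ne_zero, by simp [chainProd]⟩
    | succ j ih =>
      intro h x t c hc hx
      obtain ⟨r, hr, he⟩ := ih (Fin.tail h) (Fin.tail x) (Fin.tail t) (Fin.tail c)
        (fun i => hc i.succ) fun i => hx i.succ
      refine ⟨r * (c 0)⁻¹, mul_ne_zero hr (inv_ne_zero (hc 0)), ?_⟩
      have hx0 : x 0 = (c 0)⁻¹ • t 0 := by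
        rw [← hx 0, smul_smul, inv_mul_cancel₀ (hc 0), one_smul]
      simp only [chainProd]
      rw [he, hx0]
      simp only [Matrix.mul_smul, Matrix.smul_mul, smul_smul]
  have hkey : ∀ x ∈ Fintype.piFinset (fun _ : Fin (n + 1) => B), ∃ τ ∈ Tgt,
      (∀ i, x i * b = b * x i) ∧ (∀ i, x i (τ.2.1 i).1 (τ.2.1 i).2 = 1) ∧
      (∃ c : K, c ≠ 0 ∧ chainProd (fun i => (τ.1 i : Matrix (Fin n) (Fin n) K)) x =
        c • (τ.2.2 : Matrix (Fin n) (Fin n) K)) ∧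
      ∀ s : Fin (n + 1) → Matrix (Fin n) (Fin n) K, (∀ i, s i * b = b * s i) → ∀ r : K,
        chainDeriv (fun i => (τ.1 i : Matrix (Fin n) (Fin n) K)) x s =
          r • chainProd (fun i => (τ.1 i : Matrix (Fin n) (Fin n) K)) x →
        ∃ c : Fin (n + 1) → K, ∀ i, s i = c i • x i := by
    intro x hx
    rw [Fintype.mem_piFinset] at hx
    have hxt : ∀ i, x i = (cf (x i))⁻¹ • (lift (x i) : Matrix (Fin n) (Fin n) K) := fun i => by
      rw [← hcf _ (hx i), smul_smul, inv_mul_cancel₀ (hcf0 _ (hx i)), one_smul]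
    have hxb : ∀ i, x i * b = b * x i := fun i => by
      rw [hxt i, Matrix.smul_mul, Matrix.mul_smul, (hT _ (hliftT _ (hx i))).2]
    have hxu : ∀ i, IsUnit (x i) := fun i => by
      rw [Matrix.isUnit_iff_isUnit_det, hxt i, Matrix.det_smul, (lift (x i)).2, mul_one]
      exact (IsUnit.mk0 _ (inv_ne_zero (hcf0 _ (hx i)))).pow _
    obtain ⟨h, hhH, hrig⟩ := torus_chain H hH b hb (by omega) (n + 1)
      (Submodule.span K {1}) (Submodule.mem_span_singleton_self 1)
      (by
        obtain ⟨m, rfl⟩ : ∃ m, n = m + 1 := ⟨n - 1, by omega⟩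
        have : (m + 1 + 1) * (m + 1 - 1) + 1 = (m + 1) * (m + 1) := by
          rw [Nat.add_sub_cancel]; ring
        omega) 1 isUnit_one x hxu hxb
    obtain ⟨g, hg, hge⟩ := hmemA (n + 1) h (fun i => lift (x i)) (fun i => hA _ (hhH i))
      fun i => (hT _ (hliftT _ (hx i))).1
    obtain ⟨r, hr, hre⟩ := hscale (n + 1) (fun i => (h i : Matrix (Fin n) (Fin n) K)) x
      (fun i => (lift (x i) : Matrix (Fin n) (Fin n) K)) (fun i => cf (x i))
      (fun i => hcf0 _ (hx i)) fun i => hcf _ (hx i)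
    refine ⟨(h, fun i => pos (lift (x i)), g), ?_, hxb, fun i => hlpos _ (hx i),
      ⟨r, hr, by rw [hge]; exact hre⟩, fun s hs r hsr => ?_⟩
    · simp only [Tgt, Finset.mem_product, Fintype.mem_piFinset, Finset.mem_univ, true_and, AK,
        Set.Finite.mem_toFinset]
      exact ⟨hhH, hg⟩
    · refine hrig s hs (r • 1) (Submodule.smul_mem _ _ (Submodule.mem_span_singleton_self 1)) ?_
      rw [one_mul, one_mul, Matrix.smul_mul, one_mul]
      exact hsr
  choose! f hf hfp using hkey
  have hcard : (Fintype.piFinset (fun _ : Fin (n + 1) => B)).card ≤ C₁ * Tgt.card := by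
    refine Finset.card_le_mul_card_image_of_maps_to hf C₁ fun τ _ => ?_
    refine hC₁ K b (τ.2.2 : Matrix (Fin n) (Fin n) K) ?_
      (fun i => (τ.1 i : Matrix (Fin n) (Fin n) K)) τ.2.1 _ fun x hx => ?_
    · intro h0
      exact hpos τ.2.2 (by rw [h0]; rfl)
    · rw [Finset.mem_filter] at hx
      obtain ⟨hx1, rfl⟩ := hx
      exact hfp x hx1
  have hTgt : Tgt.card ≤ c₀ ^ (n + 1) * ((n * n) ^ (n + 1) * AK.card) := by
    simp only [Tgt, Finset.card_product, Fintype.card_piFinset, Finset.prod_const,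
      Finset.card_univ, Fintype.card_fin, Fintype.card_fun, Fintype.card_prod]
    gcongr
  rw [Fintype.card_piFinset, Finset.prod_const, Finset.card_univ, Fintype.card_fin] at hcard
  calc T.card ^ (n + 1) ≤ (n * B.card) ^ (n + 1) := Nat.pow_le_pow_left hTB _
    _ = n ^ (n + 1) * B.card ^ (n + 1) := mul_pow _ _ _
    _ ≤ n ^ (n + 1) * (C₁ * (c₀ ^ (n + 1) * ((n * n) ^ (n + 1) * AK.card))) := by
        gcongr
        exact hcard.trans (Nat.mul_le_mul_left _ hTgt)
    _ = _ := by rw [hAK]; ring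

end torusbound

section polyderiv
open Polynomial

theorem smul_dualMat {m n : Type} {K : Type} [Field K] (c : K) (A A' : Matrix m n K) :
    c • dualMat A A' = dualMat (c • A) (c • A') := by
  refine Matrix.ext fun i j => ?_
  simp only [dualMat, Matrix.smul_apply, Matrix.of_apply, smul_eq_mul, map_mul,
    Algebra.smul_def]
  ring

/-- The derivative of `W ↦ p(W)` on matrices. -/
theorem exists_polyDeriv {n : ℕ} {K : Type} [Field K] (W : Matrix (Fin n) (Fin n) K) (p : K[X]) :
    ∃ L : Matrix (Fin n) (Fin n) K →ₗ[K] Matrix (Fin n) (Fin n) K,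
      (∀ Y, aeval (dualMat W Y) p = dualMat (aeval W p) (L Y)) ∧
      (∀ Q Y, Q * W = W * Q → (Q * L Y).trace = (Q * aeval W (derivative p) * Y).trace) ∧
      (∀ Y, Y * W = W * Y → L Y = aeval W (derivative p) * Y) := by
  induction p using Polynomial.induction_on with
  | C a =>
    refine ⟨0, fun Y => ?_, fun Q Y _ => by simp, fun Y _ => by simp⟩
    rw [aeval_C, aeval_C, Algebra.algebraMap_eq_smul_one, Algebra.algebraMap_eq_smul_one,
      ← dualMat_one, smul_dualMat, smul_zero]
    rfl
  | add p q hp hq =>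
    obtain ⟨L, h1, h2, h3⟩ := hp
    obtain ⟨L', h1', h2', h3'⟩ := hq
    refine ⟨L + L', fun Y => ?_, fun Q Y hQ => ?_, fun Y hY => ?_⟩
    · rw [map_add, map_add, h1, h1', dualMat_add, LinearMap.add_apply]
    · rw [LinearMap.add_apply, mul_add, Matrix.trace_add, h2 Q Y hQ, h2' Q Y hQ, derivative_add,
        map_add, mul_add, add_mul, Matrix.trace_add]
    · rw [LinearMap.add_apply, h3 Y hY, h3' Y hY, derivative_add, map_add, add_mul]
  | monomial m a ih =>
    obtain ⟨L, h1, h2, h3⟩ := ih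
    have hd : aeval W (derivative (C a * X ^ (m + 1))) =
        aeval W (C a * X ^ m) + aeval W (derivative (C a * X ^ m)) * W := by
      rw [pow_succ, ← mul_assoc, derivative_mul, derivative_X, mul_one, map_add, map_mul, aeval_X,
        add_comm]
    have hc : ∀ q : K[X], aeval W q * W = W * aeval W q := fun q => by
      have := congrArg (aeval W) (mul_comm q X)
      rwa [map_mul, map_mul, aeval_X] at this
    refine ⟨LinearMap.mulLeft K (aeval W (C a * X ^ m)) + (LinearMap.mulRight K W).comp L,
      fun Y => ?_, fun Q Y hQ => ?_, fun Y hY => ?_⟩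
    · rw [pow_succ, ← mul_assoc, map_mul (aeval (dualMat W Y)), map_mul (aeval W), aeval_X, aeval_X,
        h1, dualMat_mul]
      rfl
    · rw [LinearMap.add_apply, LinearMap.comp_apply, LinearMap.mulLeft_apply,
        LinearMap.mulRight_apply, mul_add, Matrix.trace_add, hd, mul_add, add_mul, Matrix.trace_add,
        ← mul_assoc Q, ← mul_assoc Q (L Y) W, Matrix.trace_mul_comm (Q * L Y) W, ← mul_assoc W,
        h2 (W * Q) Y (by rw [mul_assoc, hQ]), hc, ← mul_assoc Q W, hQ]
    · rw [LinearMap.add_apply, LinearMap.comp_apply, LinearMap.mulLeft_apply,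
        LinearMap.mulRight_apply, hd, h3 Y hY, add_mul, mul_assoc _ Y W, hY, mul_assoc _ W Y]

end polyderiv

section centralizer
open Polynomial

/-- The centralizer of a matrix, as a subspace. -/
def centSub {n : ℕ} {K : Type} [Field K] (b : Matrix (Fin n) (Fin n) K) :
    Submodule K (Matrix (Fin n) (Fin n) K) :=
  LinearMap.ker (LinearMap.mulRight K b - LinearMap.mulLeft K b)

theorem mem_centSub {n : ℕ} {K : Type} [Field K] {b X : Matrix (Fin n) (Fin n) K} :
    X ∈ centSub b ↔ X * b = b * X := by
  rw [centSub, LinearMap.mem_ker, LinearMap.sub_apply, LinearMap.mulRight_apply,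
    LinearMap.mulLeft_apply, sub_eq_zero]

theorem le_finrank_centSub {n : ℕ} {K : Type} [Field K] (b : Matrix (Fin n) (Fin n) K)
    (P P' : Matrix (Fin n) (Fin n) (AlgebraicClosure K)) (e : Fin n → AlgebraicClosure K)
    (h1 : P' * P = 1) (hbe : (algebraMap K (AlgebraicClosure K)).mapMatrix b =
      P * Matrix.diagonal e * P') : n ≤ Module.finrank K (centSub b) := by
  by_contra! hlt
  set l := Module.finrank K (centSub b) with hl
  set α := algebraMap K (AlgebraicClosure K) with hα
  let E := Module.finBasis K (centSub b)
  obtain ⟨φ, hφ⟩ := LinearMap.exists_extend (E.equivFun : centSub b →ₗ[K] (Fin l → K))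
  have hφ0 : ∀ X ∈ centSub b, φ X = 0 → X = 0 := by
    intro X hX h
    have h2 : E.equivFun ⟨X, hX⟩ = 0 := by
      rw [← h]
      exact (LinearMap.congr_fun hφ ⟨X, hX⟩).symm
    exact congrArg Subtype.val (E.equivFun.map_eq_zero_iff.mp h2)
  let s : (Fin n × Fin n) ⊕ Fin l → Fin n × Fin n → K := fun k p => k.elim
    (fun q => (Matrix.single p.1 p.2 (1 : K) * b - b * Matrix.single p.1 p.2 (1 : K)) q.1 q.2)
    fun a => φ (Matrix.single p.1 p.2 (1 : K)) a
  have hinj : ∀ c : Fin n × Fin n → K, (∀ k, ∑ p, s k p * c p = 0) → c = 0 := by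
    intro c hc
    set X : Matrix (Fin n) (Fin n) K := ∑ p, c p • Matrix.single p.1 p.2 (1 : K) with hX
    have hXe : ∀ p q, X p q = c (p, q) := by
      intro p q
      rw [hX, Matrix.sum_apply, Fintype.sum_eq_single (p, q)]
      · simp
      · intro r hr
        rw [Matrix.smul_apply, Matrix.single_apply, if_neg, smul_zero]
        rintro ⟨rfl, rfl⟩
        exact hr rfl
    have hXc : X ∈ centSub b := by
      rw [mem_centSub, ← sub_eq_zero]
      ext p q
      have := hc (Sum.inl (p, q))
      simp only [s, Sum.elim_inl] at this
      rw [hX, Finset.sum_mul, Finset.mul_sum, ← Finset.sum_sub_distrib, Matrix.sum_apply]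
      rw [Matrix.zero_apply, ← this]
      refine Finset.sum_congr rfl fun r _ => ?_
      rw [Matrix.smul_mul, Matrix.mul_smul, ← smul_sub, Matrix.smul_apply, smul_eq_mul, mul_comm]
    have hφX : φ X = 0 := by
      funext a
      have := hc (Sum.inr a)
      simp only [s, Sum.elim_inr] at this
      rw [hX, map_sum, Finset.sum_apply, Pi.zero_apply, ← this]
      refine Finset.sum_congr rfl fun r _ => ?_
      rw [map_smul, Pi.smul_apply, smul_eq_mul, mul_comm]
    have h0 := hφ0 X hXc hφX
    funext p
    rw [← hXe, h0]; rfl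
  let D : (Fin n → AlgebraicClosure K) →ₗ[AlgebraicClosure K] (Fin l → AlgebraicClosure K) :=
    LinearMap.pi fun a => ∑ p : Fin n × Fin n, α (s (Sum.inr a) p) •
      ((LinearMap.proj p.2).comp ((LinearMap.proj p.1).comp
        ((LinearMap.mulRight (AlgebraicClosure K) P').comp
        ((LinearMap.mulLeft (AlgebraicClosure K) P).comp
          (Matrix.diagonalLinearMap (Fin n) (AlgebraicClosure K) (AlgebraicClosure K))))))
  have hD : LinearMap.ker D ≠ ⊥ := LinearMap.ker_ne_bot_of_finrank_lt (by simpa using hlt)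
  obtain ⟨x, hx, hx0⟩ := (Submodule.ne_bot_iff _).mp hD
  set Z := P * Matrix.diagonal x * P' with hZ
  have hZb : Z * α.mapMatrix b - α.mapMatrix b * Z = 0 := by
    rw [hbe, hZ, sub_eq_zero]
    calc _ = P * (Matrix.diagonal x * (P' * P) * Matrix.diagonal e) * P' := by
          simp only [Matrix.mul_assoc]
      _ = P * (Matrix.diagonal e * (P' * P) * Matrix.diagonal x) * P' := by
          rw [h1, mul_one, mul_one, Matrix.diagonal_mul_diagonal, Matrix.diagonal_mul_diagonal]
          simp only [mul_comm]
      _ = _ := by simp only [Matrix.mul_assoc]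
  have hZ0 : (fun p : Fin n × Fin n => Z p.1 p.2) = 0 := by
    refine linearSystem_baseChange s hinj _ ?_
    rintro (k | a)
    · have h3 : Z = ∑ p : Fin n × Fin n, Z p.1 p.2 • α.mapMatrix (Matrix.single p.1 p.2 (1 : K)) := by
        ext p q
        rw [Matrix.sum_apply, Fintype.sum_eq_single (p, q)]
        · simp
        · intro r hr
          rw [Matrix.smul_apply, RingHom.mapMatrix_apply, Matrix.map_apply, Matrix.single_apply,
            if_neg, map_zero, smul_zero]
          rintro ⟨rfl, rfl⟩
          exact hr rfl
      have h4 := congrFun (congrFun hZb k.1) k.2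
      rw [h3, Finset.sum_mul, Finset.mul_sum, ← Finset.sum_sub_distrib, Matrix.sum_apply,
        Matrix.zero_apply] at h4
      rw [← h4]
      refine Finset.sum_congr rfl fun p _ => ?_
      rw [Matrix.smul_mul, Matrix.mul_smul, ← smul_sub, ← map_mul, ← map_mul, ← map_sub,
        Matrix.smul_apply, smul_eq_mul, mul_comm]
      rfl
    · have h3 := congrFun (LinearMap.mem_ker.mp hx) a
      simp only [D, LinearMap.pi_apply, LinearMap.sum_apply, LinearMap.smul_apply, smul_eq_mul,
        LinearMap.comp_apply] at h3
      exact h3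
  have hZz : Z = 0 := by
    ext p q
    exact congrFun hZ0 (p, q)
  apply hx0
  have h5 : Matrix.diagonal x = 0 := by
    calc Matrix.diagonal x = (P' * P) * Matrix.diagonal x * (P' * P) := by
          rw [h1, one_mul, mul_one]
      _ = P' * Z * P := by simp only [hZ, Matrix.mul_assoc]
      _ = 0 := by rw [hZz]; simp
  funext i
  have := congrFun (congrFun h5 i) i
  simpa using this

theorem finrank_comap_le {K V W : Type} [Field K] [AddCommGroup V] [AddCommGroup W] [Module K V]
    [Module K W] [FiniteDimensional K V] [FiniteDimensional K W] (L : V →ₗ[K] W)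
    (S : Submodule K W) :
    Module.finrank K (S.comap L) ≤ Module.finrank K (LinearMap.ker L) + Module.finrank K S := by
  have h1 := LinearMap.finrank_range_add_finrank_ker (L.domRestrict (S.comap L))
  have h2 : Module.finrank K (LinearMap.range (L.domRestrict (S.comap L))) ≤ Module.finrank K S := by
    refine Submodule.finrank_mono ?_
    rintro _ ⟨x, rfl⟩
    exact x.2
  have h3 : Module.finrank K (LinearMap.ker (L.domRestrict (S.comap L))) ≤
      Module.finrank K (LinearMap.ker L) := by
    rw [← Submodule.finrank_map_subtype_eq (S.comap L)]
    refine Submodule.finrank_mono ?_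
    rintro _ ⟨x, hx, rfl⟩
    exact hx
  omega

/-- For a matrix with separable minimal polynomial, the derivative of the minimal polynomial maps
onto the centralizer. -/
theorem range_polyDeriv {n : ℕ} {K : Type} [Field K] (b : Matrix (Fin n) (Fin n) K)
    (f : K[X]) (hf : f.Separable) (hfb : aeval b f = 0)
    (L : Matrix (Fin n) (Fin n) K →ₗ[K] Matrix (Fin n) (Fin n) K)
    (hL1 : ∀ Y, aeval (dualMat b Y) f = dualMat (aeval b f) (L Y))
    (hL3 : ∀ Y, Y * b = b * Y → L Y = aeval b (derivative f) * Y) :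
    LinearMap.range L = centSub b := by
  obtain ⟨a, c, hac⟩ := hf
  have hac' : aeval b (derivative f) * aeval b c = 1 := by
    have := congrArg (aeval b) hac
    rwa [map_add, map_mul, map_mul, hfb, mul_zero, zero_add, map_one, ← map_mul, mul_comm,
      map_mul] at this
  apply le_antisymm
  · rintro _ ⟨Y, rfl⟩
    rw [mem_centSub]
    have h : aeval (dualMat b Y) f * dualMat b Y = dualMat b Y * aeval (dualMat b Y) f := by
      have := congrArg (aeval (dualMat b Y)) (mul_comm f X)
      rwa [map_mul, map_mul, aeval_X] at this
    rw [hL1, hfb, dualMat_mul, dualMat_mul, dualMat_inj] at h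
    simpa using h.2
  · intro X hX
    have hcX : aeval b c * b = b * aeval b c := by
      have := congrArg (aeval b) (mul_comm c Polynomial.X)
      rwa [map_mul, map_mul, aeval_X] at this
    refine ⟨aeval b c * X, ?_⟩
    rw [hL3, ← mul_assoc, hac', one_mul]
    rw [mul_assoc, mem_centSub.mp hX, ← mul_assoc, hcX, mul_assoc]

theorem exists_trace_ne_zero {n : ℕ} {K : Type} [Field K] (hn : 1 ≤ n)
    (b : Matrix (Fin n) (Fin n) K) (f : K[X]) (hf : f.Separable) (hfb : aeval b f = 0) :
    ∃ X ∈ centSub b, X.trace ≠ 0 := by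
  obtain ⟨L, hL1, hL2, hL3⟩ := exists_polyDeriv b f
  have hr := range_polyDeriv b f hf hfb L hL1 hL3
  obtain ⟨a, c, hac⟩ := hf
  have hac' : aeval b (derivative f) * aeval b c = 1 := by
    have := congrArg (aeval b) hac
    rwa [map_add, map_mul, map_mul, hfb, mul_zero, zero_add, map_one, ← map_mul, mul_comm,
      map_mul] at this
  refine ⟨L (aeval b c * Matrix.single ⟨0, by omega⟩ ⟨0, by omega⟩ 1),
    hr ▸ LinearMap.mem_range_self L _, ?_⟩
  have := hL2 1 (aeval b c * Matrix.single ⟨0, by omega⟩ ⟨0, by omega⟩ 1) (by simp)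
  rw [one_mul] at this
  rw [this, one_mul, ← mul_assoc, hac', one_mul, Matrix.trace_single_eq_same]
  exact one_ne_zero

end centralizer

section pairchain

theorem exists_submodule_between {K V : Type} [Field K] [AddCommGroup V] [Module K V]
    [FiniteDimensional K V] (S₀ C : Submodule K V) (h : S₀ ≤ C) (m : ℕ)
    (h1 : Module.finrank K S₀ ≤ m) (h2 : m ≤ Module.finrank K C) :
    ∃ S, S₀ ≤ S ∧ S ≤ C ∧ Module.finrank K S = m := by
  induction m, h1 using Nat.le_induction with
  | base => exact ⟨S₀, le_rfl, h, rfl⟩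
  | succ m hm ih =>
    obtain ⟨S, hS1, hS2, hS3⟩ := ih (by omega)
    have hne : S ≠ C := by
      rintro rfl
      omega
    obtain ⟨x, hxC, hxS⟩ := SetLike.exists_of_lt (lt_of_le_of_ne hS2 hne)
    refine ⟨S ⊔ Submodule.span K {x}, hS1.trans le_sup_left,
      sup_le hS2 ((Submodule.span_singleton_le_iff_mem _ _).mpr hxC), ?_⟩
    have hlt : S < S ⊔ Submodule.span K {x} := by
      refine lt_of_le_of_ne le_sup_left fun he => hxS ?_
      rw [he]
      exact Submodule.mem_sup_right (Submodule.mem_span_singleton_self x)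
    have h3 := Submodule.finrank_lt_finrank_of_lt hlt
    have h4 := Submodule.finrank_add_le_finrank_add_finrank S (Submodule.span K {x})
    have h5 : Module.finrank K (Submodule.span K {x}) ≤ 1 := by
      simpa using finrank_span_le_card (R := K) ({x} : Set V)
    omega

theorem finrank_add_le_of_disjoint {K V : Type} [Field K] [AddCommGroup V] [Module K V]
    [FiniteDimensional K V] (S R C : Submodule K V) (hS : S ≤ C) (hR : R ≤ C)
    (h : ∀ x ∈ S, x ∈ R → x = 0) :
    Module.finrank K R + Module.finrank K S ≤ Module.finrank K C := by
  have h1 := Submodule.finrank_sup_add_finrank_inf_eq R S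
  have h2 : R ⊓ S = ⊥ := by
    rw [eq_bot_iff]
    exact fun x hx => (Submodule.mem_bot K).mpr (h x hx.2 hx.1)
  rw [h2, finrank_bot, add_zero] at h1
  rw [← h1]
  exact Submodule.finrank_mono (sup_le hR hS)

/-- The first order conditions on a pair coming from a word. -/
def wordKer {n : ℕ} {K : Type} [Field K] (w h h' : Matrix (Fin n) (Fin n) K) :
    Submodule K (Matrix (Fin n) (Fin n) K × Matrix (Fin n) (Fin n) K) where
  carrier := {z | ∀ j : Fin n, (w ^ (j : ℕ) * (z.1 + h * z.2 * h')).trace = 0}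
  add_mem' {a b} ha hb j := by
    have : w ^ (j : ℕ) * ((a + b).1 + h * (a + b).2 * h') =
      w ^ (j : ℕ) * (a.1 + h * a.2 * h') + w ^ (j : ℕ) * (b.1 + h * b.2 * h') := by
      rw [Prod.fst_add, Prod.snd_add]; noncomm_ring
    rw [this, Matrix.trace_add, ha j, hb j, add_zero]
  zero_mem' j := by simp
  smul_mem' c a ha j := by
    have : w ^ (j : ℕ) * ((c • a).1 + h * (c • a).2 * h') =
      c • (w ^ (j : ℕ) * (a.1 + h * a.2 * h')) := by
      simp [Matrix.mul_add]
    rw [this, Matrix.trace_smul, ha j, smul_zero]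

theorem mem_wordKer {n : ℕ} {K : Type} [Field K] {w h h' : Matrix (Fin n) (Fin n) K}
    {z : Matrix (Fin n) (Fin n) K × Matrix (Fin n) (Fin n) K} :
    z ∈ wordKer w h h' ↔ ∀ j : Fin n, (w ^ (j : ℕ) * (z.1 + h * z.2 * h')).trace = 0 := Iff.rfl

theorem exists_family {K V : Type} [Field K] [AddCommGroup V] [Module K V]
    [FiniteDimensional K V] (S : Submodule K V) (m : ℕ) (hm : Module.finrank K S = m) :
    ∃ s : Fin m → V, (∀ a, s a ∈ S) ∧ (∀ c : Fin m → K, ∑ a, c a • s a = 0 → c = 0) ∧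
      ∀ x ∈ S, ∃ c : Fin m → K, ∑ a, c a • s a = x := by
  let E := Module.finBasisOfFinrankEq K S hm
  refine ⟨fun a => E a, fun a => (E a).2, fun c hc => ?_, fun x hx => ⟨E.equivFun ⟨x, hx⟩, ?_⟩⟩
  · have : ∑ a, c a • E a = 0 := Subtype.ext (by simpa using hc)
    funext a
    exact Fintype.linearIndependent_iff.mp E.linearIndependent c this a
  · have := congrArg Subtype.val (E.sum_equivFun ⟨x, hx⟩)
    rwa [Submodule.coe_sum] at this

theorem pair_step {n : ℕ} {K : Type} [Field K]
    (H : Finset (Matrix.SpecialLinearGroup (Fin n) K)) (hH : Escapes H (3 * n * n + n))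
    (hn : 1 ≤ n) (u y : Matrix.SpecialLinearGroup (Fin n) K)
    (V : Submodule K (Matrix (Fin n) (Fin n) K × Matrix (Fin n) (Fin n) K))
    (hV : ∀ t : K, (t • (1 : Matrix (Fin n) (Fin n) K), -t • (1 : Matrix (Fin n) (Fin n) K)) ∈ V →
      t = 0) :
    ∃ h' ∈ H, ∃ h ∈ H,
      gramDet ((h' * u * h * y : Matrix.SpecialLinearGroup (Fin n) K) :
        Matrix (Fin n) (Fin n) K) ≠ 0 ∧
      Module.finrank K (V ⊓ wordKer ((h' * u * h * y : Matrix.SpecialLinearGroup (Fin n) K) :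
        Matrix (Fin n) (Fin n) K) h' (h'⁻¹ : Matrix.SpecialLinearGroup (Fin n) K) :
        Submodule K _) ≤ Module.finrank K V - (n - 1) := by
  set d := min (n - 1) (Module.finrank K V) with hd
  obtain ⟨S, -, hSV, hSd⟩ := exists_submodule_between ⊥ V bot_le d (by simp) (min_le_right _ _)
  obtain ⟨s, hsS, hsli, hsspan⟩ := exists_family S d hSd
  have hsum : ∀ c : Fin d → K, ∑ a, c a • s a = (∑ a, c a • (s a).1, ∑ a, c a • (s a).2) := by
    intro c
    ext1
    · simp [Prod.fst_sum]
    · simp [Prod.snd_sum]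
  have hd1 : d + 1 ≤ n := by omega
  obtain ⟨h', hh', hp⟩ := escape_pair H hH (fun a => (s a).1) (fun a => (s a).2) hd1 (by
    intro c t h1 h2
    have h3 : ∑ a, c a • s a = (t • (1 : Matrix (Fin n) (Fin n) K), -t • 1) := by
      rw [hsum, h1, h2]
    have ht : t = 0 := hV t (h3 ▸ V.sum_mem fun a _ => V.smul_mem _ (hSV (hsS a)))
    refine ⟨hsli c ?_, ht⟩
    rw [h3, ht]; simp)
  set m : Matrix (Fin n) (Fin n) K := (h' : Matrix (Fin n) (Fin n) K) with hm
  set mi : Matrix (Fin n) (Fin n) K :=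
    ((h'⁻¹ : Matrix.SpecialLinearGroup (Fin n) K) : Matrix (Fin n) (Fin n) K) with hmi
  have hmmi : m * mi = 1 := by
    rw [hm, hmi, ← Matrix.SpecialLinearGroup.coe_mul, mul_inv_cancel,
      Matrix.SpecialLinearGroup.coe_one]
  have hmim : mi * m = 1 := mul_eq_one_comm.mp hmmi
  have hsum2 : ∀ c : Fin d → K, ∑ a, c a • ((s a).1 + m * (s a).2 * mi) =
      (∑ a, c a • s a).1 + m * (∑ a, c a • s a).2 * mi := by
    intro c
    rw [hsum, Finset.mul_sum, Finset.sum_mul, ← Finset.sum_add_distrib]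
    refine Finset.sum_congr rfl fun a _ => ?_
    rw [smul_add, Matrix.mul_smul, Matrix.smul_mul]
  obtain ⟨h, hh, hg, ht⟩ := escape_trace H hH (m * (u : Matrix (Fin n) (Fin n) K))
    (y : Matrix (Fin n) (Fin n) K)
    (by rw [Matrix.det_mul, hm, h'.2, u.2, mul_one]; exact isUnit_one)
    (by rw [y.2]; exact isUnit_one) (fun a => (s a).1 + m * (s a).2 * mi) hd1 (by
      intro c hc
      refine hp c ?_
      rw [hsum2, hsum] at hc
      have := congrArg (fun Z => Z * m) hc
      simpa [add_mul, mul_assoc, hmim] using this)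
  have hw : ((h' * u * h * y : Matrix.SpecialLinearGroup (Fin n) K) : Matrix (Fin n) (Fin n) K) =
      m * (u : Matrix (Fin n) (Fin n) K) * (h : Matrix (Fin n) (Fin n) K) *
        (y : Matrix (Fin n) (Fin n) K) := by
    simp only [Matrix.SpecialLinearGroup.coe_mul, hm]
  refine ⟨h', hh', h, hh, hw ▸ hg, ?_⟩
  have hdis := finrank_add_le_of_disjoint S (V ⊓ wordKer ((h' * u * h * y :
    Matrix.SpecialLinearGroup (Fin n) K) : Matrix (Fin n) (Fin n) K) m mi) V hSV inf_le_left (by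
      intro z hz hzw
      obtain ⟨c, rfl⟩ := hsspan z hz
      have h1 := mem_wordKer.mp hzw.2
      rw [ht c]
      · simp
      · intro j
        rw [hsum2, ← hw]
        exact h1 j)
  rw [hSd] at hdis
  change Module.finrank K (V ⊓ wordKer _ m mi : Submodule K _) ≤ _
  omega

theorem pair_chain {n : ℕ} {K : Type} [Field K]
    (H : Finset (Matrix.SpecialLinearGroup (Fin n) K)) (hH : Escapes H (3 * n * n + n))
    (hn : 1 ≤ n) (u y : Matrix.SpecialLinearGroup (Fin n) K) (j : ℕ) :
    ∀ (V : Submodule K (Matrix (Fin n) (Fin n) K × Matrix (Fin n) (Fin n) K)),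
    (∀ t : K, (t • (1 : Matrix (Fin n) (Fin n) K), -t • (1 : Matrix (Fin n) (Fin n) K)) ∈ V →
      t = 0) → Module.finrank K V ≤ j * (n - 1) →
    ∃ h' h : Fin j → Matrix.SpecialLinearGroup (Fin n) K, (∀ i, h' i ∈ H) ∧ (∀ i, h i ∈ H) ∧
      (∀ i, gramDet ((h' i * u * h i * y : Matrix.SpecialLinearGroup (Fin n) K) :
        Matrix (Fin n) (Fin n) K) ≠ 0) ∧
      ∀ z ∈ V, (∀ i, z ∈ wordKer ((h' i * u * h i * y : Matrix.SpecialLinearGroup (Fin n) K) :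
        Matrix (Fin n) (Fin n) K) (h' i) ((h' i)⁻¹ : Matrix.SpecialLinearGroup (Fin n) K)) →
        z = 0 := by
  induction j with
  | zero =>
    intro V _ hV
    refine ⟨Fin.elim0, Fin.elim0, fun i => i.elim0, fun i => i.elim0, fun i => i.elim0,
      fun z hz _ => ?_⟩
    have : V = ⊥ := Submodule.finrank_eq_zero.mp (by omega)
    rwa [this, Submodule.mem_bot] at hz
  | succ j ih =>
    intro V hV hdim
    obtain ⟨h', hh', h, hh, hg, hk⟩ := pair_step H hH hn u y V hV
    obtain ⟨g', g, hg'H, hgH, hgg, hgk⟩ := ih (V ⊓ wordKer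
      ((h' * u * h * y : Matrix.SpecialLinearGroup (Fin n) K) : Matrix (Fin n) (Fin n) K) h'
      (h'⁻¹ : Matrix.SpecialLinearGroup (Fin n) K)) (fun t ht => hV t (Submodule.mem_inf.mp ht).1) (hk.trans (by
      rw [Nat.succ_mul] at hdim
      omega))
    refine ⟨Fin.cons h' g', Fin.cons h g, ?_, ?_, ?_, fun z hz hzw => ?_⟩
    · exact fun i => Fin.cases hh' hg'H i
    · exact fun i => Fin.cases hh hgH i
    · exact fun i => Fin.cases hg hgg i
    · exact hgk z ⟨hz, hzw 0⟩ fun i => hzw i.succ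

theorem first_step {n : ℕ} {K : Type} [Field K]
    (H : Finset (Matrix.SpecialLinearGroup (Fin n) K)) (hH : Escapes H (3 * n * n + n))
    (hn : 2 ≤ n) (u : Matrix.SpecialLinearGroup (Fin n) K)
    (C : Submodule K (Matrix (Fin n) (Fin n) K)) (hC : n - 1 ≤ Module.finrank K C) :
    ∃ h ∈ H, gramDet ((u * h : Matrix.SpecialLinearGroup (Fin n) K) :
        Matrix (Fin n) (Fin n) K) ≠ 0 ∧
      ∃ R ≤ C, (∀ μ ∈ C, (∀ j : Fin n, (((u * h : Matrix.SpecialLinearGroup (Fin n) K) :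
        Matrix (Fin n) (Fin n) K) ^ (j : ℕ) * μ).trace = 0) → μ ∈ R) ∧
        Module.finrank K R + (n - 1) ≤ Module.finrank K C ∧
        ∀ t : K, t • (1 : Matrix (Fin n) (Fin n) K) ∈ R → t = 0 := by
  obtain ⟨S, hS1, hSC, hSd⟩ := exists_submodule_between (C ⊓ Submodule.span K {1}) C inf_le_left
    (n - 1) (by
      have h5 : Module.finrank K (Submodule.span K {(1 : Matrix (Fin n) (Fin n) K)}) ≤ 1 := by
        simpa using finrank_span_le_card (R := K) ({1} : Set (Matrix (Fin n) (Fin n) K))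
      have := Submodule.finrank_mono
        (inf_le_right : C ⊓ Submodule.span K {(1 : Matrix (Fin n) (Fin n) K)} ≤ _)
      omega) hC
  obtain ⟨s, hsS, hsli, hsspan⟩ := exists_family S (n - 1) hSd
  obtain ⟨h, hh, hg, ht⟩ := escape_trace H hH (u : Matrix (Fin n) (Fin n) K) 1
    (by rw [u.2]; exact isUnit_one) (by simp) s (by omega) hsli
  rw [mul_one, ← Matrix.SpecialLinearGroup.coe_mul] at hg ht
  set w := ((u * h : Matrix.SpecialLinearGroup (Fin n) K) : Matrix (Fin n) (Fin n) K)
  have hS0 : ∀ μ ∈ S, (∀ j : Fin n, (w ^ (j : ℕ) * μ).trace = 0) → μ = 0 := by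
    intro μ hμ hj
    obtain ⟨c, rfl⟩ := hsspan μ hμ
    rw [ht c hj]; simp
  let R' : Submodule K (Matrix (Fin n) (Fin n) K) := (wordKer w 0 0).comap (LinearMap.inl K _ _)
  have hR' : ∀ μ, μ ∈ R' ↔ ∀ j : Fin n, (w ^ (j : ℕ) * μ).trace = 0 := by
    intro μ
    simp only [R', Submodule.mem_comap, mem_wordKer, LinearMap.inl_apply, mul_zero, add_zero]
  refine ⟨h, hh, hg, C ⊓ R', inf_le_left, fun μ hμ hj => ⟨hμ, (hR' μ).mpr hj⟩, ?_, fun t ht => ?_⟩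
  · rw [← hSd]
    exact finrank_add_le_of_disjoint S (C ⊓ R') C hSC inf_le_left
      fun x hx hxR => hS0 x hx ((hR' x).mp hxR.2)
  · have h1 : t • (1 : Matrix (Fin n) (Fin n) K) = 0 :=
      hS0 _ (hS1 ⟨ht.1, Submodule.smul_mem _ _ (Submodule.mem_span_singleton_self 1)⟩)
        ((hR' _).mp ht.2)
    have := congrFun (congrFun h1 ⟨0, by omega⟩) ⟨0, by omega⟩
    simpa using this

end pairchain

section pairfibre
open Polynomial

/-- The equations satisfied by a pair `(x 0, x 2)` with auxiliary diagonal coefficients `x 1`. -/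
noncomputable def pairEq {n : ℕ} {K : Type} [Field K] (b h0 : Matrix (Fin n) (Fin n) K)
    (h' h : Fin (n + 1) → Matrix (Fin n) (Fin n) K) (f0 : K[X]) (f : Fin (n + 1) → K[X]) (k : ℕ)
    (R : Type) [CommRing R] [Algebra K R] (x : Fin 3 → Matrix (Fin n) (Fin n) R) :
    Fin 5 ⊕ Fin (n + 1) → Matrix (Fin n) (Fin n) R :=
  Sum.elim
    ![x 0 ^ k + ∑ i : Fin n, x 1 i i • x 0 ^ (i : ℕ),
      Matrix.of fun p q => if p = q ∧ (p : ℕ) < k then 0 else x 1 p q,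
      x 2 * b.map (algebraMap K R) - b.map (algebraMap K R) * x 2,
      (x 2).det • 1 - 1,
      aeval (x 2 * h0.map (algebraMap K R)) f0]
    fun j => aeval (x 0 * (h' j).map (algebraMap K R) * x 2 * (h j).map (algebraMap K R)) (f j)

theorem mapMatrix_map_algebraMap {n : ℕ} {K R S : Type} [Field K] [CommRing R] [CommRing S]
    [Algebra K R] [Algebra K S] (f : R →ₐ[K] S) (g : Matrix (Fin n) (Fin n) K) :
    f.mapMatrix (g.map (algebraMap K R)) = g.map (algebraMap K S) := by
  ext i j; simp

theorem mapMatrix_pairEq {n : ℕ} {K : Type} [Field K] (b h0 : Matrix (Fin n) (Fin n) K)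
    (h' h : Fin (n + 1) → Matrix (Fin n) (Fin n) K) (f0 : K[X]) (f : Fin (n + 1) → K[X]) (k : ℕ)
    {R S : Type} [CommRing R] [Algebra K R] [CommRing S] [Algebra K S] (φ : R →ₐ[K] S)
    (x : Fin 3 → Matrix (Fin n) (Fin n) R) (e) :
    φ.mapMatrix (pairEq b h0 h' h f0 f k R x e) =
      pairEq b h0 h' h f0 f k S (fun i => φ.mapMatrix (x i)) e := by
  rcases e with e | e
  · fin_cases e
    · change φ.mapMatrix (x 0 ^ k + ∑ i : Fin n, x 1 i i • x 0 ^ (i : ℕ)) = _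
      rw [map_add, map_pow, map_sum]
      simp_rw [algHom_mapMatrix_smul, map_pow]
      rfl
    · refine Matrix.ext fun p q => ?_
      change φ (if _ then _ else _) = if _ then _ else _
      split_ifs
      · exact map_zero φ
      · rfl
    · change φ.mapMatrix (x 2 * b.map (algebraMap K R) - b.map (algebraMap K R) * x 2) = _
      rw [map_sub, map_mul, map_mul, mapMatrix_map_algebraMap]
      rfl
    · change φ.mapMatrix ((x 2).det • 1 - 1) = _
      rw [map_sub, algHom_mapMatrix_smul, map_one, AlgHom.map_det]
      rfl
    · change φ.mapMatrix (aeval (x 2 * h0.map (algebraMap K R)) f0) = _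
      rw [← Polynomial.aeval_algHom_apply, map_mul, mapMatrix_map_algebraMap]
      rfl
  · change φ.mapMatrix (aeval (x 0 * (h' e).map (algebraMap K R) * x 2 *
      (h e).map (algebraMap K R)) (f e)) = _
    rw [← Polynomial.aeval_algHom_apply, map_mul, map_mul, map_mul, mapMatrix_map_algebraMap,
      mapMatrix_map_algebraMap]
    rfl

theorem EntryDeg.aeval {n : ℕ} {K σ : Type} [Field K]
    {W : Matrix (Fin n) (Fin n) (MvPolynomial σ K)} {d m : ℕ} (hW : EntryDeg W d) {f : K[X]}
    (hf : f.natDegree ≤ m) : EntryDeg (Polynomial.aeval W f) (m * d) := by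
  rw [Polynomial.aeval_eq_sum_range]
  refine EntryDeg.sum _ _ fun i hi => ?_
  have hi' : i ≤ m := (Nat.lt_succ_iff.mp (Finset.mem_range.mp hi)).trans hf
  have : f.coeff i • W ^ i = (MvPolynomial.C (f.coeff i) : MvPolynomial σ K) • W ^ i := by
    refine Matrix.ext fun p q => ?_
    rw [Matrix.smul_apply, Matrix.smul_apply, MvPolynomial.smul_eq_C_mul, smul_eq_mul]
  rw [this]
  exact ((hW.pow i).smul (e := 0) (by simp)).mono (by nlinarith)

theorem pairEq_entryDeg {n : ℕ} {K : Type} [Field K] (b h0 : Matrix (Fin n) (Fin n) K)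
    (h' h : Fin (n + 1) → Matrix (Fin n) (Fin n) K) (f0 : K[X]) (f : Fin (n + 1) → K[X]) (k : ℕ)
    (hk : k ≤ n) (hf0 : f0.natDegree ≤ n) (hf : ∀ j, (f j).natDegree ≤ n) (e) :
    EntryDeg (pairEq b h0 h' h f0 f k (MvPolynomial (Fin 3 × Fin n × Fin n) K)
      (fun i => famMat i) e) (2 * n + 2) := by
  have hX : ∀ i : Fin 3, EntryDeg (famMat (K := K) (n := n) i) 1 := fun i => famMat_entryDeg i
  have hC : ∀ g : Matrix (Fin n) (Fin n) K, EntryDeg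
      (g.map (algebraMap K (MvPolynomial (Fin 3 × Fin n × Fin n) K))) 0 := fun g =>
    EntryDeg.map_C g
  have hsum : EntryDeg (∑ i : Fin n, famMat (K := K) (n := n) (1 : Fin 3) i i •
      famMat (K := K) (n := n) (0 : Fin 3) ^ (i : ℕ)) (1 + n * 1) :=
    EntryDeg.sum _ _ fun i _ => (((hX 0).pow (i : ℕ)).smul (hX 1 i i)).mono (by
      have := i.2
      omega)
  have hdet := (hX 2).det
  rw [Fintype.card_fin] at hdet
  have hD : ∀ {W : Matrix (Fin n) (Fin n) (MvPolynomial (Fin 3 × Fin n × Fin n) K)} {d : ℕ},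
      EntryDeg W d → d ≤ 2 * n + 2 → EntryDeg W (2 * n + 2) := fun h hd => h.mono hd
  rcases e with e | e
  · fin_cases e
    · exact hD (((hX 0).pow k).add hsum) (by apply max_le <;> omega)
    · intro p q
      change MvPolynomial.totalDegree (if _ then _ else _) ≤ _
      split_ifs
      · simp
      · exact (hX 1 p q).trans (by omega)
    · exact hD (((hX 2).mul (hC b)).sub ((hC b).mul (hX 2))) (by apply max_le <;> omega)
    · exact hD ((EntryDeg.one.smul hdet).sub EntryDeg.one) (by apply max_le <;> omega)
    · exact hD (((hX 2).mul (hC h0)).aeval hf0) (by omega)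
  · exact hD (((((hX 0).mul (hC (h' e))).mul (hX 2)).mul (hC (h e))).aeval (hf e)) (by omega)

theorem pair_fibre (n : ℕ) : ∃ C : ℕ, ∀ (K : Type) [Field K] (b h0 : Matrix (Fin n) (Fin n) K)
    (h' h : Fin (n + 1) → Matrix (Fin n) (Fin n) K) (f0 : K[X]) (f : Fin (n + 1) → K[X]) (k : ℕ),
    k ≤ n → f0.natDegree ≤ n → (∀ j, (f j).natDegree ≤ n) →
    ∀ Z : Finset (Matrix (Fin n) (Fin n) K × Matrix (Fin n) (Fin n) K),
    (∀ z ∈ Z, ∃ c, (∀ e, pairEq b h0 h' h f0 f k K ![z.1, c, z.2] e = 0) ∧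
      ∀ Y c' U, (∀ e, pairEq b h0 h' h f0 f k (DualNumber K)
        ![dualMat z.1 Y, dualMat c c', dualMat z.2 U] e = 0) → Y = 0 ∧ c' = 0 ∧ U = 0) →
    Z.card ≤ C := by
  classical
  obtain ⟨C, hC⟩ := bezout_matrix (Fin 3) (Fin 5 ⊕ Fin (n + 1)) n (2 * n + 2)
  refine ⟨C, fun K _ b h0 h' h f0 f k hk hf0 hf Z hZ => ?_⟩
  choose! c hc hrig using hZ
  let J : Matrix (Fin n) (Fin n) K × Matrix (Fin n) (Fin n) K → Fin 3 → Matrix (Fin n) (Fin n) K :=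
    fun z => ![z.1, c z, z.2]
  have hJ : Function.Injective J := fun z z' hzz =>
    Prod.ext (congrFun hzz 0) (congrFun hzz 2)
  rw [← Finset.card_image_of_injective Z hJ]
  refine hC K (fun e => pairEq b h0 h' h f0 f k _ (fun i => famMat i) e)
    (pairEq_entryDeg b h0 h' h f0 f k hk hf0 hf) _ fun x hx => ?_
  obtain ⟨z, hz, rfl⟩ := Finset.mem_image.mp hx
  refine ⟨fun e => ?_, fun v hv => ?_⟩
  · rw [mapMatrix_pairEq]
    simp_rw [evalFam_famMat]
    exact hc z hz e
  · obtain ⟨h1, h2, h3⟩ := hrig z hz (v 0) (v 1) (v 2) fun e => by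
      have := hv e
      rw [mapMatrix_pairEq] at this
      simp_rw [evalTangent_famMat] at this
      rw [← this]
      congr 1
      funext i
      fin_cases i <;> rfl
    funext i
    fin_cases i
    exacts [h1, h2, h3]

end pairfibre

section tangent
open Polynomial

theorem dualMat_eq_zero {n : ℕ} {K : Type} [Field K] {A A' : Matrix (Fin n) (Fin n) K} :
    dualMat A A' = 0 ↔ A = 0 ∧ A' = 0 := by
  have h0 : dualMat (0 : Matrix (Fin n) (Fin n) K) 0 = 0 := by
    rw [dualMat_zero_right]; exact Matrix.map_zero _ (map_zero _)
  rw [← h0, dualMat_inj]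

theorem trace_eq_zero_of_separable {n : ℕ} {K : Type} [Field K] {W W' : Matrix (Fin n) (Fin n) K}
    {p : K[X]} (hp : p.Separable) (hW : aeval W p = 0) (hWW : aeval (dualMat W W') p = 0) (q : K[X]) :
    (aeval W q * W').trace = 0 := by
  obtain ⟨L, h1, h2, -⟩ := exists_polyDeriv W p
  obtain ⟨a, c, hac⟩ := hp
  have hL : L W' = 0 := by
    rw [h1, dualMat_eq_zero] at hWW
    exact hWW.2
  have hc : aeval W (q * c) * W = W * aeval W (q * c) := by
    have := congrArg (aeval W) (mul_comm (q * c) X)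
    rwa [map_mul (aeval W) (q * c), map_mul (aeval W) X, aeval_X] at this
  have h3 := h2 (aeval W (q * c)) W' hc
  rw [hL, mul_zero, Matrix.trace_zero, ← map_mul] at h3
  have h4 : q * c * derivative p = q - q * a * p := by linear_combination q * hac
  rw [h4, map_sub, map_mul (aeval W) _ p, hW, mul_zero, sub_zero] at h3
  exact h3.symm

theorem trace_pow_mul_eq_zero {n : ℕ} {K : Type} [Field K]
    {w Z y yi : Matrix (Fin n) (Fin n) K} (hy : yi * y = 1) {N : ℕ} (hN : 1 ≤ N) (hw : w ^ N = 1)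
    (h : ∀ q : K[X], (aeval (y * w * yi) q * (y * Z * w * yi)).trace = 0) (j : ℕ) :
    (w ^ j * Z).trace = 0 := by
  have hpow : ∀ m : ℕ, (y * w * yi) ^ m * y = y * w ^ m := by
    intro m
    induction m with
    | zero => simp
    | succ m ih =>
      rw [pow_succ, mul_assoc, mul_assoc (y * w) yi y, hy, mul_one, ← mul_assoc, ih, pow_succ,
        mul_assoc]
  have h1 := h (X ^ (j + (N - 1)))
  rw [map_pow, aeval_X, mul_assoc y Z w, mul_assoc y (Z * w) yi, ← mul_assoc, hpow,
    mul_assoc, Matrix.trace_mul_comm, mul_assoc, mul_assoc, hy, mul_one, ← mul_assoc,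
    Matrix.trace_mul_comm, ← mul_assoc, ← pow_succ', add_assoc,
    Nat.sub_add_cancel hN, pow_add, hw, mul_one] at h1
  exact h1

theorem trace_eq_zero_of_det {n : ℕ} {K : Type} [Field K] {u ui U : Matrix (Fin n) (Fin n) K}
    (hu : ui * u = 1) (hdet : u.det = 1) (h : (dualMat u U).det = 1) : (U * ui).trace = 0 := by
  have h1 : dualMat u U = dualMat 1 (U * ui) * dualMat u 0 := by
    rw [dualMat_mul, one_mul, mul_zero, zero_add, mul_assoc, hu, mul_one]
  have h2 : dualMat 1 (U * ui) = 1 + (DualNumber.eps : DualNumber K) •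
      (U * ui).map (algebraMap K (DualNumber K)) := by
    refine Matrix.ext fun i j => ?_
    simp only [dualMat, Matrix.of_apply, Matrix.add_apply, Matrix.smul_apply, Matrix.map_apply,
      smul_eq_mul, Matrix.one_apply]
    split_ifs <;> simp [mul_comm]
  rw [h1, Matrix.det_mul, h2, Matrix.det_one_add_smul, dualMat_zero_right] at h
  have heps : (DualNumber.eps : DualNumber K) ^ 2 = 0 := by
    rw [sq]; exact DualNumber.eps_mul_eps
  have hd : (u.map (algebraMap K (DualNumber K))).det = 1 := by
    have := (RingHom.map_det (algebraMap K (DualNumber K)) u).symm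
    rw [hdet, map_one] at this
    exact this
  have ht : ((U * ui).map (algebraMap K (DualNumber K))).trace =
      algebraMap K (DualNumber K) (U * ui).trace := by
    rw [Matrix.trace, Matrix.trace, map_sum]
    rfl
  rw [heps, mul_zero, add_zero, hd, mul_one, ht] at h
  have h3 := congrArg TrivSqZeroExt.snd h
  simpa [TrivSqZeroExt.algebraMap_eq_inl] using h3

theorem dualMat_pow {n : ℕ} {K : Type} [Field K] (y Y : Matrix (Fin n) (Fin n) K) (i : ℕ) :
    ∃ D, dualMat y Y ^ i = dualMat (y ^ i) D := by
  induction i with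
  | zero => exact ⟨0, by rw [pow_zero, pow_zero, dualMat_one]⟩
  | succ i ih =>
    obtain ⟨D, hD⟩ := ih
    exact ⟨_, by rw [pow_succ, hD, dualMat_mul, pow_succ]⟩

theorem monic_tangent {n : ℕ} {K : Type} [Field K] (y Y c c' : Matrix (Fin n) (Fin n) K) (i : ℕ)
    (j : Fin n) : dualMat c c' j j • dualMat y Y ^ i =
      c j j • dualMat y Y ^ i + dualMat 0 (c' j j • y ^ i) := by
  obtain ⟨D, hD⟩ := dualMat_pow y Y i
  rw [hD, dualMat, Matrix.of_apply, dualMat_smul, smul_dualMat, dualMat_add, add_zero]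

theorem sum_dualMat_zero {n : ℕ} {K ι : Type} [Field K] (s : Finset ι)
    (M : ι → Matrix (Fin n) (Fin n) K) :
    ∑ i ∈ s, dualMat 0 (M i) = dualMat 0 (∑ i ∈ s, M i) := by
  classical
  induction s using Finset.induction_on with
  | empty => exact (dualMat_eq_zero.mpr ⟨rfl, rfl⟩).symm
  | insert a s ha ih => rw [Finset.sum_insert ha, Finset.sum_insert ha, ih, dualMat_add, add_zero]

theorem aeval_eq_pow_add_sum {n k : ℕ} {K A : Type} [Field K] [Ring A] [Algebra K A] (f : K[X])
    (hf : f.Monic) (hk : f.natDegree = k) (hkn : k ≤ n) (x : A) :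
    aeval x f = x ^ k + ∑ i : Fin n, (if (i : ℕ) < k then f.coeff i else 0) • x ^ (i : ℕ) := by
  rw [Fin.sum_univ_eq_sum_range (fun i => (if i < k then f.coeff i else 0) • x ^ i) n]
  conv_lhs => rw [hf.as_sum, hk]
  rw [map_add, map_pow, aeval_X, map_sum]
  congr 1
  refine Finset.sum_subset_zero_on_sdiff (by simpa using hkn) ?_ ?_
  · intro i hi
    rw [Finset.mem_sdiff, Finset.mem_range, Finset.mem_range] at hi
    rw [if_neg hi.2, zero_smul]
  · intro i hi
    rw [if_pos (Finset.mem_range.mp hi), map_mul, aeval_C, map_pow, aeval_X, Algebra.smul_def]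

end tangent

section pairrigid
open Polynomial

theorem finrank_centSub_inf_ker_trace {n : ℕ} {K : Type} [Field K] (hn : 1 ≤ n)
    (b : Matrix (Fin n) (Fin n) K) (hb : (minpoly K b).Separable) :
    Module.finrank K (centSub b ⊓ LinearMap.ker (Matrix.traceLinearMap (Fin n) K K) :
      Submodule K _) + 1 = Module.finrank K (centSub b) := by
  obtain ⟨X, hX, hX0⟩ := exists_trace_ne_zero hn b _ hb (minpoly.aeval K b)
  have h1 : Module.finrank K (centSub b ⊓ LinearMap.ker (Matrix.traceLinearMap (Fin n) K K) :
      Submodule K _) < Module.finrank K (centSub b) := by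
    refine Submodule.finrank_lt_finrank_of_lt (lt_of_le_of_ne inf_le_left fun h => hX0 ?_)
    rw [← h] at hX
    exact hX.2
  have h2 := Submodule.finrank_sup_add_finrank_inf_eq (centSub b)
    (LinearMap.ker (Matrix.traceLinearMap (Fin n) K K))
  have h3 := LinearMap.finrank_range_add_finrank_ker (Matrix.traceLinearMap (Fin n) K K)
  have h4 := Submodule.finrank_le (LinearMap.range (Matrix.traceLinearMap (Fin n) K K))
  have h5 := Submodule.finrank_le (centSub b ⊔
    LinearMap.ker (Matrix.traceLinearMap (Fin n) K K))
  rw [Module.finrank_self] at h4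
  omega

theorem finrank_submodule_prod_le {K V W : Type} [Field K] [AddCommGroup V] [Module K V]
    [AddCommGroup W] [Module K W] [FiniteDimensional K V] [FiniteDimensional K W]
    (S : Submodule K V) (T : Submodule K W) :
    Module.finrank K (S.prod T) ≤ Module.finrank K S + Module.finrank K T := by
  rw [← Module.finrank_prod]
  refine LinearMap.finrank_le_finrank_of_injective (f := LinearMap.prod
    (((LinearMap.fst K V W).comp (S.prod T).subtype).codRestrict S fun x => x.2.1)
    (((LinearMap.snd K V W).comp (S.prod T).subtype).codRestrict T fun x => x.2.2)) ?_
  intro x y hxy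
  exact Subtype.ext (Prod.ext (congrArg (fun z => (z.1 : V)) hxy)
    (congrArg (fun z => (z.2 : W)) hxy))

/-- Tangent directions along the variety of conjugates of `y`. -/
theorem exists_tangent_submodule {n : ℕ} {K : Type} [Field K] (y yi : Matrix (Fin n) (Fin n) K)
    (hyi : yi * y = 1) (hy : (minpoly K y).Separable)
    (L : Matrix (Fin n) (Fin n) K →ₗ[K] Matrix (Fin n) (Fin n) K)
    (hL1 : ∀ Y, aeval (dualMat y Y) (minpoly K y) = dualMat (aeval y (minpoly K y)) (L Y))
    (hL3 : ∀ Y, Y * y = y * Y → L Y = aeval y (derivative (minpoly K y)) * Y) :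
    ∃ V : Submodule K (Matrix (Fin n) (Fin n) K),
      Module.finrank K V + Module.finrank K (centSub y) ≤ n * n + (minpoly K y).natDegree ∧
      ∀ η, (∃ c : Fin n → K, (∀ i : Fin n, (minpoly K y).natDegree ≤ i → c i = 0) ∧
        L (y * η) + ∑ i : Fin n, c i • y ^ (i : ℕ) = 0) → η ∈ V := by
  have hr := range_polyDeriv y _ hy (minpoly.aeval K y) L hL1 hL3
  let S := Submodule.span K (Set.range fun i : Fin (minpoly K y).natDegree => y ^ (i : ℕ))
  have hS : Module.finrank K S ≤ (minpoly K y).natDegree := by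
    have := finrank_range_le_card (R := K) fun i : Fin (minpoly K y).natDegree => y ^ (i : ℕ)
    rwa [Fintype.card_fin] at this
  have h1 := LinearMap.finrank_range_add_finrank_ker L
  rw [hr, Module.finrank_matrix, Fintype.card_fin, Module.finrank_self, mul_one] at h1
  have h2 := finrank_comap_le (LinearMap.mulLeft K y) (LinearMap.ker L)
  have hker : LinearMap.ker (LinearMap.mulLeft K y) = ⊥ := by
    rw [LinearMap.ker_eq_bot']
    intro m hm
    have : yi * (y * m) = 0 := by
      rw [← LinearMap.mulLeft_apply (R := K) y m, hm, mul_zero]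
    rwa [← mul_assoc, hyi, one_mul] at this
  rw [hker, finrank_bot, zero_add] at h2
  have h3 := finrank_comap_le (L.comp (LinearMap.mulLeft K y)) S
  rw [LinearMap.ker_comp] at h3
  refine ⟨S.comap (L.comp (LinearMap.mulLeft K y)), by omega, fun η hη => ?_⟩
  obtain ⟨c, hc, hη⟩ := hη
  rw [Submodule.mem_comap, LinearMap.comp_apply, LinearMap.mulLeft_apply, eq_neg_of_add_eq_zero_left hη]
  refine Submodule.neg_mem _ (Submodule.sum_mem _ fun i _ => ?_)
  by_cases hi : (i : ℕ) < (minpoly K y).natDegree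
  · exact Submodule.smul_mem _ _ (Submodule.subset_span ⟨⟨i, hi⟩, rfl⟩)
  · rw [hc i (by omega), zero_smul]
    exact Submodule.zero_mem _

theorem eq_zero_of_sum_pow {n : ℕ} {K : Type} [Field K] (y : Matrix (Fin n) (Fin n) K)
    (hk : (minpoly K y).natDegree ≤ n) (c : Fin n → K)
    (hc : ∀ i : Fin n, (minpoly K y).natDegree ≤ i → c i = 0)
    (h : ∑ i : Fin n, c i • y ^ (i : ℕ) = 0) : c = 0 := by
  have hli := linearIndependent_pow (K := K) y
  rw [Fintype.linearIndependent_iff] at hli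
  have h1 : ∑ i : Fin (minpoly K y).natDegree, c (Fin.castLE hk i) • y ^ (i : ℕ) = 0 := by
    rw [← h]
    refine (Finset.sum_map Finset.univ (Fin.castLEEmb hk)
      (fun i : Fin n => c i • y ^ (i : ℕ))).symm.trans ?_
    refine Finset.sum_subset (Finset.subset_univ _) fun i _ hi => ?_
    rw [hc i, zero_smul]
    by_contra! hlt
    exact hi (Finset.mem_map.mpr ⟨⟨i, hlt⟩, Finset.mem_univ _, rfl⟩)
  funext i
  by_cases hi : (i : ℕ) < (minpoly K y).natDegree
  · exact hli _ h1 ⟨i, hi⟩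
  · exact hc i (by omega)

theorem word_deriv {R : Type} [Ring R] {y yi Y h' hi u U μ η h : R} (hy : y * yi = 1)
    (hh : hi * h' = 1) (hY : Y = y * η) (hU : U = μ * u) :
    y * (η + h' * μ * hi) * (h' * u * h * y) * yi = (Y * h' * u + y * h' * U) * h := by
  subst hY hU
  calc _ = y * η * h' * u * h * (y * yi) + y * h' * μ * (hi * h') * u * h * (y * yi) := by
        noncomm_ring
    _ = _ := by rw [hy, hh]; noncomm_ring

theorem pair_rigid {n : ℕ} {K : Type} [Field K] [Fintype K]
    (H : Finset (Matrix.SpecialLinearGroup (Fin n) K)) (hH : Escapes H (3 * n * n + n))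
    (hn : 2 ≤ n) (u y : Matrix.SpecialLinearGroup (Fin n) K) (b : Matrix (Fin n) (Fin n) K)
    (k : ℕ) (hyk : (minpoly K (y : Matrix (Fin n) (Fin n) K)).natDegree = k) (hkn : k + 1 ≤ n)
    (hy : (minpoly K (y : Matrix (Fin n) (Fin n) K)).Separable) (hb : (minpoly K b).Separable)
    (hl : Module.finrank K (centSub (y : Matrix (Fin n) (Fin n) K)) =
      Module.finrank K (centSub b)) (hnl : n ≤ Module.finrank K (centSub b))
    (hub : (u : Matrix (Fin n) (Fin n) K) * b = b * u) :
    ∃ (h0 : Matrix.SpecialLinearGroup (Fin n) K)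
      (h' h : Fin (n + 1) → Matrix.SpecialLinearGroup (Fin n) K),
      h0 ∈ H ∧ (∀ i, h' i ∈ H) ∧ (∀ i, h i ∈ H) ∧
      (u * h0 : Matrix (Fin n) (Fin n) K).charpoly.Separable ∧
      (∀ i, (y * h' i * u * h i : Matrix (Fin n) (Fin n) K).charpoly.Separable) ∧
      ∃ c, (∀ e, pairEq b h0 (fun i => h' i) (fun i => h i)
          (u * h0 : Matrix (Fin n) (Fin n) K).charpoly
          (fun i => (y * h' i * u * h i : Matrix (Fin n) (Fin n) K).charpoly) k K ![↑y, c, ↑u] e =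
            0) ∧
        ∀ Y c' U, (∀ e, pairEq b h0 (fun i => h' i) (fun i => h i)
          (u * h0 : Matrix (Fin n) (Fin n) K).charpoly
          (fun i => (y * h' i * u * h i : Matrix (Fin n) (Fin n) K).charpoly) k (DualNumber K)
          ![dualMat ↑y Y, dualMat c c', dualMat ↑u U] e = 0) → Y = 0 ∧ c' = 0 ∧ U = 0 := by
  have hyi : ((y⁻¹ : Matrix.SpecialLinearGroup (Fin n) K) : Matrix (Fin n) (Fin n) K) * y = 1 := by
    rw [← Matrix.SpecialLinearGroup.coe_mul, inv_mul_cancel, Matrix.SpecialLinearGroup.coe_one]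
  have hiy : (y : Matrix (Fin n) (Fin n) K) * (y⁻¹ : Matrix.SpecialLinearGroup (Fin n) K) = 1 := by
    rw [← Matrix.SpecialLinearGroup.coe_mul, mul_inv_cancel, Matrix.SpecialLinearGroup.coe_one]
  have hui : ((u⁻¹ : Matrix.SpecialLinearGroup (Fin n) K) : Matrix (Fin n) (Fin n) K) * u = 1 := by
    rw [← Matrix.SpecialLinearGroup.coe_mul, inv_mul_cancel, Matrix.SpecialLinearGroup.coe_one]
  have hiu : (u : Matrix (Fin n) (Fin n) K) * (u⁻¹ : Matrix.SpecialLinearGroup (Fin n) K) = 1 := by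
    rw [← Matrix.SpecialLinearGroup.coe_mul, mul_inv_cancel, Matrix.SpecialLinearGroup.coe_one]
  obtain ⟨L, hL1, -, hL3⟩ := exists_polyDeriv (y : Matrix (Fin n) (Fin n) K)
    (minpoly K (y : Matrix (Fin n) (Fin n) K))
  obtain ⟨V, hV, hVmem⟩ := exists_tangent_submodule _ _ hyi hy L hL1 hL3
  have hC := finrank_centSub_inf_ker_trace (by omega) b hb
  obtain ⟨h0, hh0, hg0, R, hRC, hRmem, hRdim, hRone⟩ := first_step H hH hn u
    (centSub b ⊓ LinearMap.ker (Matrix.traceLinearMap (Fin n) K K)) (by omega)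
  obtain ⟨h', h, hh', hh, hg, hzero⟩ := pair_chain H hH (by omega) u y (n + 1) (V.prod R)
    (fun t ht => by
      have := hRone _ ht.2
      exact neg_eq_zero.mp this)
    (by
      have h1 := finrank_submodule_prod_le V R
      obtain ⟨m, rfl⟩ := Nat.exists_eq_add_of_le' (show 1 ≤ n by omega)
      rw [Nat.add_sub_cancel]
      rw [Nat.add_sub_cancel] at hRdim
      nlinarith)
  have hsep0 : (u * h0 : Matrix (Fin n) (Fin n) K).charpoly.Separable :=
    separable_of_gramDet _ hg0
  have hsep : ∀ i, (y * h' i * u * h i : Matrix (Fin n) (Fin n) K).charpoly.Separable := by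
    intro i
    have := separable_of_gramDet _ (hg i)
    rw [Matrix.SpecialLinearGroup.coe_mul, Matrix.charpoly_mul_comm] at this
    simpa only [Matrix.SpecialLinearGroup.coe_mul, mul_assoc] using this
  have hmonic := minpoly.monic (Algebra.IsIntegral.isIntegral (R := K)
    (y : Matrix (Fin n) (Fin n) K))
  refine ⟨h0, h', h, hh0, hh', hh, hsep0, hsep, Matrix.diagonal fun i : Fin n =>
    if (i : ℕ) < k then (minpoly K (y : Matrix (Fin n) (Fin n) K)).coeff i else 0, ?_, ?_⟩
  · rintro (e | e)
    · fin_cases e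
      · have := aeval_eq_pow_add_sum (n := n) _ hmonic hyk (by omega) (y : Matrix (Fin n) (Fin n) K)
        rw [minpoly.aeval] at this
        refine Eq.trans ?_ this.symm
        simp [pairEq]
      · refine Matrix.ext fun p q => ?_
        change (if _ then _ else _) = _
        split_ifs with hpq
        · rfl
        · change Matrix.diagonal _ p q = _
          rw [Matrix.diagonal_apply]
          split_ifs with h1 h2
          · exact absurd ⟨h1, h2⟩ hpq
          · rfl
          · rfl
      · change (u : Matrix (Fin n) (Fin n) K) * b.map (algebraMap K K) -
          b.map (algebraMap K K) * u = 0
        rw [show b.map (algebraMap K K) = b from by ext; simp, hub, sub_self]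
      · change (u : Matrix (Fin n) (Fin n) K).det • (1 : Matrix (Fin n) (Fin n) K) - 1 = 0
        rw [u.2, one_smul, sub_self]
      · change aeval ((u : Matrix (Fin n) (Fin n) K) *
          (h0 : Matrix (Fin n) (Fin n) K).map (algebraMap K K)) _ = 0
        rw [show (h0 : Matrix (Fin n) (Fin n) K).map (algebraMap K K) = h0 from by ext; simp]
        exact Matrix.aeval_self_charpoly _
    · change aeval ((y : Matrix (Fin n) (Fin n) K) *
          (h' e : Matrix (Fin n) (Fin n) K).map (algebraMap K K) * u *
          (h e : Matrix (Fin n) (Fin n) K).map (algebraMap K K)) _ = 0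
      rw [show (h' e : Matrix (Fin n) (Fin n) K).map (algebraMap K K) = h' e from by ext; simp,
        show (h e : Matrix (Fin n) (Fin n) K).map (algebraMap K K) = h e from by ext; simp]
      exact Matrix.aeval_self_charpoly _
  intro Y c' U hE
  set f := minpoly K (y : Matrix (Fin n) (Fin n) K) with hf
  set c : Matrix (Fin n) (Fin n) K :=
    Matrix.diagonal fun i : Fin n => if (i : ℕ) < k then f.coeff i else 0 with hc
  have hoff : ∀ p q : Fin n, ¬ (p = q ∧ (p : ℕ) < k) → c' p q = 0 := by
    intro p q hpq
    have := congrFun (congrFun (hE (Sum.inl 1)) p) q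
    change (if _ then _ else dualMat c c' p q) = (0 : DualNumber K) at this
    rw [if_neg hpq, dualMat, Matrix.of_apply] at this
    simpa [TrivSqZeroExt.algebraMap_eq_inl] using congrArg TrivSqZeroExt.snd this
  have hLY : L Y + ∑ i : Fin n, c' i i • (y : Matrix (Fin n) (Fin n) K) ^ (i : ℕ) = 0 := by
    have h1 : dualMat (y : Matrix (Fin n) (Fin n) K) Y ^ k +
      ∑ i : Fin n, dualMat c c' i i • dualMat (y : Matrix (Fin n) (Fin n) K) Y ^ (i : ℕ) = 0 :=
      hE (Sum.inl 0)
    have h2 := aeval_eq_pow_add_sum (n := n) _ hmonic hyk (by omega)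
      (dualMat (y : Matrix (Fin n) (Fin n) K) Y)
    simp_rw [monic_tangent] at h1
    rw [Finset.sum_add_distrib, ← add_assoc, sum_dualMat_zero] at h1
    have h3 : ∀ i : Fin n, c i i = if (i : ℕ) < k then f.coeff i else 0 := fun i =>
      Matrix.diagonal_apply_eq _ i
    simp_rw [h3] at h1
    rw [← h2, hL1, dualMat_add, dualMat_eq_zero] at h1
    exact h1.2
  have hUb : U * b = b * U := by
    have : dualMat (u : Matrix (Fin n) (Fin n) K) U * b.map (algebraMap K (DualNumber K)) -
      b.map (algebraMap K (DualNumber K)) * dualMat (u : Matrix (Fin n) (Fin n) K) U = 0 :=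
      hE (Sum.inl 2)
    rw [← dualMat_zero_right, dualMat_mul, dualMat_mul, sub_eq_zero, dualMat_inj] at this
    simpa using this.2
  have hdet : (dualMat (u : Matrix (Fin n) (Fin n) K) U).det = 1 := by
    have : (dualMat (u : Matrix (Fin n) (Fin n) K) U).det •
      (1 : Matrix (Fin n) (Fin n) (DualNumber K)) - 1 = 0 := hE (Sum.inl 3)
    have h2 := congrFun (congrFun this ⟨0, by omega⟩) ⟨0, by omega⟩
    simpa [sub_eq_zero] using h2
  have hW0 : aeval (dualMat (u * h0 : Matrix (Fin n) (Fin n) K) (U * h0))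
      (u * h0 : Matrix (Fin n) (Fin n) K).charpoly = 0 := by
    have : aeval (dualMat (u : Matrix (Fin n) (Fin n) K) U *
      (h0 : Matrix (Fin n) (Fin n) K).map (algebraMap K (DualNumber K)))
      (u * h0 : Matrix (Fin n) (Fin n) K).charpoly = 0 := hE (Sum.inl 4)
    rwa [← dualMat_zero_right, dualMat_mul, mul_zero, zero_add] at this
  have hW : ∀ i, aeval (dualMat (y * h' i * u * h i : Matrix (Fin n) (Fin n) K)
      ((Y * h' i * u + y * h' i * U) * h i))
      (y * h' i * u * h i : Matrix (Fin n) (Fin n) K).charpoly = 0 := by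
    intro i
    have : aeval (dualMat (y : Matrix (Fin n) (Fin n) K) Y *
      (h' i : Matrix (Fin n) (Fin n) K).map (algebraMap K (DualNumber K)) *
      dualMat (u : Matrix (Fin n) (Fin n) K) U *
      (h i : Matrix (Fin n) (Fin n) K).map (algebraMap K (DualNumber K)))
      (y * h' i * u * h i : Matrix (Fin n) (Fin n) K).charpoly = 0 := hE (Sum.inr i)
    rw [← dualMat_zero_right, ← dualMat_zero_right, dualMat_mul, dualMat_mul, dualMat_mul, mul_zero,
      mul_zero, zero_add, zero_add] at this
    rwa [add_comm (Y * _ * _)]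
  have hfin : Finite (Matrix.SpecialLinearGroup (Fin n) K) := Subtype.finite
  have hord : ∀ g : Matrix.SpecialLinearGroup (Fin n) K,
      (g : Matrix (Fin n) (Fin n) K) ^ orderOf g = 1 := fun g => by
    rw [← Matrix.SpecialLinearGroup.coe_pow, pow_orderOf_eq_one, Matrix.SpecialLinearGroup.coe_one]
  set μ := U * ((u⁻¹ : Matrix.SpecialLinearGroup (Fin n) K) : Matrix (Fin n) (Fin n) K) with hμ
  set η := ((y⁻¹ : Matrix.SpecialLinearGroup (Fin n) K) : Matrix (Fin n) (Fin n) K) * Y with hη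
  have hUμ : U = μ * u := by rw [hμ, mul_assoc, hui, mul_one]
  have hYη : Y = y * η := by rw [hη, ← mul_assoc, hiy, one_mul]
  have hμC : μ ∈ centSub b ⊓ LinearMap.ker (Matrix.traceLinearMap (Fin n) K K) := by
    refine ⟨mem_centSub.mpr ?_, trace_eq_zero_of_det hui u.2 hdet⟩
    have h1 : ((u⁻¹ : Matrix.SpecialLinearGroup (Fin n) K) : Matrix (Fin n) (Fin n) K) * b =
        b * (u⁻¹ : Matrix.SpecialLinearGroup (Fin n) K) := by
      calc _ = ((u⁻¹ : Matrix.SpecialLinearGroup (Fin n) K) : Matrix (Fin n) (Fin n) K) *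
            (b * u) * (u⁻¹ : Matrix.SpecialLinearGroup (Fin n) K) := by
            rw [mul_assoc, mul_assoc, hiu, mul_one]
        _ = _ := by rw [← hub, ← mul_assoc, hui, one_mul]
    rw [hμ, mul_assoc, h1, ← mul_assoc, hUb, mul_assoc]
  have hμR : μ ∈ R := by
    refine hRmem μ hμC fun j => ?_
    refine trace_pow_mul_eq_zero (y := 1) (yi := 1) (mul_one 1) (orderOf_pos (u * h0))
      (hord (u * h0)) (fun q => ?_) j
    have e : μ * (u * h0 : Matrix.SpecialLinearGroup (Fin n) K) = U * h0 := by
      rw [Matrix.SpecialLinearGroup.coe_mul, ← mul_assoc, ← hUμ]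
    rw [one_mul, mul_one, one_mul, mul_one, e, Matrix.SpecialLinearGroup.coe_mul]
    exact trace_eq_zero_of_separable hsep0 (Matrix.aeval_self_charpoly _) hW0 q
  have hz : (η, μ) = 0 := by
    refine hzero (η, μ) ⟨hVmem η ⟨fun i => c' i i, fun i hi => hoff i i fun hh => ?_, ?_⟩, hμR⟩
      fun i => mem_wordKer.mpr fun j => ?_
    · omega
    · rwa [← hYη]
    · refine trace_pow_mul_eq_zero (y := y)
        (yi := (y⁻¹ : Matrix.SpecialLinearGroup (Fin n) K)) hyi
        (orderOf_pos (h' i * u * h i * y)) (hord _) (fun q => ?_) j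
      have hii : ((h' i)⁻¹ : Matrix.SpecialLinearGroup (Fin n) K) *
          (h' i : Matrix (Fin n) (Fin n) K) = 1 := by
        rw [← Matrix.SpecialLinearGroup.coe_mul, inv_mul_cancel, Matrix.SpecialLinearGroup.coe_one]
      have e1 : (y : Matrix (Fin n) (Fin n) K) *
          (h' i * u * h i * y : Matrix.SpecialLinearGroup (Fin n) K) *
          (y⁻¹ : Matrix.SpecialLinearGroup (Fin n) K) = y * h' i * u * h i := by
        simp only [Matrix.SpecialLinearGroup.coe_mul, mul_assoc, hiy, mul_one]
      have e2 : (y : Matrix (Fin n) (Fin n) K) * (η + h' i * μ *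
          ((h' i)⁻¹ : Matrix.SpecialLinearGroup (Fin n) K)) *
          (h' i * u * h i * y : Matrix.SpecialLinearGroup (Fin n) K) *
          (y⁻¹ : Matrix.SpecialLinearGroup (Fin n) K) =
          (Y * h' i * u + y * h' i * U) * h i := by
        rw [Matrix.SpecialLinearGroup.coe_mul, Matrix.SpecialLinearGroup.coe_mul,
          Matrix.SpecialLinearGroup.coe_mul]
        exact word_deriv hiy hii hYη hUμ
      rw [e1, e2]
      exact trace_eq_zero_of_separable (hsep i) (Matrix.aeval_self_charpoly _) (hW i) q
  have hη0 : η = 0 := congrArg Prod.fst hz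
  have hμ0 : μ = 0 := congrArg Prod.snd hz
  have hY0 : Y = 0 := by rw [hYη, hη0, mul_zero]
  refine ⟨hY0, ?_, by rw [hUμ, hμ0, zero_mul]⟩
  rw [hY0, map_zero, zero_add] at hLY
  have hd := eq_zero_of_sum_pow (y : Matrix (Fin n) (Fin n) K) (by rw [← hf]; omega) (fun i => c' i i)
    (fun i hi => hoff i i fun hh => by rw [← hf] at hi; omega) hLY
  refine Matrix.ext fun p q => ?_
  by_cases hpq : p = q
  · subst hpq
    exact congrFun hd p
  · exact hoff p q fun hh => hpq hh.1

end pairrigid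

section pairbound
open Polynomial

theorem pair_bound (n : ℕ) (hn : 2 ≤ n) (c₀ : ℕ) : ∃ C : ℕ, ∀ (K : Type) [Field K] [Fintype K]
    (H : Finset (Matrix.SpecialLinearGroup (Fin n) K)), Escapes H (3 * n * n + n) → H.card ≤ c₀ →
    ∀ (A : Set (Matrix.SpecialLinearGroup (Fin n) K)) (k₀ : ℕ), (∀ h ∈ H, h ∈ prodSet A k₀) →
    ∀ (b : Matrix (Fin n) (Fin n) K) (k : ℕ), k + 1 ≤ n → (minpoly K b).Separable →
    n ≤ Module.finrank K (centSub b) → ∀ P : Finset K[X],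
    (∀ w ∈ prodSet A (2 * k₀ + 5), (w : Matrix (Fin n) (Fin n) K).charpoly.Separable →
      (w : Matrix (Fin n) (Fin n) K).charpoly ∈ P) →
    ∀ Z : Finset (Matrix.SpecialLinearGroup (Fin n) K × Matrix.SpecialLinearGroup (Fin n) K),
    (∀ z ∈ Z, (z.1 ∈ prodSet A 3 ∧ (minpoly K (z.1 : Matrix (Fin n) (Fin n) K)).Separable ∧
      (minpoly K (z.1 : Matrix (Fin n) (Fin n) K)).natDegree = k ∧
      Module.finrank K (centSub (z.1 : Matrix (Fin n) (Fin n) K)) =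
        Module.finrank K (centSub b)) ∧ z.2 ∈ prodSet A 2 ∧
      (z.2 : Matrix (Fin n) (Fin n) K) * b = b * z.2) →
    Z.card ≤ C * P.card ^ (n + 2) := by
  classical
  obtain ⟨C, hC⟩ := pair_fibre n
  refine ⟨C * c₀ ^ (2 * n + 3), fun K _ _ H hH hHc A k₀ hHA b k hkn hb hnl P hP Z hZ => ?_⟩
  have hrig := fun z (hz : z ∈ Z) => pair_rigid H hH hn z.2 z.1 b k (hZ z hz).1.2.2.1 hkn
    (hZ z hz).1.2.1 hb (hZ z hz).1.2.2.2 hnl (hZ z hz).2.2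
  have : Nonempty (Fin n) := ⟨⟨0, by omega⟩⟩
  choose! h0 h' h hh0 hh' hh hs0 hs hc using hrig
  let F : Matrix.SpecialLinearGroup (Fin n) K × Matrix.SpecialLinearGroup (Fin n) K →
      (Matrix.SpecialLinearGroup (Fin n) K × (Fin (n + 1) → Matrix.SpecialLinearGroup (Fin n) K) ×
        (Fin (n + 1) → Matrix.SpecialLinearGroup (Fin n) K)) × (K[X] × (Fin (n + 1) → K[X])) :=
    fun z => ((h0 z, h' z, h z), ((z.2 * h0 z : Matrix (Fin n) (Fin n) K).charpoly,
      fun i => (z.1 * h' z i * z.2 * h z i : Matrix (Fin n) (Fin n) K).charpoly))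
  let T := (H ×ˢ Fintype.piFinset (fun _ : Fin (n + 1) => H) ×ˢ
    Fintype.piFinset (fun _ : Fin (n + 1) => H)) ×ˢ
    (P ×ˢ Fintype.piFinset (fun _ : Fin (n + 1) => P))
  have hT : T.card ≤ c₀ ^ (2 * n + 3) * P.card ^ (n + 2) := by
    simp only [T, Finset.card_product, Fintype.card_piFinset, Finset.prod_const, Finset.card_univ,
      Fintype.card_fin]
    calc _ = H.card ^ (2 * n + 3) * P.card ^ (n + 2) := by ring
      _ ≤ _ := Nat.mul_le_mul_right _ (Nat.pow_le_pow_left hHc _)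
  have hmaps : ∀ z ∈ Z, F z ∈ T := by
    intro z hz
    obtain ⟨⟨hz1, -⟩, hz2, -⟩ := hZ z hz
    have w0 : z.2 * h0 z ∈ prodSet A (2 * k₀ + 5) :=
      prodSet_mono A (by omega) (mul_mem_prodSet A hz2 (hHA _ (hh0 z hz)))
    have w1 : ∀ i, z.1 * h' z i * z.2 * h z i ∈ prodSet A (2 * k₀ + 5) := fun i =>
      prodSet_mono A (by omega) (mul_mem_prodSet A (mul_mem_prodSet A (mul_mem_prodSet A hz1
        (hHA _ (hh' z hz i))) hz2) (hHA _ (hh z hz i)))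
    have p0 := hP _ w0
    have p1 := fun i => hP _ (w1 i)
    simp only [Matrix.SpecialLinearGroup.coe_mul] at p0 p1
    exact Finset.mem_product.mpr ⟨Finset.mem_product.mpr ⟨hh0 z hz, Finset.mem_product.mpr
      ⟨Fintype.mem_piFinset.mpr (hh' z hz), Fintype.mem_piFinset.mpr (hh z hz)⟩⟩,
      Finset.mem_product.mpr ⟨p0 (hs0 z hz), Fintype.mem_piFinset.mpr fun i =>
        p1 i (hs z hz i)⟩⟩
  have hfib : ∀ t ∈ T, (Z.filter fun z => F z = t).card ≤ C := by
    intro t _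
    rcases Finset.eq_empty_or_nonempty (Z.filter fun z => F z = t) with he | ⟨z₀, hz₀⟩
    · rw [he]; simp
    let J : Matrix.SpecialLinearGroup (Fin n) K × Matrix.SpecialLinearGroup (Fin n) K →
      Matrix (Fin n) (Fin n) K × Matrix (Fin n) (Fin n) K := fun z => (z.1, z.2)
    have hJ : Function.Injective J := fun z z' hzz =>
      Prod.ext (Subtype.ext (congrArg Prod.fst hzz)) (Subtype.ext (congrArg Prod.snd hzz))
    rw [← Finset.card_image_of_injective _ hJ]
    have hdeg : ∀ M : Matrix (Fin n) (Fin n) K, M.charpoly.natDegree ≤ n := fun M => by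
      have : Nontrivial K := inferInstance
      rw [Matrix.charpoly_natDegree_eq_dim, Fintype.card_fin]
    refine hC K b (h0 z₀) (fun i => h' z₀ i) (fun i => h z₀ i)
      (z₀.2 * h0 z₀ : Matrix (Fin n) (Fin n) K).charpoly
      (fun i => (z₀.1 * h' z₀ i * z₀.2 * h z₀ i : Matrix (Fin n) (Fin n) K).charpoly) k (by omega)
      (hdeg _) (fun _ => hdeg _) _ fun x hx => ?_
    obtain ⟨z, hz, rfl⟩ := Finset.mem_image.mp hx
    rw [Finset.mem_filter] at hz hz₀
    have hF : F z = F z₀ := hz.2.trans hz₀.2.symm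
    have e1 : h0 z = h0 z₀ := congrArg (fun s => s.1.1) hF
    have e2 : h' z = h' z₀ := congrArg (fun s => s.1.2.1) hF
    have e3 : h z = h z₀ := congrArg (fun s => s.1.2.2) hF
    have e4 : (z.2 * h0 z : Matrix (Fin n) (Fin n) K).charpoly =
      (z₀.2 * h0 z₀ : Matrix (Fin n) (Fin n) K).charpoly := congrArg (fun s => s.2.1) hF
    have e5 : (fun i => (z.1 * h' z i * z.2 * h z i : Matrix (Fin n) (Fin n) K).charpoly) =
      fun i => (z₀.1 * h' z₀ i * z₀.2 * h z₀ i : Matrix (Fin n) (Fin n) K).charpoly :=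
      congrArg (fun s => s.2.2) hF
    have := hc z hz.1
    rw [e4, e5, e1, e2, e3] at this
    exact this
  calc Z.card ≤ C * T.card := Finset.card_le_mul_card_image_of_maps_to hmaps C hfib
    _ ≤ C * (c₀ ^ (2 * n + 3) * P.card ^ (n + 2)) := Nat.mul_le_mul_left _ hT
    _ = _ := by ring

end pairbound

section orbits

theorem orbit_count {n : ℕ} {K : Type} [Field K] [Fintype K]
    (A : Set (Matrix.SpecialLinearGroup (Fin n) K)) (I : Finset (Matrix.SpecialLinearGroup (Fin n) K))
    (hI : I.Nonempty) (hconj : ∀ a ∈ I, ∀ b ∈ I, IsConj a b → a = b) :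
    ∃ b ∈ I, ∃ O T : Finset (Matrix.SpecialLinearGroup (Fin n) K),
      I.card * A.ncard ≤ O.card * T.card ∧ (∀ y ∈ O, ∃ x ∈ A, ∃ a ∈ I, y = x * a * x⁻¹) ∧
      ∀ t ∈ T, t ∈ prodSet A 2 ∧ t * b = b * t := by
  classical
  have hfin : Finite (Matrix.SpecialLinearGroup (Fin n) K) := Subtype.finite
  have : Fintype (Matrix.SpecialLinearGroup (Fin n) K) := Fintype.ofFinite _
  let θ : Matrix.SpecialLinearGroup (Fin n) K → Finset (Matrix.SpecialLinearGroup (Fin n) K) :=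
    fun a => Finset.univ.filter fun t => t ∈ prodSet A 2 ∧ t * a = a * t
  obtain ⟨b, hb, hmax⟩ := Finset.exists_max_image I (fun a => (θ a).card) hI
  let F : Matrix.SpecialLinearGroup (Fin n) K × Matrix.SpecialLinearGroup (Fin n) K →
    Matrix.SpecialLinearGroup (Fin n) K := fun p => p.1 * p.2 * p.1⁻¹
  refine ⟨b, hb, (A.toFinset ×ˢ I).image F, θ b, ?_, ?_, ?_⟩
  · rw [Set.ncard_eq_toFinset_card', mul_comm, ← Finset.card_product, mul_comm]
    refine Finset.card_le_mul_card_image _ _ fun y hy => ?_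
    obtain ⟨⟨x₀, a⟩, hp, rfl⟩ := Finset.mem_image.mp hy
    rw [Finset.mem_product, Set.mem_toFinset] at hp
    refine le_trans ?_ (hmax a hp.2)
    refine Finset.card_le_card_of_injOn (fun p => x₀⁻¹ * p.1) ?_ ?_
    · rintro ⟨x, a'⟩ hx
      rw [Finset.mem_coe, Finset.mem_filter, Finset.mem_product, Set.mem_toFinset] at hx
      have haa : a' = a := hconj _ hx.1.2 _ hp.2 (isConj_iff.mpr ⟨x₀⁻¹ * x, by
        have h2 : x * a' * x⁻¹ = x₀ * a * x₀⁻¹ := hx.2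
        rw [mul_inv_rev, inv_inv]
        calc x₀⁻¹ * x * a' * (x⁻¹ * x₀) = x₀⁻¹ * (x * a' * x⁻¹) * x₀ := by group
          _ = a := by rw [h2]; group⟩)
      subst haa
      rw [Finset.mem_coe, Finset.mem_filter]
      refine ⟨Finset.mem_univ _, mul_mem_prodSet A (inv_mem_prodSet A (mem_prodSet_one A hp.1))
        (mem_prodSet_one A hx.1.1), ?_⟩
      have h2 : x * a' * x⁻¹ = x₀ * a' * x₀⁻¹ := hx.2
      have h3 : x * a' = x₀ * a' * x₀⁻¹ * x := by rw [← h2]; group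
      change x₀⁻¹ * x * a' = a' * (x₀⁻¹ * x)
      rw [mul_assoc, h3]; group
    · rintro ⟨x, a'⟩ hx ⟨x', a''⟩ hx' hxx
      rw [Finset.mem_coe, Finset.mem_filter] at hx hx'
      have h1 : x = x' := mul_left_cancel hxx
      subst h1
      have h2 : x * a' * x⁻¹ = x * a'' * x⁻¹ := hx.2.trans hx'.2.symm
      have h3 : a' = a'' := mul_left_cancel (mul_right_cancel h2)
      rw [h3]
  · intro y hy
    obtain ⟨⟨x, a⟩, hp, rfl⟩ := Finset.mem_image.mp hy
    rw [Finset.mem_product, Set.mem_toFinset] at hp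
    exact ⟨x, hp.1, a, hp.2, rfl⟩
  · intro t ht
    exact (Finset.mem_filter.mp ht).2

theorem conj_mem_prodSet {n : ℕ} {K : Type} [Field K]
    {A : Set (Matrix.SpecialLinearGroup (Fin n) K)} {x a : Matrix.SpecialLinearGroup (Fin n) K}
    {r : ℕ} (hx : x ∈ A) (ha : a ∈ prodSet A r) : x * a * x⁻¹ ∈ prodSet A (r + 2) :=
  prodSet_mono A (by omega) (mul_mem_prodSet A (mul_mem_prodSet A (mem_prodSet_one A hx) ha)
    (inv_mem_prodSet A (mem_prodSet_one A hx)))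

theorem regular_bound (n : ℕ) (hn : 2 ≤ n) (c₀ : ℕ) : ∃ C : ℕ, ∀ (K : Type) [Field K] [Fintype K]
    (H : Finset (Matrix.SpecialLinearGroup (Fin n) K)), Escapes H (3 * n * n + n) → H.card ≤ c₀ →
    ∀ (A : Set (Matrix.SpecialLinearGroup (Fin n) K)) (k₀ : ℕ), (∀ h ∈ H, h ∈ prodSet A k₀) →
    ∀ (r : ℕ) (I : Finset (Matrix.SpecialLinearGroup (Fin n) K)),
    (∀ a ∈ I, a ∈ prodSet A r ∧ (a : Matrix (Fin n) (Fin n) K).charpoly.Separable) →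
    (∀ a ∈ I, ∀ b ∈ I, IsConj a b → a = b) →
    (I.card * A.ncard) ^ (n + 1) ≤ (prodSet A (r + 2)).ncard ^ (n + 1) *
      (C * (prodSet A ((n + 1) * (k₀ + 2))).ncard) := by
  obtain ⟨C, hC⟩ := torus_bound n hn c₀
  refine ⟨C, fun K _ _ H hH hHc A k₀ hHA r I hIA hconj => ?_⟩
  have hfin : Finite (Matrix.SpecialLinearGroup (Fin n) K) := Subtype.finite
  rcases I.eq_empty_or_nonempty with rfl | hI
  · simp
  obtain ⟨b, hb, O, T, hcard, hO, hT⟩ := orbit_count A I hI hconj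
  have h1 := hC K H hH hHc A k₀ hHA b (splitReg_of_separable _ (hIA b hb).2) T fun t ht =>
    ⟨(hT t ht).1, by
      rw [← Matrix.SpecialLinearGroup.coe_mul, (hT t ht).2, Matrix.SpecialLinearGroup.coe_mul]⟩
  have h2 : O.card ≤ (prodSet A (r + 2)).ncard := by
    rw [← Set.ncard_coe_finset]
    refine Set.ncard_le_ncard (fun y hy => ?_) (Set.toFinite _)
    obtain ⟨x, hx, a, ha, rfl⟩ := hO y hy
    exact conj_mem_prodSet hx (hIA a ha).1
  calc _ ≤ (O.card * T.card) ^ (n + 1) := Nat.pow_le_pow_left hcard _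
    _ = O.card ^ (n + 1) * T.card ^ (n + 1) := mul_pow _ _ _
    _ ≤ _ := Nat.mul_le_mul (Nat.pow_le_pow_left h2 _) h1

end orbits

section semisimple
open Polynomial

/-- Conjugation by an invertible element as an algebra automorphism. -/
def conjAlgEquiv (K : Type) {A : Type} [Field K] [Ring A] [Algebra K A] (x xi : A) (h : xi * x = 1)
    (h' : x * xi = 1) : A ≃ₐ[K] A where
  toFun a := x * a * xi
  invFun a := xi * a * x
  left_inv a := by
    calc xi * (x * a * xi) * x = (xi * x) * a * (xi * x) := by noncomm_ring
      _ = a := by rw [h]; simp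
  right_inv a := by
    calc x * (xi * a * x) * xi = (x * xi) * a * (x * xi) := by noncomm_ring
      _ = a := by rw [h']; simp
  map_mul' a b := by
    calc x * (a * b) * xi = x * a * 1 * b * xi := by noncomm_ring
      _ = x * a * xi * (x * b * xi) := by rw [← h]; noncomm_ring
  map_add' a b := by noncomm_ring
  commutes' r := by
    rw [← Algebra.commutes, mul_assoc, h', mul_one]

theorem finrank_centSub_conj {n : ℕ} {K : Type} [Field K] {x xi : Matrix (Fin n) (Fin n) K}
    (h : xi * x = 1) (h' : x * xi = 1) (a : Matrix (Fin n) (Fin n) K) :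
    Module.finrank K (centSub (x * a * xi)) = Module.finrank K (centSub a) := by
  have : centSub (x * a * xi) =
      (centSub a).map ((conjAlgEquiv K x xi h h').toLinearEquiv : _ →ₗ[K] _) := by
    ext X
    rw [Submodule.mem_map_equiv, mem_centSub, mem_centSub]
    set E := conjAlgEquiv K x xi h h' with hE
    have e1 : x * a * xi = E a := rfl
    change _ ↔ E.symm X * a = a * E.symm X
    rw [e1]
    conv_rhs => rw [← E.injective.eq_iff, map_mul, map_mul, E.apply_symm_apply]
  rw [this]
  exact LinearEquiv.finrank_map_eq _ _

theorem minpoly_conj {n : ℕ} {K : Type} [Field K] {x xi : Matrix (Fin n) (Fin n) K}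
    (h : xi * x = 1) (h' : x * xi = 1) (a : Matrix (Fin n) (Fin n) K) :
    minpoly K (x * a * xi) = minpoly K a :=
  minpoly.algEquiv_eq (conjAlgEquiv K x xi h h') a

theorem aeval_eq_zero_iff {n : ℕ} {K : Type} [Field K] (g : Matrix (Fin n) (Fin n) K)
    (P P' : Matrix (Fin n) (Fin n) (AlgebraicClosure K)) (h : P' * P = 1) (h' : P * P' = 1)
    (e : Fin n → AlgebraicClosure K)
    (hg : g.map (algebraMap K (AlgebraicClosure K)) = P * Matrix.diagonal e * P') (p : K[X]) :
    aeval g p = 0 ↔ aeval e p = 0 := by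
  let Ψ : (Fin n → AlgebraicClosure K) →ₐ[K] Matrix (Fin n) (Fin n) (AlgebraicClosure K) :=
    (conjAlgEquiv K P P' h h' : _ →ₐ[K] _).comp (Matrix.diagonalAlgHom K)
  have hΨ : Function.Injective Ψ := (conjAlgEquiv K P P' h h').injective.comp
    Matrix.diagonal_injective
  let Φ : Matrix (Fin n) (Fin n) K →ₐ[K] Matrix (Fin n) (Fin n) (AlgebraicClosure K) :=
    (Algebra.ofId K (AlgebraicClosure K)).mapMatrix
  have hΦ : Function.Injective Φ := Matrix.map_injective (algebraMap K _).injective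
  have h1 : Φ g = Ψ e := hg
  rw [← map_eq_zero_iff Φ hΦ, ← map_eq_zero_iff Ψ hΨ, ← aeval_algHom_apply, ← aeval_algHom_apply,
    h1]

theorem IsSemisimpleElt.exists_diagonal {n : ℕ} {K : Type} [Field K]
    {g : Matrix.SpecialLinearGroup (Fin n) K} (hg : IsSemisimpleElt n K g) :
    ∃ (P P' : Matrix (Fin n) (Fin n) (AlgebraicClosure K)) (e : Fin n → AlgebraicClosure K),
      P' * P = 1 ∧ P * P' = 1 ∧ (g : Matrix (Fin n) (Fin n) K).map (algebraMap K _) =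
        P * Matrix.diagonal e * P' := by
  obtain ⟨P, d, hd, hP⟩ := hg
  refine ⟨P, ↑P⁻¹, d.diag, P.inv_mul, P.mul_inv, ?_⟩
  rw [hd.diagonal_diag]
  exact hP

theorem IsSemisimpleElt.separable {n : ℕ} {K : Type} [Field K] [PerfectField K]
    {g : Matrix.SpecialLinearGroup (Fin n) K} (hg : IsSemisimpleElt n K g) :
    (minpoly K (g : Matrix (Fin n) (Fin n) K)).Separable := by
  obtain ⟨P, P', e, h, h', hg⟩ := hg.exists_diagonal
  rw [PerfectField.separable_iff_squarefree]
  rintro a ⟨c, hac⟩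
  have hf0 : minpoly K (g : Matrix (Fin n) (Fin n) K) ≠ 0 :=
    minpoly.ne_zero (Algebra.IsIntegral.isIntegral _)
  have h1 := (aeval_eq_zero_iff _ P P' h h' e hg _).mp (minpoly.aeval K
    (g : Matrix (Fin n) (Fin n) K))
  have h2 : aeval e (a * c) = 0 := by
    rw [hac, mul_assoc, map_mul] at h1
    rw [map_mul] at h1 ⊢
    funext i
    have h2 := congrFun h1 i
    simp only [Pi.mul_apply, Pi.zero_apply, mul_eq_zero] at h2 ⊢
    tauto
  have h3 := minpoly.dvd K _ ((aeval_eq_zero_iff _ P P' h h' e hg _).mpr h2)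
  rw [hac, mul_assoc] at h3
  rw [hac] at hf0
  obtain ⟨d, hd⟩ := h3
  have hne : a * c ≠ 0 := fun hh => hf0 (by rw [mul_assoc, hh, mul_zero])
  refine IsUnit.of_mul_eq_one d (mul_left_cancel₀ hne ?_)
  linear_combination -hd

end semisimple

section counting
open Polynomial

theorem coe_conj {n : ℕ} {K : Type} [Field K] (x a : Matrix.SpecialLinearGroup (Fin n) K) :
    ((x * a * x⁻¹ : Matrix.SpecialLinearGroup (Fin n) K) : Matrix (Fin n) (Fin n) K) =
      (x : Matrix (Fin n) (Fin n) K) * a *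
        ((x⁻¹ : Matrix.SpecialLinearGroup (Fin n) K) : Matrix (Fin n) (Fin n) K) := by
  rw [Matrix.SpecialLinearGroup.coe_mul, Matrix.SpecialLinearGroup.coe_mul]

theorem coe_inv_mul {n : ℕ} {K : Type} [Field K] (x : Matrix.SpecialLinearGroup (Fin n) K) :
    ((x⁻¹ : Matrix.SpecialLinearGroup (Fin n) K) : Matrix (Fin n) (Fin n) K) * x = 1 := by
  rw [← Matrix.SpecialLinearGroup.coe_mul, inv_mul_cancel, Matrix.SpecialLinearGroup.coe_one]

theorem coe_mul_inv {n : ℕ} {K : Type} [Field K] (x : Matrix.SpecialLinearGroup (Fin n) K) :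
    (x : Matrix (Fin n) (Fin n) K) *
      ((x⁻¹ : Matrix.SpecialLinearGroup (Fin n) K) : Matrix (Fin n) (Fin n) K) = 1 := by
  rw [← Matrix.SpecialLinearGroup.coe_mul, mul_inv_cancel, Matrix.SpecialLinearGroup.coe_one]

theorem IsSemisimpleElt.le_finrank_centSub {n : ℕ} {K : Type} [Field K]
    {g : Matrix.SpecialLinearGroup (Fin n) K} (hg : IsSemisimpleElt n K g) :
    n ≤ Module.finrank K (centSub (g : Matrix (Fin n) (Fin n) K)) := by
  obtain ⟨P, P', e, h, -, hg⟩ := hg.exists_diagonal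
  exact _root_.le_finrank_centSub _ P P' e h hg

theorem IsConj.charpoly_eq {n : ℕ} {K : Type} [Field K]
    {a b : Matrix.SpecialLinearGroup (Fin n) K} (h : IsConj a b) :
    (a : Matrix (Fin n) (Fin n) K).charpoly = (b : Matrix (Fin n) (Fin n) K).charpoly := by
  obtain ⟨c, rfl⟩ := isConj_iff.mp h
  rw [coe_conj, Matrix.charpoly_mul_comm, ← mul_assoc, coe_inv_mul, one_mul]

theorem nonregular_bound (n : ℕ) (hn : 2 ≤ n) (c₀ : ℕ) : ∃ C : ℕ, ∀ (K : Type) [Field K]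
    [Fintype K] (H : Finset (Matrix.SpecialLinearGroup (Fin n) K)),
    Escapes H (3 * n * n + n) → H.card ≤ c₀ →
    ∀ (A : Set (Matrix.SpecialLinearGroup (Fin n) K)) (k₀ : ℕ), (∀ h ∈ H, h ∈ prodSet A k₀) →
    ∀ P : Finset K[X],
    (∀ w ∈ prodSet A (2 * k₀ + 5), (w : Matrix (Fin n) (Fin n) K).charpoly.Separable →
      (w : Matrix (Fin n) (Fin n) K).charpoly ∈ P) →
    ∀ (k l : ℕ), k + 1 ≤ n → ∀ (I : Finset (Matrix.SpecialLinearGroup (Fin n) K)),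
    (∀ a ∈ I, a ∈ A ∧ IsSemisimpleElt n K a ∧
      (minpoly K (a : Matrix (Fin n) (Fin n) K)).natDegree = k ∧
      Module.finrank K (centSub (a : Matrix (Fin n) (Fin n) K)) = l) →
    (∀ a ∈ I, ∀ b ∈ I, IsConj a b → a = b) →
    I.card * A.ncard ≤ C * P.card ^ (n + 2) := by
  obtain ⟨C, hC⟩ := pair_bound n hn c₀
  refine ⟨C, fun K _ _ H hH hHc A k₀ hHA P hP k l hkn I hI hconj => ?_⟩
  rcases I.eq_empty_or_nonempty with rfl | hI0
  · simp
  obtain ⟨b, hb, O, T, hcard, hO, hT⟩ := orbit_count A I hI0 hconj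
  refine hcard.trans ?_
  rw [← Finset.card_product]
  refine hC K H hH hHc A k₀ hHA b k hkn (hI b hb).2.1.separable (hI b hb).2.1.le_finrank_centSub
    P hP _ fun z hz => ?_
  rw [Finset.mem_product] at hz
  obtain ⟨x, hx, a, ha, hxa⟩ := hO _ hz.1
  refine ⟨?_, (hT _ hz.2).1, ?_⟩
  · rw [hxa, coe_conj, minpoly_conj (coe_inv_mul x) (coe_mul_inv x),
      finrank_centSub_conj (coe_inv_mul x) (coe_mul_inv x)]
    exact ⟨conj_mem_prodSet hx (mem_prodSet_one A (hI a ha).1), (hI a ha).2.1.separable,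
      (hI a ha).2.2.1, (hI a ha).2.2.2.trans (hI b hb).2.2.2.symm⟩
  · rw [← Matrix.SpecialLinearGroup.coe_mul, (hT _ hz.2).2, Matrix.SpecialLinearGroup.coe_mul]

theorem exists_image_representatives {α β : Type*} [Finite α] (S : Set α) (f : α → β) :
    ∃ I : Finset α, (∀ a ∈ I, a ∈ S) ∧ I.card = (f '' S).ncard ∧
      ∀ a ∈ I, ∀ b ∈ I, f a = f b → a = b := by
  obtain ⟨t, ht, hf⟩ := Set.exists_subset_bijOn S f
  refine ⟨(Set.toFinite t).toFinset, fun a ha => ht (by simpa using ha), ?_, fun a ha b hb hab =>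
    hf.injOn (by simpa using ha) (by simpa using hb) hab⟩
  rw [← Set.ncard_eq_toFinset_card, ← hf.image_eq, hf.injOn.ncard_image]

theorem charpoly_separable_of_natDegree {n : ℕ} {K : Type} [Field K]
    {a : Matrix (Fin n) (Fin n) K} (h : (minpoly K a).Separable)
    (hd : ¬ (minpoly K a).natDegree + 1 ≤ n) : a.charpoly.Separable := by
  have h1 : a.charpoly = minpoly K a :=
    Polynomial.eq_of_monic_of_dvd_of_natDegree_le
      (minpoly.monic (Algebra.IsIntegral.isIntegral _)) a.charpoly_monic
      (Matrix.minpoly_dvd_charpoly a) (by rw [Matrix.charpoly_natDegree_eq_dim, Fintype.card_fin]; omega)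
  rwa [h1]

/-- The numerical form of the estimate: `m₁` counts regular classes, `m₂` bounds the number of
nonregular classes of each type, and `M` counts separable characteristic polynomials. -/
theorem main_count (n : ℕ) (hn : 2 ≤ n) : ∃ C r : ℕ, 1 ≤ C ∧ 3 ≤ r ∧ ∀ (K : Type) [Field K]
    [Fintype K], C ≤ Fintype.card K → ∀ A : Set (Matrix.SpecialLinearGroup (Fin n) K),
    Subgroup.closure A = ⊤ → ∃ m₁ m₂ M : ℕ,
      (ConjClasses.mk '' {g ∈ A | IsSemisimpleElt n K g}).ncard ≤ m₁ + C * m₂ ∧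
      (m₁ * A.ncard) ^ (n + 1) ≤ (prodSet A r).ncard ^ (n + 1) * (C * (prodSet A r).ncard) ∧
      m₂ * A.ncard ≤ C * M ^ (n + 2) ∧
      (M * A.ncard) ^ (n + 1) ≤ (prodSet A r).ncard ^ (n + 1) * (C * (prodSet A r).ncard) := by
  classical
  obtain ⟨k₀, c₀, hesc⟩ := exists_escape n (3 * n * n + n) (by omega)
  obtain ⟨C₁, hC₁⟩ := regular_bound n hn c₀
  obtain ⟨C₂, hC₂⟩ := nonregular_bound n hn c₀
  refine ⟨c₀ + C₁ + C₂ + n * (n * n + 1) + 1, (2 * k₀ + 7) + (n + 1) * (k₀ + 2), by omega, by omega,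
    fun K _ _ hK A hA => ?_⟩
  obtain ⟨H, hHA, hHc, hH⟩ := hesc K (by omega) A hA
  have hfin : Finite (Matrix.SpecialLinearGroup (Fin n) K) := Subtype.finite
  set C := c₀ + C₁ + C₂ + n * (n * n + 1) + 1 with hCdef
  set r := (2 * k₀ + 7) + (n + 1) * (k₀ + 2) with hr
  have hmono : ∀ s, s ≤ r → (prodSet A s).ncard ≤ (prodSet A r).ncard := fun s hs =>
    Set.ncard_le_ncard (prodSet_mono A hs) (Set.toFinite _)
  have hreg : ∀ (s : ℕ) (I : Finset (Matrix.SpecialLinearGroup (Fin n) K)), s + 2 ≤ 2 * k₀ + 7 →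
      (∀ a ∈ I, a ∈ prodSet A s ∧ (a : Matrix (Fin n) (Fin n) K).charpoly.Separable) →
      (∀ a ∈ I, ∀ b ∈ I, IsConj a b → a = b) →
      (I.card * A.ncard) ^ (n + 1) ≤
        (prodSet A r).ncard ^ (n + 1) * (C * (prodSet A r).ncard) := fun s I hs h1 h2 =>
    (hC₁ K H hH hHc A k₀ hHA s I h1 h2).trans (Nat.mul_le_mul
      (Nat.pow_le_pow_left (hmono _ (by omega)) _) (Nat.mul_le_mul (by omega) (hmono _ (by omega))))
  obtain ⟨R, hRS, hRcard, hRinj⟩ := exists_image_representatives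
    {w ∈ prodSet A (2 * k₀ + 5) | (w : Matrix (Fin n) (Fin n) K).charpoly.Separable}
    (fun w => (w : Matrix (Fin n) (Fin n) K).charpoly)
  set PS := (fun w : Matrix.SpecialLinearGroup (Fin n) K => (w : Matrix (Fin n) (Fin n) K).charpoly) ''
    {w ∈ prodSet A (2 * k₀ + 5) | (w : Matrix (Fin n) (Fin n) K).charpoly.Separable} with hPS
  have hPSfin : PS.Finite := Set.toFinite _
  obtain ⟨J, hJS, hJcard, hJinj⟩ := exists_image_representatives
    {g ∈ A | IsSemisimpleElt n K g} (fun g => ConjClasses.mk g)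
  have hJconj : ∀ a ∈ J, ∀ b ∈ J, IsConj a b → a = b := fun a ha b hb h =>
    hJinj a ha b hb (ConjClasses.mk_eq_mk_iff_isConj.mpr h)
  let dg : Matrix.SpecialLinearGroup (Fin n) K → ℕ := fun a =>
    (minpoly K (a : Matrix (Fin n) (Fin n) K)).natDegree
  let cd : Matrix.SpecialLinearGroup (Fin n) K → ℕ := fun a =>
    Module.finrank K (centSub (a : Matrix (Fin n) (Fin n) K))
  have hcd : ∀ a, cd a < n * n + 1 := fun a => by
    have := Submodule.finrank_le (centSub (a : Matrix (Fin n) (Fin n) K))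
    rw [Module.finrank_matrix, Fintype.card_fin, Module.finrank_self, mul_one] at this
    exact Nat.lt_succ_of_le this
  have hM : (PS.ncard * A.ncard) ^ (n + 1) ≤
      (prodSet A r).ncard ^ (n + 1) * (C * (prodSet A r).ncard) := by
    rw [← hRcard]
    exact hreg _ R le_rfl (fun a ha => hRS a ha) fun a ha b hb h => hRinj a ha b hb h.charpoly_eq
  have hnr : ∀ kl : ℕ × ℕ, kl.1 + 1 ≤ n →
      (J.filter fun a => (dg a, cd a) = kl).card * A.ncard ≤ C * PS.ncard ^ (n + 2) := by
    intro kl hk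
    have := hC₂ K H hH hHc A k₀ hHA hPSfin.toFinset (fun w hw hs => by
      rw [Set.Finite.mem_toFinset]; exact ⟨w, ⟨hw, hs⟩, rfl⟩) kl.1 kl.2 hk
      (J.filter fun a => (dg a, cd a) = kl) (fun a ha => by
        obtain ⟨ha, hkl⟩ := Finset.mem_filter.mp ha
        exact ⟨(hJS a ha).1, (hJS a ha).2, congrArg Prod.fst hkl, congrArg Prod.snd hkl⟩)
      (fun a ha b hb => hJconj a (Finset.mem_filter.mp ha).1 b (Finset.mem_filter.mp hb).1)
    rw [← Set.ncard_eq_toFinset_card _ hPSfin] at this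
    exact this.trans (Nat.mul_le_mul_right _ (by omega))
  obtain ⟨kl, hkl, hmax⟩ := Finset.exists_max_image (Finset.range n ×ˢ Finset.range (n * n + 1))
    (fun kl => (J.filter fun a => (dg a, cd a) = kl).card) ⟨(0, 0), by simp; omega⟩
  refine ⟨(J.filter fun a => ¬ dg a + 1 ≤ n).card, (J.filter fun a => (dg a, cd a) = kl).card,
    PS.ncard, ?_, ?_, hnr kl (Finset.mem_range.mp (Finset.mem_product.mp hkl).1), hM⟩
  · rw [← hJcard, ← Finset.card_filter_add_card_filter_not (s := J) (fun a => dg a + 1 ≤ n), add_comm]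
    refine Nat.add_le_add_left ?_ _
    refine (Finset.card_le_mul_card_image_of_maps_to (f := fun a => (dg a, cd a))
      (t := Finset.range n ×ˢ Finset.range (n * n + 1)) (fun a ha => ?_) _ fun kl' hkl' =>
        (Finset.card_le_card ?_).trans (hmax kl' hkl')).trans ?_
    · exact Finset.mem_product.mpr ⟨Finset.mem_range.mpr (Finset.mem_filter.mp ha).2,
        Finset.mem_range.mpr (hcd a)⟩
    · exact Finset.filter_subset_filter _ (Finset.filter_subset _ _)
    · rw [Finset.card_product, Finset.card_range, Finset.card_range, mul_comm]
      exact Nat.mul_le_mul_right _ (by omega)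
  · refine hreg 1 _ (by omega) (fun a ha => ?_) fun a ha b hb =>
      hJconj a (Finset.mem_filter.mp ha).1 b (Finset.mem_filter.mp hb).1
    obtain ⟨ha, hd⟩ := Finset.mem_filter.mp ha
    exact ⟨mem_prodSet_one A (hJS a ha).1,
      charpoly_separable_of_natDegree (hJS a ha).2.separable hd⟩

end counting

section growth

theorem card_pow_three_union_inv_le {G : Type*} [Group G] [DecidableEq G] (A : Finset G)
    {t : ℝ} (ht : ((A ^ 3).card : ℝ) ≤ t * A.card) :
    (((A ∪ A⁻¹) ^ 3).card : ℝ) ≤ 8 * t ^ 3 * A.card := by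
  let W : (Fin 3 → Bool) → Finset G := fun e =>
    ((List.finRange 3).map fun i => A ^ (if e i then 1 else -1 : ℤ)).prod
  have hW : ∀ e, ((W e).card : ℝ) ≤ t ^ 3 * A.card := fun e =>
    Finset.small_alternating_pow_of_small_tripling (m := 3) le_rfl ht _ fun i => by split_ifs <;> simp
  have hsub : (A ∪ A⁻¹) ^ 3 ⊆ Finset.univ.biUnion W := by
    intro g hg
    rw [pow_succ, pow_two, Finset.mem_mul] at hg
    obtain ⟨xy, hxy, z, hz, rfl⟩ := hg
    obtain ⟨x, hx, y, hy, rfl⟩ := Finset.mem_mul.mp hxy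
    have key : ∀ x ∈ A ∪ A⁻¹, ∃ b : Bool, x ∈ A ^ (if b then 1 else -1 : ℤ) := fun x hx => by
      rcases Finset.mem_union.mp hx with h | h
      · exact ⟨true, by simpa using h⟩
      · exact ⟨false, by simpa using h⟩
    obtain ⟨b₁, h₁⟩ := key x hx
    obtain ⟨b₂, h₂⟩ := key y hy
    obtain ⟨b₃, h₃⟩ := key z hz
    refine Finset.mem_biUnion.mpr ⟨![b₁, b₂, b₃], Finset.mem_univ _, ?_⟩
    have : W ![b₁, b₂, b₃] = A ^ (if b₁ then 1 else -1 : ℤ) * A ^ (if b₂ then 1 else -1 : ℤ) *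
        A ^ (if b₃ then 1 else -1 : ℤ) := by
      cases b₁ <;> cases b₂ <;> cases b₃ <;> simp [W, List.finRange_succ, mul_assoc]
    rw [this]
    exact Finset.mul_mem_mul (Finset.mul_mem_mul h₁ h₂) h₃
  calc (((A ∪ A⁻¹) ^ 3).card : ℝ) ≤ ∑ e, ((W e).card : ℝ) := by
        exact_mod_cast (Finset.card_le_card hsub).trans Finset.card_biUnion_le
    _ ≤ ∑ e : Fin 3 → Bool, t ^ 3 * A.card := Finset.sum_le_sum fun e _ => hW e
    _ = 8 * t ^ 3 * A.card := by
        rw [Finset.sum_const, Finset.card_univ, Fintype.card_fun]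
        simp; ring

theorem card_pow_three_insert_one_le {G : Type*} [Group G] [DecidableEq G] {S : Finset G}
    (hS : S.Nonempty) : ((S ∪ {1}) ^ 3).card ≤ 4 * (S ^ 3).card := by
  have hsub : (S ∪ {1}) ^ 3 ⊆ (Finset.range 4).biUnion fun k => S ^ k := by
    intro g hg
    rw [pow_succ, pow_two, Finset.mem_mul] at hg
    obtain ⟨xy, hxy, z, hz, rfl⟩ := hg
    obtain ⟨x, hx, y, hy, rfl⟩ := Finset.mem_mul.mp hxy
    have key : ∀ x ∈ S ∪ {1}, ∃ b < 2, x ∈ S ^ b := fun x hx => by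
      rcases Finset.mem_union.mp hx with h | h
      · exact ⟨1, by omega, by simpa using h⟩
      · exact ⟨0, by omega, by simpa using h⟩
    obtain ⟨b₁, hb₁, h₁⟩ := key x hx
    obtain ⟨b₂, hb₂, h₂⟩ := key y hy
    obtain ⟨b₃, hb₃, h₃⟩ := key z hz
    refine Finset.mem_biUnion.mpr ⟨b₁ + b₂ + b₃, Finset.mem_range.mpr (by omega), ?_⟩
    rw [pow_add, pow_add]
    exact Finset.mul_mem_mul (Finset.mul_mem_mul h₁ h₂) h₃
  refine (Finset.card_le_card hsub).trans ?_
  have := Finset.card_biUnion_le_card_mul (Finset.range 4) (fun k => S ^ k) (S ^ 3).card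
    fun k hk => hS.card_pow_mono (by rw [Finset.mem_range] at hk; omega)
  simpa using this

theorem ncard_prodSet_le {G : Type*} [Group G] [Finite G] (A : Set G) (hA : A.Nonempty) {t : ℝ}
    (ht1 : 1 ≤ t) (ht : ((A * A * A).ncard : ℝ) ≤ t * A.ncard) {r : ℕ} (hr : 3 ≤ r) :
    ((prodSet A r).ncard : ℝ) ≤ 3 * 32 ^ r * t ^ (3 * r) * A.ncard := by
  classical
  have : Fintype G := Fintype.ofFinite G
  obtain ⟨B, rfl⟩ : ∃ B : Finset G, A = B := ⟨A.toFinset, by simp⟩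
  have hB : B.Nonempty := by simpa using hA
  set S := B ∪ B⁻¹ ∪ {1} with hS
  have e1 : prodSet (B : Set G) r = ((S ^ r : Finset G) : Set G) := by
    rw [prodSet, Finset.coe_pow, hS]
    push_cast
    rfl
  have e2 : (B : Set G) * B * B = ((B ^ 3 : Finset G) : Set G) := by
    rw [Finset.coe_pow, pow_succ, pow_two]
  rw [e2, Set.ncard_coe_finset, Set.ncard_coe_finset] at ht
  rw [e1, Set.ncard_coe_finset, Set.ncard_coe_finset]
  have hBS : (B.card : ℝ) ≤ S.card := by
    exact_mod_cast Finset.card_le_card (by rw [hS, Finset.union_assoc]; exact Finset.subset_union_left)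
  have hSB : (S.card : ℝ) ≤ 3 * B.card := by
    have h1 := Finset.card_union_le (B ∪ B⁻¹) {1}
    have h2 := Finset.card_union_le B B⁻¹
    rw [Finset.card_inv] at h2
    have h3 := hB.card_pos
    rw [Finset.card_singleton] at h1
    have h4 : S.card ≤ 3 * B.card := by rw [hS]; omega
    exact_mod_cast h4
  have h3 : ((S ^ 3).card : ℝ) ≤ (32 * t ^ 3) * S.card := by
    calc ((S ^ 3).card : ℝ) ≤ 4 * ((B ∪ B⁻¹) ^ 3).card := by
          exact_mod_cast card_pow_three_insert_one_le (hB.mono Finset.subset_union_left)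
      _ ≤ 4 * (8 * t ^ 3 * B.card) := by gcongr; exact card_pow_three_union_inv_le B ht
      _ = 32 * t ^ 3 * B.card := by ring
      _ ≤ _ := by gcongr
  have hsymm : S⁻¹ = S := by
    ext g
    simp [hS, or_comm]
  have h32 : 1 ≤ 32 * t ^ 3 := by
    have := one_le_pow₀ ht1 (n := 3)
    linarith
  calc ((S ^ r).card : ℝ) ≤ (32 * t ^ 3) ^ (r - 2) * S.card :=
        Finset.small_pow_of_small_tripling hr h3 hsymm
    _ ≤ (32 * t ^ 3) ^ r * (3 * B.card) := by gcongr; omega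
    _ = _ := by rw [mul_pow, ← pow_mul]; ring

theorem le_of_mul_pow_le {n : ℕ} {C a X y ρ m : ℝ} (hC : 1 ≤ C) (ha : 0 < a) (hy : 0 ≤ y)
    (hX : 0 ≤ X) (hm : (m * a) ^ (n + 1) ≤ X ^ (n + 1) * (C * X)) (hyX : y ^ (n + 1) = X)
    (hρ : X ≤ ρ * a) : m ≤ ρ * C * y := by
  have h1 : m * a ≤ X * C * y := by
    by_contra! h
    have h2 : (X * C * y) ^ (n + 1) < (m * a) ^ (n + 1) :=
      pow_lt_pow_left₀ h (by positivity) (by omega)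
    have h3 : X ^ (n + 1) * (C * X) ≤ (X * C * y) ^ (n + 1) := by
      rw [mul_pow, mul_pow, hyX, mul_assoc]
      gcongr
      exact le_self_pow₀ hC (by omega)
    linarith
  refine le_of_mul_le_mul_right (h1.trans ?_) ha
  calc X * C * y ≤ ρ * a * C * y := by gcongr
    _ = _ := by ring

theorem count_le {n : ℕ} {C a X y ρ m₁ m₂ M : ℝ} (hC : 1 ≤ C) (ha : 0 < a) (hy : 0 ≤ y)
    (hX : 0 ≤ X) (hyX : y ^ (n + 1) = X) (hρ : X ≤ ρ * a) (hρ1 : 1 ≤ ρ) (hM0 : 0 ≤ M)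
    (h₁ : (m₁ * a) ^ (n + 1) ≤ X ^ (n + 1) * (C * X)) (h₂ : m₂ * a ≤ C * M ^ (n + 2))
    (hM : (M * a) ^ (n + 1) ≤ X ^ (n + 1) * (C * X)) :
    m₁ + C * m₂ ≤ 2 * C ^ (n + 4) * ρ ^ (n + 3) * y := by
  have e1 := le_of_mul_pow_le hC ha hy hX h₁ hyX hρ
  have e2 := le_of_mul_pow_le hC ha hy hX hM hyX hρ
  have e3 : m₂ ≤ C ^ (n + 3) * ρ ^ (n + 3) * y := by
    refine le_of_mul_le_mul_right (h₂.trans ?_) ha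
    calc C * M ^ (n + 2) ≤ C * (ρ * C * y) ^ (n + 2) := by gcongr
      _ = C ^ (n + 3) * ρ ^ (n + 2) * (y ^ (n + 1) * y) := by ring
      _ ≤ C ^ (n + 3) * ρ ^ (n + 2) * (ρ * a * y) := by rw [hyX]; gcongr
      _ = _ := by ring
  have e4 : ρ * C * y ≤ ρ ^ (n + 3) * C ^ (n + 4) * y := by
    gcongr
    · exact le_self_pow₀ hρ1 (by omega)
    · exact le_self_pow₀ hC (by omega)
  calc m₁ + C * m₂ ≤ ρ ^ (n + 3) * C ^ (n + 4) * y + C * (C ^ (n + 3) * ρ ^ (n + 3) * y) := by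
        gcongr; exact e1.trans e4
    _ = _ := by ring

theorem natCard_specialLinearGroup_le (n : ℕ) (K : Type) [Field K] [Fintype K] :
    Nat.card (Matrix.SpecialLinearGroup (Fin n) K) ≤ Fintype.card K ^ (n * n) := by
  have := Nat.card_le_card_of_injective
    (fun g : Matrix.SpecialLinearGroup (Fin n) K => (g : Matrix (Fin n) (Fin n) K))
    Subtype.val_injective
  refine this.trans_eq ?_
  rw [Matrix, Nat.card_fun, Nat.card_fun, Nat.card_fin, Nat.card_eq_fintype_card, pow_mul]

end growth

/-- For `n ≥ 2` there exist `d', δ > 0` and `k' ≥ 1` such that for every finite field `K`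
of characteristic `≠ 2`, all `d, ε > 0`, and every generating set `A` of `SL_n(K)` with
`|A·A·A| ≤ d·|A|^(1+ε)`, the number of conjugacy classes of `SL_n(K)` meeting the set
`A'` of semisimple elements of `A` is at most `d'·d^δ·|A_{k'}|^(1/(n+1) + δε)`. -/
theorem statement_5 (n : ℕ) (hn : 2 ≤ n) :
    ∃ (d' δ : ℝ) (k' : ℕ), 0 < d' ∧ 0 < δ ∧ 0 < k' ∧
      ∀ (K : Type) [Field K] [Fintype K], ringChar K ≠ 2 →
        ∀ d ε : ℝ, 0 < d → 0 < ε →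
          ∀ A : Set (Matrix.SpecialLinearGroup (Fin n) K),
            Subgroup.closure A = ⊤ →
            ((A * A * A).ncard : ℝ) ≤ d * (A.ncard : ℝ) ^ (1 + ε) →
            ((ConjClasses.mk '' {g ∈ A | IsSemisimpleElt n K g}).ncard : ℝ) ≤
              d' * d ^ δ * ((prodSet A k').ncard : ℝ) ^ ((1 : ℝ) / (n + 1) + δ * ε) := by
  obtain ⟨C, r, hC, hr, hmain⟩ := main_count n hn
  set c : ℕ := 3 * r * (n + 3) with hc
  have hc0 : 0 < c := by positivity
  refine ⟨2 * C ^ (n + 4) * (3 * 32 ^ r) ^ (n + 3) + C ^ (n * n), c, r, by positivity,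
    by exact_mod_cast hc0, by omega, fun K _ _ _ d ε hd hε A hA hAAA => ?_⟩
  have hfin : Finite (Matrix.SpecialLinearGroup (Fin n) K) := Subtype.finite
  rcases A.eq_empty_or_nonempty with rfl | hne
  · simp only [Set.mem_empty_iff_false, false_and, Set.ofPred_false, Set.image_empty,
      Set.ncard_empty, Nat.cast_zero]
    positivity
  have ha : (1 : ℝ) ≤ A.ncard := by
    exact_mod_cast (Set.ncard_pos (Set.toFinite A)).mpr hne
  set X : ℝ := ((prodSet A r).ncard : ℝ) with hX
  have haX : (A.ncard : ℝ) ≤ X := by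
    rw [hX]
    exact_mod_cast Set.ncard_le_ncard (fun x hx => prodSet_mono A (by omega)
      (mem_prodSet_one A hx)) (Set.toFinite _)
  have hX1 : 1 ≤ X := ha.trans haX
  set t : ℝ := d * X ^ ε with ht
  have hAt : ((A * A * A).ncard : ℝ) ≤ t * A.ncard := by
    refine hAAA.trans ?_
    rw [Real.rpow_add (by linarith), Real.rpow_one, ht]
    have : (A.ncard : ℝ) ^ ε ≤ X ^ ε := Real.rpow_le_rpow (by linarith) haX hε.le
    calc d * (A.ncard * (A.ncard : ℝ) ^ ε) ≤ d * (A.ncard * X ^ ε) := by gcongr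
      _ = _ := by ring
  have ht1 : 1 ≤ t := by
    have h1 : (A.ncard : ℝ) ≤ (A * A * A).ncard := by
      obtain ⟨x, hx⟩ := hne
      have : A.ncard ≤ (A * A * A).ncard := by
        rw [← Set.ncard_image_of_injective A (mul_right_injective (x * x))]
        exact Set.ncard_le_ncard (by
          rintro _ ⟨y, hy, rfl⟩
          exact Set.mul_mem_mul (Set.mul_mem_mul hx hx) hy) (Set.toFinite _)
      exact_mod_cast this
    refine le_of_mul_le_mul_right (a := (A.ncard : ℝ)) ?_ (by linarith)
    linarith
  set y : ℝ := X ^ ((1 : ℝ) / (n + 1)) with hy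
  have hy1 : 1 ≤ y := Real.one_le_rpow hX1 (by positivity)
  have hyX : y ^ (n + 1) = X := by
    rw [hy, ← Real.rpow_natCast, ← Real.rpow_mul (by linarith)]
    push_cast
    rw [one_div_mul_cancel (by positivity), Real.rpow_one]
  have hR : d ^ (c : ℝ) * X ^ ((1 : ℝ) / (n + 1) + c * ε) = t ^ c * y := by
    rw [Real.rpow_add (by linarith), ht, mul_pow, mul_comm (c : ℝ) ε,
      Real.rpow_mul (by linarith) ε, Real.rpow_natCast, Real.rpow_natCast]
    ring
  rw [mul_assoc, hR, add_mul]
  have htc : 1 ≤ t ^ c := one_le_pow₀ ht1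
  by_cases hK : C ≤ Fintype.card K
  · obtain ⟨m₁, m₂, M, h0, h1, h2, h3⟩ := hmain K hK A hA
    have hgrow := ncard_prodSet_le A hne ht1 hAt hr
    rw [← hX] at hgrow
    have hρ1 : 1 ≤ 3 * 32 ^ r * t ^ (3 * r) := by
      have := one_le_pow₀ ht1 (n := 3 * r)
      have h32 := one_le_pow₀ (by norm_num : (1 : ℝ) ≤ 32) (n := r)
      nlinarith
    have := count_le (n := n) (C := C) (a := A.ncard) (X := X) (y := y) (m₁ := m₁) (m₂ := m₂) (M := M)
      (by exact_mod_cast hC) (by linarith) (by linarith) (by linarith) hyX hgrow hρ1 (by positivity)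
      (by rw [hX]; exact_mod_cast h1) (by exact_mod_cast h2) (by rw [hX]; exact_mod_cast h3)
    calc ((ConjClasses.mk '' {g ∈ A | IsSemisimpleElt n K g}).ncard : ℝ) ≤ m₁ + C * m₂ := by
          exact_mod_cast h0
      _ ≤ 2 * C ^ (n + 4) * (3 * 32 ^ r * t ^ (3 * r)) ^ (n + 3) * y := this
      _ = 2 * C ^ (n + 4) * (3 * 32 ^ r) ^ (n + 3) * (t ^ c * y) := by
          rw [mul_pow (3 * 32 ^ r : ℝ), ← pow_mul, ← hc]; ring
      _ ≤ _ := le_add_of_nonneg_right (by positivity)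
  · have h1 : (ConjClasses.mk '' {g ∈ A | IsSemisimpleElt n K g}).ncard ≤ C ^ (n * n) :=
      calc _ ≤ {g ∈ A | IsSemisimpleElt n K g}.ncard := Set.ncard_image_le (Set.toFinite _)
        _ ≤ Nat.card (Matrix.SpecialLinearGroup (Fin n) K) := Set.ncard_le_card _
        _ ≤ _ := natCard_specialLinearGroup_le n K
        _ ≤ _ := Nat.pow_le_pow_left (by omega) _
    calc ((ConjClasses.mk '' {g ∈ A | IsSemisimpleElt n K g}).ncard : ℝ) ≤ C ^ (n * n) := by
          exact_mod_cast h1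
      _ ≤ C ^ (n * n) * (t ^ c * y) := le_mul_of_one_le_right (by positivity)
          (one_le_mul_of_one_le_of_one_le htc hy1)
      _ ≤ _ := le_add_of_nonneg_left (by positivity)
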